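/- Let d ≥ 2. Define c₃(2) = 1/2, c₃(3) = 1/15, and for d ≥ 4 set c₃(d) = 2h(d)/(1−h(d)) if 4 ≤ d ≤ 11, c₃(d) = 2k(d)/(1−k(d)) if d even, d ≥ 12, and c₃(d) = 2l(d)/(1−l(d)) if d odd, d ≥ 12. Define θ(2,c) = (4c+7)/13, θ(3,c) = (15c+14)/30, θ(d,c) = ((1+c)/2)(1−h(d)) for 4 ≤ d ≤ 11, θ(d,c) = ((1+c)/2)(1−k(d)) for even d ≥ 12, and θ(d,c) = ((1+c)/2)(1−l(d)) for odd d ≥ 12. Then for c ∈ (1, 1+c₃(d)), uniformly for all θ ∈ [0,1), ∑_{m≤x, m∈ℕ^c} c m^{d−1/c} e(m^d θ) = ∑_{m≤x} m^{d−1} e(m^d θ) + O(x^{d − (1−θ(d,c))/c + ε}). -/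

import Mathlib

open scoped BigOperators Classical
open Real

noncomputable section

/-- `e(t) = e^{2πit}`. -/
def eC (t : ℝ) : ℂ := Complex.exp (2 * Real.pi * Complex.I * t)

/-- The Piatetski-Shapiro set `ℕ^c = {⌊n^c⌋ : n ∈ ℕ}`. -/
def PS (c : ℝ) : Set ℕ := {m | ∃ n : ℕ, 0 < n ∧ m = ⌊(n : ℝ) ^ c⌋₊}

/-- The Fourier transform `f̂(α) = ∑_{n ∈ ℤ} f(n) e(αn)` of a finitely
supported function on `ℤ`. -/
def FT (f : ℤ → ℂ) (α : ℝ) : ℂ := ∑ᶠ n : ℤ, f n * eC (α * n)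

/-- `w = (1/2) log log x`. -/
def wps (x : ℕ) : ℝ := Real.log (Real.log x) / 2

/-- `W = 4 d³ ∏_{p ≤ w} p`. -/
def Wps (d x : ℕ) : ℕ :=
  4 * d ^ 3 * ∏ p ∈ Finset.filter Nat.Prime (Finset.Iic ⌊wps x⌋₊), p

/-- `σ(b) = #{z ∈ [W] : z^d ≡ -b (mod W)}`. -/
def sigmaPS (d W b : ℕ) : ℕ :=
  ((Finset.Icc 1 W).filter fun z => (z ^ d + b) % W = 0).card

/-- `N = ⌊x^d / W⌋ + 1`. -/
def Nps (d x : ℕ) : ℕ := ⌊(x : ℝ) ^ d / (Wps d x : ℝ)⌋₊ + 1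

/-- `b ∈ [W]` and `-b ∈ (ℤ/Wℤ)^{×d}`. -/
def bSpec (d x b : ℕ) : Prop :=
  b ∈ Finset.Icc 1 (Wps d x) ∧
    ∃ z : (ZMod (Wps d x))ˣ, (z : ZMod (Wps d x)) ^ d = -(b : ZMod (Wps d x))

/-- `S(d) = 2⌊d²/2⌋`. -/
def Sd (d : ℕ) : ℕ := 2 * (d ^ 2 / 2)

def hD (d : ℕ) : ℝ := 1 / ((d : ℝ) * ((d : ℝ) + 1) ^ 2 - 1)
def kD (d : ℕ) : ℝ := 2 / (27 * (d : ℝ) ^ 2 - 14)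
def lD (d : ℕ) : ℝ := 2 / (27 * (d : ℝ) ^ 2 - 5)

/-- `θ(d, c)`. -/
def θdc (d : ℕ) (c : ℝ) : ℝ :=
  if d = 2 then (4 * c + 7) / 13
  else if d = 3 then (15 * c + 14) / 30
  else if d ≤ 11 then (1 + c) / 2 * (1 - hD d)
  else if 2 ∣ d then (1 + c) / 2 * (1 - kD d)
  else (1 + c) / 2 * (1 - lD d)

/-- `c₂(d)`. -/
def c2ps (d : ℕ) : ℝ :=
  if d = 2 then 1 / 54
  else if d = 3 then 1 / 495
  else if d ≤ 11 then 2 * hD d / (4 * (Sd d : ℝ) + 1 - hD d)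
  else if 2 ∣ d then 2 * kD d / (4 * (Sd d : ℝ) + 1 - kD d)
  else 2 * lD d / (4 * (Sd d : ℝ) + 1 - lD d)

/-- The majorant `ν = ν_b` from the density transfer lemma, characterized by
its defining property. -/
def nuSpec (d x : ℕ) (c : ℝ) (b : ℕ) (ν : ℤ → ℝ) : Prop :=
  (∀ n : ℤ, ∀ p : ℕ, p.Prime → p ∈ PS c → p ≤ x →
      (Wps d x : ℤ) * n - (b : ℤ) = (p : ℤ) ^ d →
      ν n = c * (Nat.totient (Wps d x) : ℝ) /
          ((sigmaPS d (Wps d x) b : ℝ) * (Wps d x : ℝ)) *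
          (p : ℝ) ^ ((d : ℝ) - 1 / c) * Real.log p) ∧
  (∀ n : ℤ, (¬ ∃ p : ℕ, p.Prime ∧ p ∈ PS c ∧ p ≤ x ∧
      (Wps d x : ℤ) * n - (b : ℤ) = (p : ℤ) ^ d) → ν n = 0)

/-- The majorant `τ`, characterized by its defining property. -/
def tauSpec (d x : ℕ) (c : ℝ) (b : ℕ) (τ : ℤ → ℝ) : Prop :=
  (∀ n : ℤ, ∀ m : ℕ, m ∈ PS c → m ≤ x →
      (Wps d x : ℤ) * n - (b : ℤ) = (m : ℤ) ^ d →
      τ n = c / (sigmaPS d (Wps d x) b : ℝ) * (m : ℝ) ^ ((d : ℝ) - 1 / c)) ∧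
  (∀ n : ℤ, (¬ ∃ m : ℕ, m ∈ PS c ∧ m ≤ x ∧
      (Wps d x : ℤ) * n - (b : ℤ) = (m : ℤ) ^ d) → τ n = 0)

/-- The function `μ`, characterized by its defining property. -/
def muSpec (d x : ℕ) (b : ℕ) (μ : ℤ → ℝ) : Prop :=
  (∀ n : ℤ, ∀ m : ℕ, 1 ≤ m → m ≤ x →
      (Wps d x : ℤ) * n - (b : ℤ) = (m : ℤ) ^ d →
      μ n = (m : ℝ) ^ (d - 1) / (sigmaPS d (Wps d x) b : ℝ)) ∧
  (∀ n : ℤ, (¬ ∃ m : ℕ, 1 ≤ m ∧ m ≤ x ∧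
      (Wps d x : ℤ) * n - (b : ℤ) = (m : ℤ) ^ d) → μ n = 0)

/-- `c₃(d)`. -/
def c3ps (d : ℕ) : ℝ :=
  if d = 2 then 1 / 2
  else if d = 3 then 1 / 15
  else if d ≤ 11 then 2 * hD d / (1 - hD d)
  else if 2 ∣ d then 2 * kD d / (1 - kD d)
  else 2 * lD d / (1 - lD d)


open Finset
notation:max "~" x:max => (x : ℝ)
notation:max "PP" => (by positivity)
notation:max "OO" => (by omega)
notation:max "LL" => (by linarith)

namespace VM
set_option linter.unusedSectionVars false
variable {p : ℕ} [hp : Fact p.Prime]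

def tri (l : ℕ) : ℕ := l * (l + 1) / 2

def ph {k L : ℕ} (α : Fin k → ZMod (p ^ L)) (v : ℤ) : ZMod (p ^ L) :=
  ∑ j, α j * (v : ZMod (p ^ L)) ^ (j.1 + 1)

def fS {k L : ℕ} (c : ℤ → ℂ) (y : ℤ → ℤ) (S : Finset ℤ) (α : Fin k → ZMod (p ^ L)) : ℂ :=
  ∑ x ∈ S, c x * ZMod.stdAddChar (ph α (y x))

notation:max "fT" p:max k:max L:max => @fS p _ k L

def wn {A : Type*} [Fintype A] (t : ℕ) (w : A → ℝ) (F : A → ℂ) : ℝ :=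
  (∑ α, w α * ‖F α‖ ^ (2 * t)) ^ ((t : ℝ)⁻¹)

def cl (p : ℕ) (y : ℤ → ℤ) (S : Finset ℤ) (n : ℕ) (r : ZMod (p ^ n)) : Finset ℤ :=
  S.filter (fun x => ((y x : ℤ) : ZMod (p ^ n)) = r)

/-- decoupling with loss D -/
def Dec (p : ℕ) [Fact p.Prime] (k n : ℕ) (D : ℝ) : Prop :=
  ∀ L, k * n ≤ L → ∀ (c : ℤ → ℂ) (y : ℤ → ℤ) (S : Finset ℤ),
    wn (tri k) (fun _ => 1) (fT p k L c y S) ≤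
      D * ∑ r : ZMod (p ^ n), wn (tri k) (fun _ => 1) (fT p k L c y (cl p y S n r))

lemma tri_pos {l : ℕ} (h : 1 ≤ l) : 1 ≤ tri l := by
  unfold tri
  have : 2 ≤ l * (l + 1) := by nlinarith
  omega

lemma two_tri (l : ℕ) : 2 * tri l = l * (l + 1) := by
  unfold tri
  have := Nat.even_mul_succ_self l
  obtain ⟨m, hm⟩ := this
  omega

lemma wn_nonneg {A : Type*} [Fintype A] (t : ℕ) (w : A → ℝ) (F : A → ℂ) (hw : ∀ α, 0 ≤ w α) :
    0 ≤ wn t w F := by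
  unfold wn
  exact rpow_nonneg (sum_nonneg fun α _ => mul_nonneg (hw α) PP) _

lemma wn_pow {A : Type*} [Fintype A] {t : ℕ} (ht : 1 ≤ t) (w : A → ℝ) (F : A → ℂ)
    (hw : ∀ α, 0 ≤ w α) : wn t w F ^ t = ∑ α, w α * ‖F α‖ ^ (2 * t) := by
  unfold wn
  exact rpow_inv_natCast_pow
    (sum_nonneg fun α _ => mul_nonneg (hw α) PP) OO

/-- Minkowski -/
lemma mink {A ι : Type*} [Fintype A] (t : ℕ) (ht : 1 ≤ t) (w : A → ℝ) (hw : ∀ α, 0 ≤ w α)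
    (I : Finset ι) (u : ι → A → ℝ) (hu : ∀ i α, 0 ≤ u i α) :
    (∑ α, w α * (∑ i ∈ I, u i α) ^ t) ^ ((t : ℝ)⁻¹) ≤
      ∑ i ∈ I, (∑ α, w α * u i α ^ t) ^ ((t : ℝ)⁻¹) := by
  have ht' : ~1 ≤ t := by exact_mod_cast ht
  have ht0 : t ≠ 0 := by omega
  have key : ∀ g : A → ℝ, (∀ α, 0 ≤ g α) → ∑ α, w α * g α ^ t =
      ∑ α, (w α ^ ((t : ℝ)⁻¹) * g α) ^ ~t := by
    intro g hg
    refine sum_congr rfl fun α _ => ?_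
    rw [rpow_natCast, mul_pow, rpow_inv_natCast_pow (hw α) ht0]
  induction I using Finset.induction_on with
  | empty => simp [ht0, zero_rpow (inv_ne_zero (by positivity : (t : ℝ) ≠ 0))]
  | insert i I hi ih =>
    rw [sum_insert hi]
    refine le_trans ?_ (add_le_add le_rfl ih)
    have hs : ∀ α, 0 ≤ ∑ i ∈ I, u i α := fun α => sum_nonneg fun i _ => hu i α
    rw [key _ (fun α => sum_nonneg fun i _ => hu i α), key _ (hu i), key _ hs]
    have := Lp_add_le_of_nonneg univ (f := fun α => w α ^ ((t : ℝ)⁻¹) * u i α)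
      (g := fun α => w α ^ ((t : ℝ)⁻¹) * ∑ i ∈ I, u i α) ht'
      (fun α _ => mul_nonneg (rpow_nonneg (hw α) _) (hu i α))
      (fun α _ => mul_nonneg (rpow_nonneg (hw α) _) (hs α))
    simp only [one_div] at this
    simp only [sum_insert hi, mul_add]
    exact this

/-- triangle inequality for `wn` : wn t is ℓ^{2t} norm squared; Cauchy–Schwarz form. -/
lemma fS_cl {k L : ℕ} (c : ℤ → ℂ) (y : ℤ → ℤ) (S : Finset ℤ) (n : ℕ)
    (α : Fin k → ZMod (p ^ L)) :
    fS c y S α = ∑ r : ZMod (p ^ n), fS c y (cl p y S n r) α := by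
  unfold fS cl
  rw [← sum_fiberwise_of_maps_to (t := univ)
    (g := fun x => ((y x : ℤ) : ZMod (p ^ n))) (fun _ _ => mem_univ _)]

def up {L'' L : ℕ} (z : ZMod (p ^ L'')) : ZMod (p ^ L) := (z.val : ZMod (p ^ L)) * (p : ZMod (p ^ L)) ^ (L - L'')

lemma up_char {L'' L : ℕ} (h : L'' ≤ L) (z : ZMod (p ^ L'')) (v : ℤ) :
    ZMod.stdAddChar (up (L := L) z * (v : ZMod (p ^ L))) = ZMod.stdAddChar (z * (v : ZMod (p ^ L''))) := by
  have h1 : up (L := L) z * (v : ZMod (p ^ L)) = (((z.val : ℤ) * (p : ℤ) ^ (L - L'') * v : ℤ) : ZMod (p ^ L)) := by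
    unfold up; push_cast; ring
  have h2 : z * (v : ZMod (p ^ L'')) = (((z.val : ℤ) * v : ℤ) : ZMod (p ^ L'')) := by
    push_cast; rw [ZMod.natCast_zmod_val]
  rw [h1, h2, ZMod.stdAddChar_coe, ZMod.stdAddChar_coe]
  congr 1
  have hp0 : (p : ℂ) ≠ 0 := by exact_mod_cast hp.out.ne_zero
  have : (p : ℂ) ^ L = p ^ (L - L'') * p ^ L'' := by rw [← pow_add]; congr 1; omega
  push_cast
  rw [this]
  field_simp

lemma up_kill {L'' L e : ℕ} (h : L'' ≤ e) (hL : L'' ≤ L) (z : ZMod (p ^ L'')) (v : ZMod (p ^ L))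
    (hv : (p : ZMod (p ^ L)) ^ e ∣ v) : up (L := L) z * v = 0 := by
  obtain ⟨q, rfl⟩ := hv
  unfold up
  have : (p : ZMod (p ^ L)) ^ L = 0 := by
    have := ZMod.natCast_self (p ^ L); push_cast at this; exact this
  have h2 : (p : ZMod (p ^ L)) ^ e = p ^ (e - L'') * p ^ L'' := by rw [← pow_add]; congr 1; omega
  have h3 : (p : ZMod (p ^ L)) ^ L = p ^ (L - L'') * p ^ L'' := by rw [← pow_add]; congr 1; omega
  rw [h2]
  calc _ = (p : ZMod (p ^ L)) ^ L * (z.val * p ^ (e - L'') * q) := by rw [h3]; ring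
    _ = 0 := by rw [this, zero_mul]

lemma ph_add {k L : ℕ} (α β : Fin k → ZMod (p ^ L)) (v : ℤ) : ph (α + β) v = ph α v + ph β v := by
  unfold ph; rw [← sum_add_distrib]; exact sum_congr rfl fun j _ => by
    simp [add_mul]

lemma char_sum {ι R : Type*} [AddCommMonoid R] (ψ : AddChar R ℂ) (I : Finset ι) (f : ι → R) :
    ψ (∑ i ∈ I, f i) = ∏ i ∈ I, ψ (f i) := by
  induction I using Finset.induction_on with
  | empty => simp
  | insert i I hi ih => rw [sum_insert hi, prod_insert hi, AddChar.map_add_eq_mul, ih]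

/-- phase of up-vectors -/
lemma up_ph {l L'' L : ℕ} (h : L'' ≤ L) (z : Fin l → ZMod (p ^ L'')) (v : ℤ) :
    ZMod.stdAddChar (∑ i, up (L := L) (z i) * (v : ZMod (p ^ L)) ^ (i.1 + 1)) =
      ZMod.stdAddChar (ph z v) := by
  unfold ph
  rw [char_sum, char_sum]
  refine prod_congr rfl fun i _ => ?_
  have := up_char h (z i) (v ^ (i.1 + 1))
  push_cast at this
  exact this

lemma norm_char {N : ℕ} [NeZero N] (z : ZMod N) : ‖ZMod.stdAddChar z‖ = 1 := by
  rw [ZMod.stdAddChar_apply]; exact Circle.norm_coe _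

/-- transfer -/
lemma transfer {k l L L'' n : ℕ} (hl : 1 ≤ l) (hL : L'' ≤ L) {D : ℝ} (hD0 : 0 ≤ D)
    (hD : Dec p l n D) (hLn : l * n ≤ L'')
    (c : ℤ → ℂ) (y y' : ℤ → ℤ) (S : Finset ℤ)
    (w : (Fin k → ZMod (p ^ L)) → ℝ) (hw : ∀ α, 0 ≤ w α)
    (ι : (Fin l → ZMod (p ^ L'')) → (Fin k → ZMod (p ^ L)))
    (hwi : ∀ z α, w (α + ι z) = w α)
    (κ : (Fin l → ZMod (p ^ L'')) → ZMod (p ^ L))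
    (hι : ∀ z, ∀ x ∈ S, ph (ι z) (y x) = κ z + ∑ i, up (L := L) (z i) * ((y' x : ℤ) : ZMod (p ^ L)) ^ (i.1 + 1)) :
    wn (tri l) w (fS c y S) ≤ D * ∑ r : ZMod (p ^ n), wn (tri l) w (fS c y (cl p y' S n r)) := by
  set t := tri l with ht
  have ht1 : 1 ≤ t := tri_pos hl
  have ht0 : t ≠ 0 := by omega
  set g : Finset ℤ → (Fin k → ZMod (p ^ L)) → (Fin l → ZMod (p ^ L'')) → ℂ := fun T α z =>
    fS (fun x => c x * ZMod.stdAddChar (ph α (y x))) y' T z with hg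
  -- average identity
  have avg : ∀ T ⊆ S, ∑ α, w α * ‖fS c y T α‖ ^ (2 * t) * (Fintype.card (Fin l → ZMod (p ^ L'')) : ℝ) =
      ∑ α, w α * ∑ z, ‖g T α z‖ ^ (2 * t) := by
    intro T hT
    have h1 : ∀ z, ∑ α, w α * ‖g T α z‖ ^ (2 * t) = ∑ α, w α * ‖fS c y T α‖ ^ (2 * t) := by
      intro z
      rw [← Equiv.sum_comp (Equiv.addRight (ι z)) (fun α => w α * ‖fS c y T α‖ ^ (2 * t))]
      refine sum_congr rfl fun α _ => ?_
      simp only [Equiv.coe_addRight, hwi]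
      congr 2
      have : fS c y T (α + ι z) = ZMod.stdAddChar (κ z) * g T α z := by
        simp only [hg, fS, mul_sum]
        refine sum_congr rfl fun x hx => ?_
        rw [ph_add, hι z x (hT hx), AddChar.map_add_eq_mul, AddChar.map_add_eq_mul, up_ph hL]
        ring
      rw [this, norm_mul, norm_char, one_mul]
    simp_rw [mul_sum]
    rw [sum_comm]
    simp_rw [h1]
    rw [sum_const, card_univ, nsmul_eq_mul, mul_sum]
    exact sum_congr rfl fun α _ => by ring
  set Q : ℝ := (Fintype.card (Fin l → ZMod (p ^ L'')) : ℝ) with hQ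
  have hQ0 : 0 < Q := by rw [hQ]; exact_mod_cast Fintype.card_pos
  have hwn : ∀ T ⊆ S, (∑ α, w α * ∑ z, ‖g T α z‖ ^ (2 * t)) ^ ((t : ℝ)⁻¹) =
      wn t w (fS c y T) * Q ^ ((t : ℝ)⁻¹) := by
    intro T hT
    rw [← avg T hT, ← sum_mul, mul_rpow (sum_nonneg fun α _ => mul_nonneg (hw α) PP) hQ0.le]
    rfl
  have hgsub : ∀ r, cl p y' S n r ⊆ S := fun r => filter_subset _ _
  have step : ∀ α, ∑ z, ‖g S α z‖ ^ (2 * t) ≤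
      (∑ r : ZMod (p ^ n), D * wn t (fun _ => 1) (g (cl p y' S n r) α)) ^ t := by
    intro α
    have := hD L'' hLn (fun x => c x * ZMod.stdAddChar (ph α (y x))) y' S
    have h2 := pow_le_pow_left₀ (wn_nonneg _ _ _ (fun _ => zero_le_one)) this t
    rw [wn_pow ht1 _ _ (fun _ => zero_le_one)] at h2
    simp only [one_mul] at h2
    rw [← mul_sum]
    exact h2
  have main : (∑ α, w α * ∑ z, ‖g S α z‖ ^ (2 * t)) ^ ((t : ℝ)⁻¹) ≤
      ∑ r : ZMod (p ^ n), D * (∑ α, w α * ∑ z, ‖g (cl p y' S n r) α z‖ ^ (2 * t)) ^ ((t : ℝ)⁻¹) := by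
    refine le_trans (rpow_le_rpow (sum_nonneg fun α _ => mul_nonneg (hw α) PP)
      (sum_le_sum fun α _ => mul_le_mul_of_nonneg_left (step α) (hw α)) PP) ?_
    refine le_trans (mink t ht1 w hw _ _ (fun r α => mul_nonneg hD0 (wn_nonneg _ _ _ fun _ => zero_le_one))) ?_
    refine sum_le_sum fun r _ => le_of_eq ?_
    have : ∀ α, w α * (D * wn t (fun _ => 1) (g (cl p y' S n r) α)) ^ t =
        D ^ t * (w α * ∑ z, ‖g (cl p y' S n r) α z‖ ^ (2 * t)) := by
      intro α
      rw [mul_pow, wn_pow ht1 _ _ (fun _ => zero_le_one)]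
      simp only [one_mul]; ring
    simp_rw [this]
    rw [← mul_sum, mul_rpow PP (sum_nonneg fun α _ => mul_nonneg (hw α) PP),
      pow_rpow_inv_natCast hD0 ht0]
  rw [hwn S subset_rfl] at main
  have main2 : wn t w (fS c y S) * Q ^ ((t : ℝ)⁻¹) ≤
      (D * ∑ r : ZMod (p ^ n), wn t w (fS c y (cl p y' S n r))) * Q ^ ((t : ℝ)⁻¹) := by
    refine main.trans (le_of_eq ?_)
    rw [mul_sum, sum_mul]
    exact sum_congr rfl fun r _ => by rw [hwn _ (hgsub r)]; ring
  exact le_of_mul_le_mul_right main2 (rpow_pos_of_pos hQ0 _)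

end VM

namespace VM
set_option linter.unusedSectionVars false
open Polynomial in
lemma Qexist {R : Type*} [CommRing R] [Nontrivial R] {k l m : ℕ} (hm : 1 ≤ m) (hml : m + l = k + 1) (hl : 1 ≤ l)
    (hun : ∀ j : ℕ, 1 ≤ j → j ≤ k → IsUnit (j : R)) (u : R) (hu : IsUnit u) (i : ℕ) (hi : 1 ≤ i)
    (hil : i ≤ l) : ∃ (Q : R[X]) (c0 : R), Q.natDegree ≤ k ∧ X ^ m ∣ Q ∧
      X ^ (l + 1) ∣ Q.comp (X + C u) - C c0 - X ^ i := by
  -- t = X - u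
  have hcop : IsCoprime (X ^ (m - 1) : R[X]) ((X - C u) ^ l) := by
    apply IsCoprime.pow
    obtain ⟨v, hv⟩ := hu.exists_left_inv
    refine ⟨C v, - C v, ?_⟩
    calc C v * X + -C v * (X - C u) = C (v * u) := by rw [C_mul]; ring
      _ = 1 := by rw [hv, C_1]
  obtain ⟨v, w, hvw⟩ := hcop
  have hmon : ((X - C u) ^ l : R[X]).Monic := (monic_X_sub_C u).pow l
  set g : R[X] := C (i : R) * (X - C u) ^ (i - 1) with hg
  set ρ : R[X] := (g * v) %ₘ ((X - C u) ^ l) with hρ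
  have hρdeg : ρ.natDegree < l := by
    have := natDegree_modByMonic_lt (g * v) hmon (by
      intro h
      have h2 : ((X - C u) ^ l : R[X]).natDegree = l := by
        rw [(monic_X_sub_C u).natDegree_pow, natDegree_X_sub_C, mul_one]
      rw [h] at h2; simp at h2; omega)
    rwa [(monic_X_sub_C u).natDegree_pow, natDegree_X_sub_C, mul_one] at this
  have hG : (X - C u) ^ l ∣ X ^ (m - 1) * ρ - g := by
    have h1 : (X - C u) ^ l ∣ ρ - g * v := by
      have := modByMonic_add_div (g * v) ((X - C u) ^ l)
      refine ⟨-((g * v) /ₘ (X - C u) ^ l), ?_⟩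
      rw [hρ]; linear_combination this
    have h2 : X ^ (m - 1) * ρ - g = X ^ (m - 1) * (ρ - g * v) - g * w * (X - C u) ^ l := by
      linear_combination g * hvw
    rw [h2]
    exact dvd_sub (h1.mul_left _) (Dvd.intro_left _ rfl)
  set G : R[X] := X ^ (m - 1) * ρ with hGdef
  have hGdeg : G.natDegree < k := by
    have := natDegree_mul_le (p := (X ^ (m - 1) : R[X])) (q := ρ)
    rw [natDegree_X_pow, ← hGdef] at this
    omega
  set Q : R[X] := ∑ j ∈ range k, C (G.coeff j * Ring.inverse ((j + 1 : ℕ) : R)) * X ^ (j + 1) with hQ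
  have hder : derivative Q = G := by
    rw [hQ, derivative_sum]
    conv_rhs => rw [as_sum_range' G k hGdeg]
    refine sum_congr rfl fun j hj => ?_
    rw [derivative_C_mul_X_pow, ← C_mul_X_pow_eq_monomial]
    congr 2
    rw [mul_assoc, Ring.inverse_mul_cancel _ (hun (j + 1) OO (by simp at hj; omega)), mul_one]
  refine ⟨Q, (Q.comp (X + C u)).coeff 0, ?_, ?_, ?_⟩
  · rw [hQ]
    refine natDegree_sum_le_of_forall_le _ _ fun j hj => ?_
    refine (natDegree_C_mul_X_pow_le _ _).trans ?_
    simp at hj; omega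
  · rw [X_pow_dvd_iff]
    intro e he
    rw [hQ, finsetSum_coeff]
    refine sum_eq_zero fun j hj => ?_
    rw [coeff_C_mul_X_pow]
    split_ifs with h
    · have : G.coeff j = 0 := by
        rw [hGdef, coeff_X_pow_mul']
        rw [if_neg OO]
      rw [this, zero_mul]
    · rfl
  · rw [X_pow_dvd_iff]
    intro e he
    have hd2 : derivative (Q.comp (X + C u)) = G.comp (X + C u) := by
      rw [derivative_comp, hder]; simp
    have hG2 : X ^ l ∣ G.comp (X + C u) - C (i : R) * X ^ (i - 1) := by
      obtain ⟨q, hq⟩ := hG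
      refine ⟨q.comp (X + C u), ?_⟩
      have := congrArg (fun P => P.comp (X + C u)) hq
      simp only [sub_comp, mul_comp, pow_comp, X_comp, C_comp, hg, add_sub_cancel_right] at this
      exact this
    rcases Nat.eq_zero_or_pos e with rfl | he0
    · simp [coeff_X_pow, show (0 : ℕ) ≠ i by omega]
    · have h3 := (X_pow_dvd_iff.1 hG2) (e - 1) OO
      rw [← hd2, coeff_sub, coeff_derivative, coeff_C_mul_X_pow] at h3
      have hee : e - 1 + 1 = e := by omega
      rw [hee] at h3
      have hcast : ((e - 1 : ℕ) : R) + 1 = (e : R) := by rw [← hee]; push_cast; simp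
      rw [hcast] at h3
      rw [coeff_sub, coeff_sub, coeff_C, if_neg OO, coeff_X_pow, sub_zero]
      have hu2 := hun e he0 OO
      apply hu2.mul_left_cancel
      rw [mul_zero, mul_sub]
      by_cases hie : e = i
      · subst hie; rw [if_pos rfl] at h3 ⊢; linear_combination h3
      · rw [if_neg hie]; rw [if_neg OO] at h3; linear_combination h3

variable {p : ℕ} [hp : Fact p.Prime]

open Polynomial in
lemma ph_poly {k L : ℕ} (Q : (ZMod (p ^ L))[X]) (hQ : Q.natDegree ≤ k) (v : ℤ) :
    ph (fun j : Fin k => Q.coeff (j.1 + 1)) v = Q.eval (v : ZMod (p ^ L)) - Q.coeff 0 := by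
  unfold ph
  rw [eval_eq_sum_range' (n := k + 1) OO, sum_range_succ', sum_range]
  simp

lemma reindex {n A : ℕ} (hA : A ≤ n) (y y' : ℤ → ℤ) (S : Finset ℤ) (x0 : ℤ)
    (h : ∀ x ∈ S, y x = x0 + p ^ A * y' x) (F : Finset ℤ → ℝ) (hF : ∀ T, 0 ≤ F T) :
    ∑ r : ZMod (p ^ (n - A)), F (cl p y' S (n - A) r) ≤ ∑ r : ZMod (p ^ n), F (cl p y S n r) := by
  have hp0 : (p : ℤ) ≠ 0 := by exact_mod_cast hp.out.ne_zero
  have key : ∀ a b : ℤ, ((x0 + p ^ A * a : ℤ) : ZMod (p ^ n)) = ((x0 + p ^ A * b : ℤ) : ZMod (p ^ n)) ↔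
      (a : ZMod (p ^ (n - A))) = (b : ZMod (p ^ (n - A))) := by
    intro a b
    rw [ZMod.intCast_eq_intCast_iff_dvd_sub, ZMod.intCast_eq_intCast_iff_dvd_sub]
    have : ((p ^ n : ℕ) : ℤ) = p ^ A * ((p ^ (n - A) : ℕ) : ℤ) := by
      push_cast; rw [← pow_add]; congr 1; omega
    rw [this, show x0 + p ^ A * b - (x0 + p ^ A * a) = (p : ℤ) ^ A * (b - a) by ring]
    exact mul_dvd_mul_iff_left (pow_ne_zero _ hp0)
  set φ : ZMod (p ^ (n - A)) → ZMod (p ^ n) := fun r => ((x0 + p ^ A * (r.val : ℤ) : ℤ) : ZMod (p ^ n)) with hφ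
  have hval : ∀ r : ZMod (p ^ (n - A)), (((r.val : ℤ)) : ZMod (p ^ (n - A))) = r := by
    intro r; rw [Int.cast_natCast, ZMod.natCast_zmod_val]
  have hinj : Function.Injective φ := by
    intro r r' hr
    rw [hφ] at hr
    have := (key _ _).1 hr
    rwa [hval, hval] at this
  have hcl : ∀ r, cl p y' S (n - A) r = cl p y S n (φ r) := by
    intro r
    unfold cl
    refine filter_congr fun x hx => ?_
    rw [h x hx, hφ, key, hval]
  simp_rw [hcl]
  have hm := sum_map univ ⟨φ, hinj⟩ (fun r => F (cl p y S n r))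
  simp only [Function.Embedding.coeFn_mk] at hm
  rw [← hm]
  exact sum_le_univ_sum_of_nonneg fun r => hF _

open Polynomial in
lemma rescale {k n A L : ℕ} (hk : 1 ≤ k) (hA : A ≤ n) (hL : k * n ≤ L) {D : ℝ} (hD0 : 0 ≤ D)
    (hD : Dec p k (n - A) D) (c : ℤ → ℂ) (y : ℤ → ℤ) (S : Finset ℤ) (x0 : ℤ)
    (h : ∀ x ∈ S, (p : ℤ) ^ A ∣ y x - x0) :
    wn (tri k) (fun _ => 1) (fT p k L c y S) ≤
      D * ∑ r : ZMod (p ^ n), wn (tri k) (fun _ => 1) (fT p k L c y (cl p y S n r)) := by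
  have hp0 : (p : ℤ) ≠ 0 := by exact_mod_cast hp.out.ne_zero
  set y' : ℤ → ℤ := fun x => (y x - x0) / p ^ A with hy'
  have hyy : ∀ x ∈ S, y x = x0 + p ^ A * y' x := by
    intro x hx
    rw [hy', Int.mul_ediv_cancel' (h x hx)]; ring
  have hkA : k * A ≤ k * n := Nat.mul_le_mul_left _ hA
  have hsub : k * (n - A) = k * n - k * A := Nat.mul_sub _ _ _
  set P : (Fin k → ZMod (p ^ (L - k * A))) → (ZMod (p ^ L))[X] := fun z =>
    ∑ i : Fin k, C (((z i).val : ZMod (p ^ L)) * (p : ZMod (p ^ L)) ^ (k * A - (i.1 + 1) * A)) * (X - C (x0 : ZMod (p ^ L))) ^ (i.1 + 1) with hP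
  have hPdeg : ∀ z, (P z).natDegree ≤ k := by
    intro z
    refine natDegree_sum_le_of_forall_le _ _ fun i _ => ?_
    refine (natDegree_C_mul_le _ _).trans ?_
    refine (natDegree_pow_le).trans ?_
    have := natDegree_X_sub_C_le (x0 : ZMod (p ^ L))
    calc _ ≤ (i.1 + 1) * 1 := Nat.mul_le_mul_left _ this
      _ ≤ k := by omega
  refine le_trans (transfer (L'' := L - k * A) hk (Nat.sub_le _ _) hD0 hD OO c y y' S (fun _ => 1)
    (fun _ => zero_le_one) (fun z j => (P z).coeff (j.1 + 1)) (fun _ _ => rfl) (fun z => - (P z).coeff 0) ?_) ?_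
  · intro z x hx
    rw [ph_poly _ (hPdeg z), hP]
    simp only [eval_finsetSum, eval_mul, eval_C, eval_pow, eval_sub, eval_X]
    rw [sub_eq_neg_add]
    congr 1
    refine sum_congr rfl fun i _ => ?_
    have h1 : ((y x : ℤ) : ZMod (p ^ L)) - (x0 : ZMod (p ^ L)) = (p : ZMod (p ^ L)) ^ A * (y' x : ZMod (p ^ L)) := by
      rw [hyy x hx]; push_cast; ring
    have h2 : (i.1 + 1) * A ≤ k * A := Nat.mul_le_mul_right _ OO
    have h3 : (p : ZMod (p ^ L)) ^ (L - (L - k * A)) = p ^ (k * A - (i.1 + 1) * A) * p ^ (A * (i.1 + 1)) := by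
      rw [← pow_add]; congr 1; rw [mul_comm A]; omega
    rw [h1, up, h3, mul_pow, pow_mul]
    ring
  · refine mul_le_mul_of_nonneg_left ?_ hD0
    exact reindex hA y y' S x0 hyy (fun T => wn (tri k) (fun _ => 1) (fT p k L c y T))
      (fun T => wn_nonneg _ _ _ fun _ => zero_le_one)

open Polynomial in
lemma raise1 {k l n' A B L : ℕ} (hl : 1 ≤ l) (hlk : l ≤ k) (hpk : k < p) (hL : l * n' ≤ L)
    (h1 : l * n' ≤ (l + 1) * A) (h2 : l * n' ≤ (k - l + 1) * B) {D : ℝ} (hD0 : 0 ≤ D)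
    (hD : Dec p l n' D) (c : ℤ → ℂ) (y : ℤ → ℤ) (S1 S2 : Finset ℤ) (a b : ℤ)
    (hab : ¬ (p : ℤ) ∣ a - b) (hS1 : ∀ x ∈ S1, (p : ℤ) ^ A ∣ y x - a)
    (hS2 : ∀ x ∈ S2, (p : ℤ) ^ B ∣ y x - b) (e : ℕ) :
    wn (tri l) (fun α => ‖fT p k L c y S2 α‖ ^ e) (fT p k L c y S1) ≤
      D * ∑ r : ZMod (p ^ n'), wn (tri l) (fun α => ‖fT p k L c y S2 α‖ ^ e)
        (fT p k L c y (cl p y S1 n' r)) := by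
  have hunit : ∀ v : ℤ, ¬ (p : ℤ) ∣ v → IsUnit ((v : ℤ) : ZMod (p ^ L)) := by
    intro v hv
    rw [ZMod.coe_int_isUnit_iff_isCoprime]
    push_cast
    apply IsCoprime.pow_left
    exact (Prime.coprime_iff_not_dvd (Nat.prime_iff_prime_int.1 hp.out)).2 hv
  rcases Nat.eq_zero_or_pos L with rfl | hLpos
  · have hn' : n' = 0 := by
      rcases Nat.eq_zero_or_pos n' with h | h
      · exact h
      · have := Nat.mul_pos hl h; omega
    subst hn'
    refine le_trans (transfer (L'' := 0) hl le_rfl hD0 hD OO c y y S1 _ (fun _ => by positivity) (fun z _ => 0) ?_ (fun z => 0) ?_) le_rfl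
    · intro z α; congr 3; exact Subsingleton.elim (α := Fin k → ZMod 1) _ _
    · intro z x _; exact Subsingleton.elim (α := ZMod 1) _ _
  have : Nontrivial (ZMod (p ^ L)) := by
    have : Fact (1 < p ^ L) := ⟨Nat.one_lt_pow OO hp.out.one_lt⟩
    infer_instance
  have hun : ∀ j : ℕ, 1 ≤ j → j ≤ k → IsUnit (j : ZMod (p ^ L)) := by
    intro j hj1 hjk
    have := hunit (j : ℤ) (by
      intro h; have := Nat.le_of_dvd OO (by exact_mod_cast h : p ∣ j); omega)
    simpa using this
  have hQ := fun i : Fin l => Qexist (R := ZMod (p ^ L)) (k := k) (l := l) (m := k - l + 1) OO OO hl hun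
    (((a - b : ℤ)) : ZMod (p ^ L)) (hunit _ hab) (i.1 + 1) OO OO
  choose Q c0 hdeg hdv1 hdv2 using hQ
  set P : (Fin l → ZMod (p ^ (l * n'))) → (ZMod (p ^ L))[X] := fun z =>
    ∑ i : Fin l, C (up (L := L) (z i)) * (Q i).comp (X - C (b : ZMod (p ^ L))) with hP
  have hPdeg : ∀ z, (P z).natDegree ≤ k := by
    intro z
    refine natDegree_sum_le_of_forall_le _ _ fun i _ => ?_
    refine (natDegree_C_mul_le _ _).trans ?_
    refine (natDegree_comp_le).trans ?_
    have := natDegree_X_sub_C_le (b : ZMod (p ^ L))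
    calc _ ≤ (Q i).natDegree * 1 := Nat.mul_le_mul_left _ this
      _ ≤ k := by rw [mul_one]; exact hdeg i
  have hPev : ∀ z (v : ZMod (p ^ L)), (P z).eval v = ∑ i : Fin l, up (L := L) (z i) * (Q i).eval (v - b) := by
    intro z v
    simp [hP, eval_finsetSum, eval_comp]
  have hpd : ∀ {E : ℕ} {v : ℤ}, (p : ℤ) ^ E ∣ v → (p : ZMod (p ^ L)) ^ E ∣ (v : ZMod (p ^ L)) := by
    intro E v hv
    obtain ⟨q, rfl⟩ := hv
    push_cast; exact Dvd.intro _ rfl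
  set y' : ℤ → ℤ := fun x => y x - a with hy'
  refine le_trans (transfer (L'' := l * n') hl hL hD0 hD le_rfl c y y' S1 _ (fun _ => by positivity)
    (fun z j => (P z).coeff (j.1 + 1)) ?_ (fun z => ∑ i, up (L := L) (z i) * c0 i - (P z).coeff 0) ?_) ?_
  · intro z α
    congr 1
    have : fT p k L c y S2 (α + fun j => (P z).coeff (j.1 + 1)) =
        ZMod.stdAddChar (-(P z).coeff 0) * fS c y S2 α := by
      unfold fS
      rw [mul_sum]
      refine sum_congr rfl fun x hx => ?_
      rw [ph_add, ph_poly _ (hPdeg z), hPev]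
      have : ∑ i : Fin l, up (L := L) (z i) * (Q i).eval ((y x : ZMod (p ^ L)) - b) = 0 := by
        refine sum_eq_zero fun i _ => up_kill h2 hL _ _ ?_
        obtain ⟨q, hq⟩ := hdv1 i
        rw [hq, eval_mul, eval_pow, eval_X]
        refine Dvd.dvd.mul_right ?_ _
        rw [mul_comm, pow_mul]
        refine pow_dvd_pow_of_dvd ?_ _
        have := hpd (hS2 x hx)
        push_cast at this; exact this
      rw [this, zero_sub, AddChar.map_add_eq_mul]
      ring
    rw [this, norm_mul, norm_char, one_mul]
  · intro z x hx
    rw [ph_poly _ (hPdeg z), hPev, sub_add_eq_add_sub, ← sum_add_distrib]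
    congr 1
    refine sum_congr rfl fun i _ => ?_
    obtain ⟨q, hq⟩ := hdv2 i
    have h3 := congrArg (fun F => F.eval ((y' x : ℤ) : ZMod (p ^ L))) hq
    simp only [eval_sub, eval_comp, eval_add, eval_X, eval_C, eval_pow, eval_mul] at h3
    have h4 : ((y' x : ℤ) : ZMod (p ^ L)) + ((a - b : ℤ) : ZMod (p ^ L)) = (y x : ZMod (p ^ L)) - b := by
      rw [hy']; push_cast; ring
    rw [h4] at h3
    have h5 := up_kill (L := L) (e := (l + 1) * A) h1 hL (z i) (((y' x : ℤ) : ZMod (p ^ L)) ^ (l + 1) * q.eval ((y' x : ℤ) : ZMod (p ^ L))) (by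
      refine Dvd.dvd.mul_right ?_ _
      rw [mul_comm, pow_mul]
      exact pow_dvd_pow_of_dvd (hpd (hS1 x hx)) _)
    linear_combination (up (L := L) (z i)) * h3 + h5
  · refine mul_le_mul_of_nonneg_left ?_ hD0
    exact reindex (A := 0) (n := n') (Nat.zero_le _) y y' S1 a (fun x _ => by rw [hy']; ring)
      (fun T => wn (tri l) (fun α => ‖fT p k L c y S2 α‖ ^ e) (fT p k L c y T))
      (fun T => wn_nonneg _ _ _ fun _ => by positivity)

end VM

namespace VM
set_option linter.unusedSectionVars false

lemma holder_int {A : Type*} [Fintype A] (a b : ℕ) (hab : 1 ≤ a + b) (h u v : A → ℝ) (hh : ∀ x, 0 ≤ h x)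
    (hu : ∀ x, 0 ≤ u x) (hv : ∀ x, 0 ≤ v x) (H : ∀ x, h x ^ (a + b) ≤ u x ^ a * v x ^ b) :
    (∑ x, h x) ^ (a + b) ≤ (∑ x, u x) ^ a * (∑ x, v x) ^ b := by
  have hsu : 0 ≤ ∑ x, u x := sum_nonneg fun x _ => hu x
  have hsv : 0 ≤ ∑ x, v x := sum_nonneg fun x _ => hv x
  have hsh : 0 ≤ ∑ x, h x := sum_nonneg fun x _ => hh x
  rcases Nat.eq_zero_or_pos a with rfl | ha
  · simp only [zero_add, pow_zero, one_mul] at *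
    exact pow_le_pow_left₀ hsh (sum_le_sum fun x _ => le_of_pow_le_pow_left₀ OO (hv x) (H x)) _
  rcases Nat.eq_zero_or_pos b with rfl | hb
  · simp only [add_zero, pow_zero, mul_one] at *
    exact pow_le_pow_left₀ hsh (sum_le_sum fun x _ => le_of_pow_le_pow_left₀ OO (hu x) (H x)) _
  have ha' : ~0 < a := by exact_mod_cast ha
  have hb' : ~0 < b := by exact_mod_cast hb
  set P : ℝ := (a + b) / a with hP
  set Q : ℝ := (a + b) / b with hQ
  have hPQ : P.HolderConjugate Q := by
    rw [holderConjugate_iff]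
    refine ⟨by rw [hP, lt_div_iff₀ ha']; linarith, ?_⟩
    rw [hP, hQ]; field_simp
  have hPi : P⁻¹ = a / (a + b) := by rw [hP, inv_div]
  have hQi : Q⁻¹ = b / (a + b) := by rw [hQ, inv_div]
  have hP0 : P ≠ 0 := by rw [hP]; positivity
  have hQ0 : Q ≠ 0 := by rw [hQ]; positivity
  have h1 : ∀ x, h x ≤ u x ^ P⁻¹ * v x ^ Q⁻¹ := by
    intro x
    apply le_of_pow_le_pow_left₀ (n := a + b) OO (by have := hu x; have := hv x; positivity)
    refine (H x).trans (le_of_eq ?_)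
    rw [mul_pow, ← rpow_natCast (u x ^ P⁻¹), ← rpow_natCast (v x ^ Q⁻¹), ← rpow_mul (hu x),
      ← rpow_mul (hv x), hPi, hQi]
    push_cast
    rw [div_mul_cancel₀ _ PP, div_mul_cancel₀ _ PP, rpow_natCast, rpow_natCast]
  have h2 := inner_le_Lp_mul_Lq_of_nonneg univ hPQ (f := fun x => u x ^ P⁻¹) (g := fun x => v x ^ Q⁻¹)
    (fun x _ => rpow_nonneg (hu x) _) (fun x _ => rpow_nonneg (hv x) _)
  simp only [rpow_inv_rpow (hu _) hP0, rpow_inv_rpow (hv _) hQ0] at h2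
  have h3 : ∑ x, h x ≤ _ := (sum_le_sum fun x _ => h1 x).trans h2
  refine (pow_le_pow_left₀ hsh h3 _).trans (le_of_eq ?_)
  rw [mul_pow, ← rpow_natCast, ← rpow_natCast, ← rpow_mul hsu, ← rpow_mul hsv, one_div, one_div,
    hPi, hQi]
  push_cast
  rw [div_mul_cancel₀ _ PP, div_mul_cancel₀ _ PP, rpow_natCast, rpow_natCast]

variable {p : ℕ} [hp : Fact p.Prime]

def Sg (p : ℕ) [Fact p.Prime] (k L n : ℕ) (c : ℤ → ℂ) (y : ℤ → ℤ) (S : Finset ℤ) : ℝ :=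
  ∑ r : ZMod (p ^ n), wn (tri k) (fun _ => 1) (fT p k L c y (cl p y S n r))

lemma Sg_nonneg {k L n : ℕ} {c : ℤ → ℂ} {y : ℤ → ℤ} {S : Finset ℤ} : 0 ≤ Sg p k L n c y S :=
  sum_nonneg fun _ _ => wn_nonneg _ _ _ fun _ => zero_le_one

def BilBd (p : ℕ) [Fact p.Prime] (k l A B n : ℕ) (E : ℝ) : Prop :=
  ∀ L, k * n ≤ L → ∀ (c : ℤ → ℂ) (y : ℤ → ℤ) (S1 S2 : Finset ℤ) (a b : ℤ), ¬ (p : ℤ) ∣ a - b →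
    (∀ x ∈ S1, (p : ℤ) ^ A ∣ y x - a) → (∀ x ∈ S2, (p : ℤ) ^ B ∣ y x - b) →
    ∑ α, ‖fT p k L c y S2 α‖ ^ (2 * (tri k - tri l)) * ‖fT p k L c y S1 α‖ ^ (2 * tri l) ≤
      E * (Sg p k L n c y S1 ^ tri l * Sg p k L n c y S2 ^ (tri k - tri l))

lemma BilBd.mono {k l A B n : ℕ} {E E' : ℝ} (h : BilBd p k l A B n E) (hE : E ≤ E') : BilBd p k l A B n E' :=
  fun L hL c y S1 S2 a b hab h1 h2 => (h L hL c y S1 S2 a b hab h1 h2).trans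
    (mul_le_mul_of_nonneg_right hE (mul_nonneg (pow_nonneg Sg_nonneg _) (pow_nonneg Sg_nonneg _)))

lemma Dec.mono {k n : ℕ} {D D' : ℝ} (h : Dec p k n D) (hD : D ≤ D') : Dec p k n D' :=
  fun L hL c y S => (h L hL c y S).trans (mul_le_mul_of_nonneg_right hD
    (sum_nonneg fun _ _ => wn_nonneg _ _ _ fun _ => zero_le_one))

lemma wn_empty {k L t : ℕ} (ht : 1 ≤ t) (w : (Fin k → ZMod (p ^ L)) → ℝ) (c : ℤ → ℂ) (y : ℤ → ℤ) :
    wn t w (fS c y ∅) = 0 := by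
  unfold wn fS
  simp [show t ≠ 0 by omega]

lemma Sg_add {k L n A : ℕ} (hk : 1 ≤ k) (hA : A ≤ n) (c : ℤ → ℂ) (y : ℤ → ℤ) (S : Finset ℤ) :
    ∑ r : ZMod (p ^ A), Sg p k L n c y (cl p y S A r) = Sg p k L n c y S := by
  unfold Sg
  rw [sum_comm]
  refine sum_congr rfl fun r _ => ?_
  have hd : p ^ A ∣ p ^ n := pow_dvd_pow _ hA
  rw [sum_eq_single (ZMod.castHom hd (ZMod (p ^ A)) r)]
  · congr 2
    unfold cl
    ext x
    simp only [mem_filter]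
    constructor
    · rintro ⟨⟨h1, _⟩, h3⟩; exact ⟨h1, h3⟩
    · rintro ⟨h1, h3⟩; exact ⟨⟨h1, by rw [← h3, map_intCast]⟩, h3⟩
  · intro r' _ hr'
    rw [show cl p y (cl p y S A r') n r = ∅ from ?_]
    · exact wn_empty (tri_pos hk) _ c y
    · unfold cl
      ext x
      simp only [mem_filter, notMem_empty, iff_false]
      rintro ⟨⟨_, h2⟩, h3⟩
      exact hr' (by rw [← h2, ← h3, map_intCast])
  · simp

lemma triv {k L t n : ℕ} (ht : 1 ≤ t) (w : (Fin k → ZMod (p ^ L)) → ℝ) (hw : ∀ α, 0 ≤ w α) (c : ℤ → ℂ) (y : ℤ → ℤ)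
    (S : Finset ℤ) : wn t w (fS c y S) ≤ ~p ^ n * ∑ r : ZMod (p ^ n), wn t w (fS c y (cl p y S n r)) := by
  have h1 : ∀ α, w α * ‖fS (p := p) c y S α‖ ^ (2 * t) ≤
      w α * (∑ r : ZMod (p ^ n), ~p ^ n * ‖fS c y (cl p y S n r) α‖ ^ 2) ^ t := by
    intro α
    refine mul_le_mul_of_nonneg_left ?_ (hw α)
    rw [pow_mul]
    refine pow_le_pow_left₀ PP ?_ _
    rw [fS_cl c y S n α, ← mul_sum]
    have h2 := sq_sum_le_card_mul_sum_sq (s := (univ : Finset (ZMod (p ^ n)))) (f := fun r => ‖fS c y (cl p y S n r) α‖)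
    rw [card_univ, ZMod.card] at h2
    push_cast at h2
    exact (pow_le_pow_left₀ (norm_nonneg _) (norm_sum_le _ _) 2).trans h2
  have h3 : wn t w (fS c y S) ≤ (∑ α, w α * (∑ r : ZMod (p ^ n), ~p ^ n * ‖fS c y (cl p y S n r) α‖ ^ 2) ^ t) ^ ((t : ℝ)⁻¹) :=
    rpow_le_rpow (sum_nonneg fun α _ => mul_nonneg (hw α) PP)
      (sum_le_sum fun α _ => h1 α) PP
  refine h3.trans ((mink t ht w hw _ _ (fun r α => by positivity)).trans (le_of_eq ?_))
  rw [mul_sum]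
  refine sum_congr rfl fun r _ => ?_
  unfold wn
  have : ∀ α, w α * (~p ^ n * ‖fS c y (cl p y S n r) α‖ ^ 2) ^ t =
      (~p ^ n) ^ t * (w α * ‖fS c y (cl p y S n r) α‖ ^ (2 * t)) := by
    intro α; rw [mul_pow, ← pow_mul ‖_‖ 2 t]; ring
  simp_rw [this]
  rw [← mul_sum, mul_rpow PP (sum_nonneg fun α _ => mul_nonneg (hw α) PP),
    pow_rpow_inv_natCast PP OO]

lemma dec_triv {k : ℕ} (hk : 1 ≤ k) (n : ℕ) : Dec p k n (~p ^ n) :=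
  fun _ _ c y S => triv (tri_pos hk) _ (fun _ => zero_le_one) c y S

/-- generic raising -/
lemma raiseG {k l A A' B n : ℕ} (hk : 1 ≤ k) (hl : 1 ≤ l) (hA : 1 ≤ A) (hA' : 1 ≤ A') (hA'n : A' ≤ n) {E Λ : ℝ} (hE : 0 ≤ E)
    (hΛ : 0 ≤ Λ)
    (hst : ∀ L, k * n ≤ L → ∀ (c : ℤ → ℂ) (y : ℤ → ℤ) (S1 S2 : Finset ℤ) (a b : ℤ), ¬ (p : ℤ) ∣ a - b →
      (∀ x ∈ S1, (p : ℤ) ^ A ∣ y x - a) → (∀ x ∈ S2, (p : ℤ) ^ B ∣ y x - b) →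
      wn (tri l) (fun α => ‖fT p k L c y S2 α‖ ^ (2 * (tri k - tri l))) (fT p k L c y S1) ≤
      Λ * ∑ r : ZMod (p ^ A'), wn (tri l) (fun α => ‖fT p k L c y S2 α‖ ^ (2 * (tri k - tri l)))
        (fT p k L c y (cl p y S1 A' r)))
    (h : BilBd p k l A' B n E) : BilBd p k l A B n (Λ ^ tri l * E) := by
  intro L hL c y S1 S2 a b hab h1 h2
  have hst := hst L hL c y S1 S2 a b hab h1 h2
  have ht := tri_pos hl
  set t := tri l
  set w : (Fin k → ZMod (p ^ L)) → ℝ := fun α => ‖fT p k L c y S2 α‖ ^ (2 * (tri k - t)) with hw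
  have hw0 : ∀ α, 0 ≤ w α := fun α => by positivity
  set G : ℝ := E * Sg p k L n c y S2 ^ (tri k - t) with hG
  have hG0 : 0 ≤ G := mul_nonneg hE (pow_nonneg Sg_nonneg _)
  have hcl : ∀ r, wn t w (fS c y (cl p y S1 A' r)) ≤ G ^ ((t : ℝ)⁻¹) * Sg p k L n c y (cl p y S1 A' r) := by
    intro r
    rcases (cl p y S1 A' r).eq_empty_or_nonempty with h0 | ⟨x0, hx0⟩
    · rw [h0, wn_empty ht]; exact mul_nonneg (rpow_nonneg hG0 _) Sg_nonneg
    · have hx0' := mem_filter.1 hx0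
      have hd : (p : ℤ) ∣ y x0 - a := (dvd_pow_self _ OO).trans (h1 x0 hx0'.1)
      have := h L hL c y (cl p y S1 A' r) S2 (y x0) b
        (fun hc => hab (by have := dvd_sub hc hd; rwa [show y x0 - b - (y x0 - a) = a - b by ring] at this))
        (by
          intro x hx
          have hx' := mem_filter.1 hx
          have := (ZMod.intCast_eq_intCast_iff_dvd_sub (y x0) (y x) (p ^ A')).1 (by rw [hx0'.2, hx'.2])
          push_cast at this; exact this) h2
      apply le_of_pow_le_pow_left₀ (n := t) OO (mul_nonneg (rpow_nonneg hG0 _) Sg_nonneg)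
      rw [wn_pow ht _ _ hw0, mul_pow, rpow_inv_natCast_pow hG0 OO]
      refine this.trans (le_of_eq ?_)
      rw [hG]; ring
  have h3 : wn t w (fS c y S1) ≤ Λ * (G ^ ((t : ℝ)⁻¹) * Sg p k L n c y S1) := by
    refine hst.trans (mul_le_mul_of_nonneg_left ?_ hΛ)
    rw [← Sg_add hk hA'n c y S1, mul_sum]
    exact sum_le_sum fun r _ => hcl r
  have h4 := pow_le_pow_left₀ (wn_nonneg _ _ _ hw0) h3 t
  rw [wn_pow ht _ _ hw0, mul_pow, mul_pow, rpow_inv_natCast_pow hG0 OO] at h4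
  refine h4.trans (le_of_eq ?_)
  rw [hG]; ring

lemma raise_triv {k l A A' B n : ℕ} (hk : 1 ≤ k) (hl : 1 ≤ l) (hA : 1 ≤ A) (hA' : 1 ≤ A') (hA'n : A' ≤ n) {E : ℝ} (hE : 0 ≤ E)
    (h : BilBd p k l A' B n E) : BilBd p k l A B n ((~p ^ A') ^ tri l * E) :=
  raiseG hk hl hA hA' hA'n hE PP
    (fun L _ c y S1 S2 _ _ _ _ _ => triv (tri_pos hl) _ (fun _ => by positivity) c y S1) h

lemma raise_multi {k l T B n e : ℕ} (hl : 1 ≤ l) (hlk : l ≤ k) (hpk : k < p) (hTn : T ≤ n) (hT : l * T = (k - l + 1) * B)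
    {Λ : ℝ} (hΛ : 1 ≤ Λ) (hD : ∀ m ≤ n, Dec p l m Λ) {E : ℝ} (hE : 0 ≤ E) (h : BilBd p k l T B n E) (i : ℕ) :
    ∀ A, 1 ≤ A → A ≤ T → l * e ≤ A → T ≤ A + i * e → BilBd p k l A B n ((Λ ^ i) ^ tri l * E) := by
  induction i with
  | zero => intro A _ h1 _ h2; obtain rfl : A = T := by omega
            simpa using h
  | succ i ih =>
    intro A hA hAT heA hT2
    have hA' : 1 ≤ min (A + e) T := by omega
    have := ih (min (A + e) T) hA' OO OO (by
      have : (i + 1) * e = i * e + e := by ring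
      omega)
    have hn' : min (A + e) T ≤ n := by omega
    have h1 : l * min (A + e) T ≤ (l + 1) * A := by
      calc l * min (A + e) T ≤ l * (A + e) := Nat.mul_le_mul_left _ OO
        _ ≤ _ := by nlinarith
    have h2 : l * min (A + e) T ≤ (k - l + 1) * B := by
      rw [← hT]; exact Nat.mul_le_mul_left _ OO
    have h3 := raiseG (hl.trans hlk) hl hA hA' hn' PP LL
      (fun L hL c y S1 S2 a b hab hS1 hS2 => raise1 hl hlk hpk
        (le_trans (Nat.mul_le_mul hlk hn') hL) h1 h2 LL (hD _ hn') c y S1 S2 a b hab hS1 hS2 _) this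
    refine h3.mono (le_of_eq ?_)
    rw [pow_succ, mul_pow]; ring

lemma raise_full {k l A T B n e i : ℕ} (hl : 1 ≤ l) (hlk : l ≤ k) (hpk : k < p) (hTn : T ≤ n) (hT : l * T = (k - l + 1) * B)
    {Λ : ℝ} (hΛ : 1 ≤ Λ) (hD : ∀ m ≤ n, Dec p l m Λ) {E : ℝ} (hE : 0 ≤ E) (h : BilBd p k l T B n E)
    (hA : 1 ≤ A) (hAT : A ≤ T) (he : n ≤ i * e) (he1 : 1 ≤ e) :
    BilBd p k l A B n ((~p ^ (l * e) * Λ ^ i) ^ tri l * E) := by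
  have hp1 : ~1 ≤ p := by exact_mod_cast hp.out.one_lt.le
  have hΛi : 1 ≤ Λ ^ i := one_le_pow₀ hΛ
  have hpp : ~1 ≤ ~p ^ (l * e) := one_le_pow₀ hp1
  have hle : 1 ≤ l * e := Nat.mul_pos hl he1
  rcases le_total T (l * e) with hc | hc
  · refine (raise_triv (hl.trans hlk) hl hA (hA.trans hAT) hTn hE h).mono ?_
    refine mul_le_mul_of_nonneg_right ?_ hE
    refine pow_le_pow_left₀ PP ?_ _
    calc ~p ^ T ≤ ~p ^ (l * e) := pow_le_pow_right₀ hp1 hc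
      _ ≤ _ := le_mul_of_one_le_right PP hΛi
  · rcases le_total (l * e) A with hc2 | hc2
    · refine (raise_multi hl hlk hpk hTn hT hΛ hD hE h i A hA hAT hc2 OO).mono ?_
      refine mul_le_mul_of_nonneg_right ?_ hE
      refine pow_le_pow_left₀ PP ?_ _
      exact le_mul_of_one_le_left PP hpp
    · have h1 := raise_multi hl hlk hpk hTn hT hΛ hD hE h i (l * e) hle hc le_rfl OO
      refine (raise_triv (hl.trans hlk) hl hA hle (hc.trans hTn) PP h1).mono (le_of_eq ?_)
      rw [mul_pow]; ring

lemma bil_zero {k A B n : ℕ} (hk : 1 ≤ k) (hB : B ≤ n) {D : ℝ} (hD0 : 0 ≤ D) (hD : Dec p k (n - B) D) :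
    BilBd p k 0 A B n (D ^ tri k) := by
  intro L hL c y S1 S2 a b _ _ h2
  have := rescale hk hB hL hD0 hD c y S2 b h2
  have h3 := pow_le_pow_left₀ (wn_nonneg _ _ _ fun _ => zero_le_one) this (tri k)
  rw [wn_pow (tri_pos hk) _ _ (fun _ => zero_le_one), mul_pow] at h3
  simpa [tri, Sg] using h3

lemma tri_mono {a b : ℕ} (h : a ≤ b) : tri a ≤ tri b := by
  have := two_tri a; have := two_tri b
  have : a * (a + 1) ≤ b * (b + 1) := Nat.mul_le_mul h OO
  omega

lemma bil_triv {k l A B n : ℕ} (hk : 1 ≤ k) (hlk : l ≤ k) {D : ℝ} (hD0 : 0 ≤ D) (hD : Dec p k n D) :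
    BilBd p k l A B n (D ^ tri k) := by
  intro L hL c y S1 S2 a b _ _ _
  have hs := tri_pos hk
  have htl := tri_mono hlk
  set s := tri k
  set t := tri l
  have e1 := pow_le_pow_left₀ (wn_nonneg _ _ _ fun _ => zero_le_one) (hD L hL c y S1) s
  have e2 := pow_le_pow_left₀ (wn_nonneg _ _ _ fun _ => zero_le_one) (hD L hL c y S2) s
  rw [wn_pow hs _ _ (fun _ => zero_le_one)] at e1 e2
  simp only [one_mul] at e1 e2
  have key := holder_int t (s - t) OO
    (fun α => ‖fT p k L c y S2 α‖ ^ (2 * (s - t)) * ‖fT p k L c y S1 α‖ ^ (2 * t))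
    (fun α => ‖fT p k L c y S1 α‖ ^ (2 * s)) (fun α => ‖fT p k L c y S2 α‖ ^ (2 * s))
    (fun _ => by positivity) (fun _ => by positivity) (fun _ => by positivity) (fun α => le_of_eq (by
      rw [show t + (s - t) = s by omega, mul_pow, ← pow_mul, ← pow_mul, ← pow_mul, ← pow_mul]
      rw [show 2 * s * t = 2 * t * s by ring, show 2 * s * (s - t) = 2 * (s - t) * s by ring]; ring))
  rw [show t + (s - t) = s by omega] at key
  have hS1 : 0 ≤ Sg p k L n c y S1 := Sg_nonneg
  have hS2 : 0 ≤ Sg p k L n c y S2 := Sg_nonneg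
  apply le_of_pow_le_pow_left₀ (n := s) OO PP
  refine key.trans ((mul_le_mul (pow_le_pow_left₀ PP e1 _) (pow_le_pow_left₀ PP e2 _)
    PP PP).trans (le_of_eq ?_))
  change ((D * Sg p k L n c y S1) ^ s) ^ t * ((D * Sg p k L n c y S2) ^ s) ^ (s - t) = _
  rw [← pow_mul, ← pow_mul, mul_comm s t, mul_comm s (s - t), pow_mul, pow_mul, ← mul_pow]
  congr 1
  rw [mul_pow, mul_pow]
  calc _ = (D ^ t * D ^ (s - t)) * (Sg p k L n c y S1 ^ t * Sg p k L n c y S2 ^ (s - t)) := by ring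
    _ = _ := by rw [← pow_add, show t + (s - t) = s by omega]

lemma bil_holder {k l A B n : ℕ} (hl : 1 ≤ l) (hlk : l < k) {E1 E2 E : ℝ} (hE1 : 0 ≤ E1) (hE0 : 0 ≤ E)
    (hE : E1 ^ (k - l) * E2 ≤ E ^ (k - l + 1)) (h1 : BilBd p k (l - 1) A B n E1) (h2 : BilBd p k (k - l) B A n E2) :
    BilBd p k l A B n E := by
  intro L hL c y S1 S2 a b hab hS1 hS2
  have b1 := h1 L hL c y S1 S2 a b hab hS1 hS2
  have b2 := h2 L hL c y S2 S1 b a (fun hc => hab (by rw [← dvd_neg]; simpa using hc)) hS2 hS1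
  have i1 : (k - l) * tri (l - 1) + (tri k - tri (k - l)) = (k - l + 1) * tri l ∧
      (k - l) * (tri k - tri (l - 1)) + tri (k - l) = (k - l + 1) * (tri k - tri l) := by
    obtain ⟨m, rfl⟩ : ∃ m, k = l + m := ⟨k - l, by omega⟩
    obtain ⟨q, rfl⟩ : ∃ q, l = q + 1 := ⟨l - 1, by omega⟩
    have t1 := two_tri q; have t2 := two_tri (q + 1); have t3 := two_tri m; have t4 := two_tri (q + 1 + m)
    have m1 : tri q ≤ tri (q + 1 + m) := tri_mono OO
    have m2 : tri (q + 1) ≤ tri (q + 1 + m) := tri_mono OO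
    have m3 : tri m ≤ tri (q + 1 + m) := tri_mono OO
    rw [show q + 1 + m - (q + 1) = m by omega, show q + 1 - 1 = q by omega]
    zify [m1, m2, m3] at *
    constructor <;> nlinarith
  set m := k - l with hm
  have hS1 : 0 ≤ Sg p k L n c y S1 := Sg_nonneg
  have hS2 : 0 ≤ Sg p k L n c y S2 := Sg_nonneg
  set σ1 := Sg p k L n c y S1
  set σ2 := Sg p k L n c y S2
  have pe : ∀ a b : ℝ, (b ^ (2 * (tri k - tri (l - 1))) * a ^ (2 * tri (l - 1))) ^ m *
      (a ^ (2 * (tri k - tri m)) * b ^ (2 * tri m)) ^ 1 = (b ^ (2 * (tri k - tri l)) * a ^ (2 * tri l)) ^ (m + 1) := by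
    intro a b
    have x1 : (2 * (tri k - tri (l - 1))) * m + 2 * tri m = 2 * (tri k - tri l) * (m + 1) := by linarith [i1.2]
    have x2 : 2 * tri (l - 1) * m + 2 * (tri k - tri m) = 2 * tri l * (m + 1) := by linarith [i1.1]
    rw [mul_pow, mul_pow (b ^ (2 * (tri k - tri l))), ← pow_mul, ← pow_mul, ← pow_mul, ← pow_mul, ← x1, ← x2, pow_add, pow_add]
    ring
  have key := holder_int m 1 OO
    (fun α => ‖fT p k L c y S2 α‖ ^ (2 * (tri k - tri l)) * ‖fT p k L c y S1 α‖ ^ (2 * tri l))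
    (fun α => ‖fT p k L c y S2 α‖ ^ (2 * (tri k - tri (l - 1))) * ‖fT p k L c y S1 α‖ ^ (2 * tri (l - 1)))
    (fun α => ‖fT p k L c y S1 α‖ ^ (2 * (tri k - tri m)) * ‖fT p k L c y S2 α‖ ^ (2 * tri m))
    (fun _ => by positivity) (fun _ => by positivity) (fun _ => by positivity) (fun α => le_of_eq (pe _ _).symm)
  apply le_of_pow_le_pow_left₀ (n := m + 1) OO PP
  rw [pow_one] at key
  refine key.trans ((mul_le_mul (pow_le_pow_left₀ PP b1 _) b2 PP PP).trans ?_)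
  have x1 : (tri k - tri (l - 1)) * m + tri m = (tri k - tri l) * (m + 1) := by linarith [i1.2]
  have x2 : tri (l - 1) * m + (tri k - tri m) = tri l * (m + 1) := by linarith [i1.1]
  calc _ = (E1 ^ m * E2) * (σ1 ^ (tri (l - 1) * m + (tri k - tri m)) * σ2 ^ ((tri k - tri (l - 1)) * m + tri m)) := by
        rw [pow_add, pow_add, pow_mul, pow_mul]; ring
    _ ≤ E ^ (m + 1) * (σ1 ^ (tri (l - 1) * m + (tri k - tri m)) * σ2 ^ ((tri k - tri (l - 1)) * m + tri m)) :=
        mul_le_mul_of_nonneg_right hE PP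
    _ = _ := by rw [x1, x2, pow_mul, pow_mul]; ring

end VM

namespace VM
set_option linter.unusedSectionVars false
variable {p : ℕ} [hp : Fact p.Prime]

def EpsDec (p : ℕ) [Fact p.Prime] (l : ℕ) : Prop :=
  ∀ ε : ℝ, 0 < ε → ∃ C : ℝ, 1 ≤ C ∧ ∀ n : ℕ, Dec p l n (C * ~p ^ (ε * n))

lemma raise_eps {k l : ℕ} (hl : 1 ≤ l) (hlk : l ≤ k) (hpk : k < p) (H : EpsDec p l) (ε : ℝ) (hε : 0 < ε) :
    ∃ C : ℝ, 1 ≤ C ∧ ∀ n A B T : ℕ, T ≤ n → l * T = (k - l + 1) * B → 1 ≤ A → A ≤ T → ∀ E : ℝ, 0 ≤ E →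
      BilBd p k l T B n E → BilBd p k l A B n (C * ~p ^ (ε * n) * E) := by
  have hP1 : ~1 ≤ p := by exact_mod_cast hp.out.one_lt.le
  have hP0 : ~0 < p := by linarith
  have ht1 : 1 ≤ tri l := tri_pos hl
  set t := tri l with ht
  have ht0 : ~0 < t := by exact_mod_cast ht1
  set q : ℕ := ⌈2 * t * l / ε⌉₊ + 1 with hq
  have hq0 : ~0 < q := by rw [hq]; positivity
  have hqb : (t * l : ℝ) / q ≤ ε / 2 := by
    rw [div_le_iff₀ hq0]
    have : 2 * t * l / ε ≤ q := by
      rw [hq]; push_cast; exact (Nat.le_ceil _).trans LL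
    rw [div_le_iff₀ hε] at this; linarith
  obtain ⟨C0, hC0, hD⟩ := H (ε / (2 * q * t)) PP
  refine ⟨~p ^ (l * t) * C0 ^ (q * t), one_le_mul_of_one_le_of_one_le (one_le_pow₀ hP1) (one_le_pow₀ hC0), ?_⟩
  intro n A B T hTn hT hA hAT E hE h
  have hdec : ∀ m ≤ n, Dec p l m (C0 * ~p ^ (ε / (2 * q * t) * n)) := by
    intro m hm
    refine (hD m).mono ?_
    refine mul_le_mul_of_nonneg_left (rpow_le_rpow_of_exponent_le hP1 ?_) LL
    have : ~m ≤ n := by exact_mod_cast hm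
    exact mul_le_mul_of_nonneg_left this PP
  have h1 : 1 ≤ C0 * ~p ^ (ε / (2 * q * t) * n) :=
    one_le_mul_of_one_le_of_one_le hC0 (one_le_rpow hP1 PP)
  have := raise_full hl hlk hpk hTn hT h1 hdec hE h hA hAT (i := q) (e := n / q + 1)
    (by have := Nat.lt_mul_div_succ n (show 0 < q by rw [hq]; omega); exact this.le) (Nat.le_add_left _ _)
  refine this.mono (mul_le_mul_of_nonneg_right ?_ hE)
  have e1 : (~p ^ (l * (n / q + 1))) ^ t ≤ ~p ^ (l * t) * ~p ^ (ε / 2 * n) := by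
    rw [← pow_mul, show l * (n / q + 1) * t = l * t + (t * l) * (n / q) by ring, pow_add]
    refine mul_le_mul_of_nonneg_left ?_ PP
    rw [← rpow_natCast]
    refine rpow_le_rpow_of_exponent_le hP1 ?_
    push_cast
    have : ~(n / q : ℕ) ≤ n / q := Nat.cast_div_le
    calc (t * l : ℝ) * ~(n / q : ℕ) ≤ (t * l) * (n / q) := mul_le_mul_of_nonneg_left this PP
      _ = (t * l) / q * n := by ring
      _ ≤ _ := mul_le_mul_of_nonneg_right hqb PP
  have e2 : ((C0 * ~p ^ (ε / (2 * q * t) * n)) ^ q) ^ t = C0 ^ (q * t) * ~p ^ (ε / 2 * n) := by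
    rw [← pow_mul, mul_pow, ← rpow_natCast (~p ^ _), ← rpow_mul hP0.le]
    congr 2; push_cast; field_simp
  rw [mul_pow, e2]
  refine (mul_le_mul_of_nonneg_right e1 PP).trans (le_of_eq ?_)
  have : ~p ^ (ε * n) = ~p ^ (ε / 2 * n) * ~p ^ (ε / 2 * n) := by
    rw [← rpow_add hP0]; congr 1; ring
  rw [this]; ring

def gg (k : ℕ) : ℕ → ℕ → ℝ
  | 0, l => if l = 0 then 1 else 0
  | r + 1, l => if l = 0 then 1 else (~k - l) / (k - l + 1) * gg k r (l - 1) + gg k r (k - l) / l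

lemma gg_zero (k r : ℕ) : gg k r 0 = 1 := by cases r <;> simp [gg]

lemma gg_sum (k : ℕ) (hk : 2 ≤ k) (r : ℕ) : ∑ i ∈ range (k - 1), gg k r (i + 1) = r * ((k - 1) / k) := by
  obtain ⟨K, rfl⟩ : ∃ K, k = K + 2 := ⟨k - 2, by omega⟩
  induction r with
  | zero => simp [gg]
  | succ r ih =>
    rw [show K + 2 - 1 = K + 1 by omega] at *
    simp only [gg, Nat.add_eq_zero_iff, one_ne_zero, and_false, if_false, Nat.add_sub_cancel]
    rw [sum_add_distrib, ← sum_range_reflect (fun i => gg (K + 2) r (K + 2 - (i + 1)) / ~(i + 1 : ℕ)),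
      sum_range_succ', gg_zero]
    have h1 : ∀ i ∈ range (K + 1), gg (K + 2) r (K + 2 - (K + 1 - 1 - i + 1)) / ~(K + 1 - 1 - i + 1 : ℕ) =
        gg (K + 2) r (i + 1) / (K + 1 - i) := by
      intro i hi
      simp at hi
      rw [show K + 2 - (K + 1 - 1 - i + 1) = i + 1 by omega]
      congr 1
      rw [show K + 1 - 1 - i + 1 = K + 1 - i by omega, Nat.cast_sub OO]; push_cast; ring
    rw [sum_congr rfl h1]
    have h2 : ∑ i ∈ range K, (~(K + 2 : ℕ) - ~(i + 1 + 1 : ℕ)) / (~(K + 2 : ℕ) - ~(i + 1 + 1 : ℕ) + 1) * gg (K + 2) r (i + 1)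
      = ∑ i ∈ range (K + 1), (~K - i) / (K + 1 - i) * gg (K + 2) r (i + 1) := by
      rw [sum_range_succ]
      simp only [sub_self, zero_div, zero_mul, add_zero]
      refine sum_congr rfl fun i _ => ?_
      congr 1; push_cast; congr 1 <;> ring
    rw [h2, add_right_comm, ← sum_add_distrib]
    have h3 : ∀ i ∈ range (K + 1), (~K - i) / (K + 1 - i) * gg (K + 2) r (i + 1) + gg (K + 2) r (i + 1) / (K + 1 - i)
        = gg (K + 2) r (i + 1) := by
      intro i hi
      simp at hi
      have : ~i ≤ K := by exact_mod_cast (by omega : i ≤ K)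
      have : ~K + 1 - i ≠ 0 := by linarith
      field_simp; ring
    rw [sum_congr rfl h3, ih]
    push_cast
    rw [sub_add_cancel]; ring

lemma gg_large (k : ℕ) (hk : 2 ≤ k) (r : ℕ) : ∃ l, 1 ≤ l ∧ l < k ∧ (r : ℝ) / k ≤ gg k r l := by
  by_contra hcon
  push Not at hcon
  have hk' : ~2 ≤ k := by exact_mod_cast hk
  have : ∑ i ∈ range (k - 1), gg k r (i + 1) < ∑ i ∈ range (k - 1), (r : ℝ) / k :=
    sum_lt_sum_of_nonempty ⟨0, by simp; omega⟩ fun i hi => hcon (i + 1) OO (by simp at hi; omega)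
  rw [gg_sum k hk, sum_const, card_range, nsmul_eq_mul, Nat.cast_sub OO] at this
  push_cast at this
  have e : (r : ℝ) * ((k - 1) / k) = (k - 1) * (r / k) := by ring
  linarith

lemma claim {k : ℕ} (hk : 2 ≤ k) (hpk : k < p) (hlow : ∀ l, 1 ≤ l → l < k → EpsDec p l) (η : ℝ) (CD : ℝ)
    (hCD : 1 ≤ CD) (hD : ∀ n, Dec p k n (CD * ~p ^ (η * n))) (r : ℕ) :
    ∀ ε : ℝ, 0 < ε → ∃ C : ℝ, 1 ≤ C ∧ ∀ n B A l : ℕ, 1 ≤ l → l < k → k.factorial ^ r ∣ B → k ^ r * B ≤ n → 1 ≤ A →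
      l * A ≤ (k - l + 1) * B → BilBd p k l A B n (C * ~p ^ (η * tri k * (n - gg k r l * B) + ε * n)) := by
  have hP1 : ~1 ≤ p := by exact_mod_cast hp.out.one_lt.le
  have hP0 : ~0 < p := by linarith
  have hpw : ∀ m : ℝ, (CD * ~p ^ (η * m)) ^ tri k = CD ^ tri k * ~p ^ (η * tri k * m) := by
    intro m
    rw [mul_pow, ← rpow_natCast (~p ^ _), ← rpow_mul hP0.le]; congr 2; ring
  induction r with
  | zero =>
    intro ε hε
    refine ⟨CD ^ tri k, one_le_pow₀ hCD, ?_⟩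
    intro n B A l hl hlk _ _ _ _
    refine (bil_triv OO hlk.le PP (hD n)).mono ?_
    rw [hpw]
    refine mul_le_mul_of_nonneg_left (rpow_le_rpow_of_exponent_le hP1 ?_) PP
    simp only [gg, show l ≠ 0 by omega, if_false, zero_mul, sub_zero]
    have : 0 ≤ ε * n := by positivity
    linarith
  | succ r ih =>
    intro ε hε
    obtain ⟨C1, hC1, h1⟩ := ih (ε / 2) PP
    have hR : ∀ l, ∃ C : ℝ, 1 ≤ C ∧ (1 ≤ l → l < k → ∀ n A B T : ℕ, T ≤ n → l * T = (k - l + 1) * B → 1 ≤ A → A ≤ T → ∀ E : ℝ, 0 ≤ E →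
      BilBd p k l T B n E → BilBd p k l A B n (C * ~p ^ (ε / 2 * n) * E)) := by
      intro l
      by_cases hh : 1 ≤ l ∧ l < k
      · obtain ⟨C, hC, h⟩ := raise_eps hh.1 hh.2.le hpk (hlow l hh.1 hh.2) (ε / 2) PP
        exact ⟨C, hC, fun _ _ => h⟩
      · exact ⟨1, le_rfl, fun a b => absurd ⟨a, b⟩ hh⟩
    choose CR hCR hR using hR
    set C2 : ℝ := max C1 (CD ^ tri k) with hC2
    have hC2' : 1 ≤ C2 := hC1.trans (le_max_left _ _)
    set C3 : ℝ := ∑ l ∈ range k, CR l with hC3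
    have hCRle : ∀ l, l < k → CR l ≤ C3 := fun l hl => single_le_sum (f := CR) (fun i _ => by linarith [hCR i]) (mem_range.2 hl)
    have hC3' : 1 ≤ C3 := (hCR 0).trans (hCRle 0 OO)
    refine ⟨C3 * C2, one_le_mul_of_one_le_of_one_le hC3' hC2', ?_⟩
    intro n B A l hl hlk hB hBn hA hAB
    have hkr : k ^ (r + 1) = k ^ r * k := pow_succ _ _
    have hkr0 : 1 ≤ k ^ r := Nat.one_le_pow _ _ OO
    obtain ⟨Bq, rfl⟩ := hB
    obtain ⟨f, hf⟩ := Nat.dvd_factorial (by omega : 0 < l) hlk.le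
    set B := k.factorial ^ (r + 1) * Bq with hBdef
    set T := (k - l + 1) * (k.factorial ^ r * f * Bq) with hTdef
    have hT : l * T = (k - l + 1) * B := by
      rw [hTdef, hBdef, pow_succ, hf]; ring
    have hTdvd : k.factorial ^ r ∣ T := ⟨(k - l + 1) * (f * Bq), by rw [hTdef]; ring⟩
    have hAT : A ≤ T := by
      have : l * A ≤ l * T := by rw [hT]; exact hAB
      exact Nat.le_of_mul_le_mul_left this OO
    have hTkB : T ≤ k * B := by
      have h5 : T ≤ l * T := Nat.le_mul_of_pos_left _ hl
      rw [hT] at h5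
      exact h5.trans (Nat.mul_le_mul_right _ OO)
    have hTn' : k ^ r * T ≤ n := by
      refine le_trans ?_ hBn
      rw [hkr, mul_assoc]; exact Nat.mul_le_mul_left _ hTkB
    have hTn : T ≤ n := le_trans (Nat.le_mul_of_pos_left _ hkr0) hTn'
    have hBn' : k ^ r * B ≤ n := by
      refine le_trans ?_ hBn
      rw [hkr, mul_assoc]; exact Nat.mul_le_mul_left _ (Nat.le_mul_of_pos_left _ OO)
    have hBn2 : B ≤ n := le_trans (Nat.le_mul_of_pos_left _ hkr0) hBn'
    have hB1 : 1 ≤ B := by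
      rcases Nat.eq_zero_or_pos B with h0 | h0
      · rw [h0, mul_zero] at hAB
        have := Nat.mul_pos hl hA; omega
      · exact h0
    have b1 : BilBd p k (l - 1) T B n (C2 * ~p ^ (η * tri k * (n - gg k r (l - 1) * B) + ε / 2 * n)) := by
      rcases Nat.eq_or_lt_of_le hl with h0 | h0
      · rw [← h0, Nat.sub_self, gg_zero]
        refine (bil_zero OO hBn2 PP (hD (n - B))).mono ?_
        rw [hpw, Nat.cast_sub hBn2]
        refine mul_le_mul (le_max_right _ _) (rpow_le_rpow_of_exponent_le hP1 ?_) PP PP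
        have : 0 ≤ ε / 2 * n := by positivity
        linarith
      · refine (h1 n B T (l - 1) OO OO ⟨k.factorial * Bq, by rw [hBdef, pow_succ]; ring⟩ hBn' (hA.trans hAT) ?_).mono
          (mul_le_mul_of_nonneg_right (le_max_left _ _) PP)
        calc (l - 1) * T ≤ l * T := Nat.mul_le_mul_right _ OO
          _ = (k - l + 1) * B := hT
          _ ≤ _ := Nat.mul_le_mul_right _ OO
    have b2 : BilBd p k (k - l) B T n (C2 * ~p ^ (η * tri k * (n - gg k r (k - l) * T) + ε / 2 * n)) := by
      refine (h1 n T B (k - l) OO OO hTdvd hTn' hB1 ?_).mono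
          (mul_le_mul_of_nonneg_right (le_max_left _ _) PP)
      rw [show k - (k - l) + 1 = l + 1 by omega]
      calc (k - l) * B ≤ (k - l + 1) * B := Nat.mul_le_mul_right _ OO
        _ = l * T := hT.symm
        _ ≤ _ := Nat.mul_le_mul_right _ OO
    have b3 := bil_holder (E := C2 * ~p ^ (η * tri k * (n - gg k (r + 1) l * B) + ε / 2 * n)) hl hlk PP PP (le_of_eq ?_) b1 b2
    · refine (hR l hl hlk n A B T hTn hT hA hAT _ PP b3).mono ?_
      have e1 : ~p ^ (η * tri k * (n - gg k (r + 1) l * B) + ε * n) = ~p ^ (ε / 2 * n) * ~p ^ (η * tri k * (n - gg k (r + 1) l * B) + ε / 2 * n) := by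
        rw [← rpow_add hP0]; congr 1; ring
      rw [e1]
      calc _ = CR l * (C2 * (~p ^ (ε / 2 * n) * ~p ^ (η * tri k * (n - gg k (r + 1) l * B) + ε / 2 * n))) := by ring
        _ ≤ C3 * (C2 * (~p ^ (ε / 2 * n) * ~p ^ (η * tri k * (n - gg k (r + 1) l * B) + ε / 2 * n))) :=
          mul_le_mul_of_nonneg_right (hCRle l hlk) PP
        _ = _ := by ring
    · obtain ⟨m, hm⟩ : ∃ m, k = l + m := ⟨k - l, by omega⟩
      have hkl : k - l = m := by omega
      have hkc : ~k = l + m := by rw [hm]; push_cast; ring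
      rw [hkl] at hT ⊢
      have hTr : ~l * T = (m + 1) * B := by exact_mod_cast hT
      have hl0 : ~0 < l := by exact_mod_cast hl
      rw [mul_pow, mul_pow, ← rpow_natCast (~p ^ _), ← rpow_natCast (~p ^ _), ← rpow_mul hP0.le,
        ← rpow_mul hP0.le, mul_mul_mul_comm, ← pow_succ, ← rpow_add hP0]
      congr 2
      have hg : (~m + 1) * (gg k (r + 1) l * B) = m * gg k r (l - 1) * B + gg k r m * T := by
        have hTT : ~T = (m + 1) * B / l := by field_simp; linarith
        simp only [gg, show l ≠ 0 by omega, if_false, hkl]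
        rw [hTT, hkc]
        have : ~l + m - l = m := by ring
        rw [this]
        field_simp
      push_cast
      linear_combination (η * tri k) * hg

end VM

namespace VM
set_option linter.unusedSectionVars false
variable {p : ℕ} [hp : Fact p.Prime]

lemma dec_one (n : ℕ) : Dec p 1 n 1 := by
  intro L hL c y S
  rw [one_mul] at hL
  have ht : tri 1 = 1 := rfl
  rw [ht, one_mul]
  unfold wn
  simp only [one_mul, mul_one, Nat.cast_one, inv_one, rpow_one]
  rw [sum_comm]
  apply le_of_eq
  have orth : ∀ r r' : ZMod (p ^ n), r ≠ r' →
      ∑ α : Fin 1 → ZMod (p ^ L), fS c y (cl p y S n r) α * (starRingEnd ℂ) (fS c y (cl p y S n r') α) = 0 := by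
    intro r r' hr
    unfold fS
    simp_rw [map_sum, sum_mul_sum, map_mul]
    rw [sum_comm]
    refine sum_eq_zero fun x hx => ?_
    rw [sum_comm]
    refine sum_eq_zero fun x' hx' => ?_
    have hne : ((y x : ℤ) : ZMod (p ^ L)) - ((y x' : ℤ) : ZMod (p ^ L)) ≠ 0 := by
      intro h0
      have h1 := (mem_filter.1 hx).2
      have h2 := (mem_filter.1 hx').2
      apply hr
      rw [← h1, ← h2]
      have hd : p ^ n ∣ p ^ L := pow_dvd_pow _ hL
      have := congrArg (ZMod.castHom hd (ZMod (p ^ n))) (sub_eq_zero.1 h0)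
      simpa only [map_intCast] using this
    have h3 : ∀ α : Fin 1 → ZMod (p ^ L), c x * ZMod.stdAddChar (ph α (y x)) *
        ((starRingEnd ℂ) (c x') * (starRingEnd ℂ) (ZMod.stdAddChar (ph α (y x')))) =
        c x * (starRingEnd ℂ) (c x') * ZMod.stdAddChar (α 0 * (((y x : ℤ) : ZMod (p ^ L)) - ((y x' : ℤ) : ZMod (p ^ L)))) := by
      intro α
      have e1 : ∀ v, ph α v = α 0 * v := by intro v; simp [ph]
      rw [e1, e1, ← AddChar.map_neg_eq_conj, mul_sub, sub_eq_add_neg, AddChar.map_add_eq_mul]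
      ring
    simp_rw [h3]
    rw [← mul_sum]
    have h4 : ∑ α : Fin 1 → ZMod (p ^ L), ZMod.stdAddChar (α 0 * (((y x : ℤ) : ZMod (p ^ L)) - ((y x' : ℤ) : ZMod (p ^ L)))) =
        ∑ a : ZMod (p ^ L), ZMod.stdAddChar (a * (((y x : ℤ) : ZMod (p ^ L)) - ((y x' : ℤ) : ZMod (p ^ L)))) :=
      Fintype.sum_equiv (Equiv.funUnique (Fin 1) (ZMod (p ^ L))) _ _ (fun α => rfl)
    rw [h4, AddChar.sum_mulShift _ (ZMod.isPrimitive_stdAddChar _), if_neg hne]; simp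
  have hc : ((∑ α : Fin 1 → ZMod (p ^ L), ‖fS c y S α‖ ^ 2 : ℝ) : ℂ) =
      ((∑ α : Fin 1 → ZMod (p ^ L), ∑ r : ZMod (p ^ n), ‖fS c y (cl p y S n r) α‖ ^ 2 : ℝ) : ℂ) := by
    push_cast
    simp_rw [← Complex.mul_conj']
    have : ∀ α : Fin 1 → ZMod (p ^ L), fS c y S α * (starRingEnd ℂ) (fS c y S α) =
        ∑ r : ZMod (p ^ n), ∑ r' : ZMod (p ^ n), fS c y (cl p y S n r) α * (starRingEnd ℂ) (fS c y (cl p y S n r') α) := by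
      intro α
      rw [fS_cl c y S n α, map_sum, sum_mul_sum]
    simp_rw [this]
    rw [sum_comm, sum_comm (s := (univ : Finset (Fin 1 → ZMod (p ^ L))))]
    refine sum_congr rfl fun r _ => ?_
    rw [sum_comm, sum_eq_single r]
    · intro r' _ hr'
      exact orth r r' hr'.symm
    · simp
  exact_mod_cast hc

lemma raise2 {k l A B n : ℕ} (hk : 1 ≤ k) (hlk : l < k) (hB : 1 ≤ B) (hBn : B ≤ n) {E : ℝ} (hE : 0 ≤ E)
    (h : BilBd p k l A B n E) : BilBd p k l A 1 n ((~p ^ B) ^ (tri k - tri l) * E) := by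
  intro L hL c y S1 S2 a b hab h1 h2
  have ht : 1 ≤ tri k - tri l := by
    have h3 := two_tri l; have h4 := two_tri k
    have : l * (l + 1) + 2 ≤ k * (k + 1) := by nlinarith
    omega
  set t := tri k - tri l
  set w : (Fin k → ZMod (p ^ L)) → ℝ := fun α => ‖fT p k L c y S1 α‖ ^ (2 * tri l) with hw
  have hw0 : ∀ α, 0 ≤ w α := fun α => by positivity
  set G : ℝ := E * Sg p k L n c y S1 ^ tri l with hG
  have hG0 : 0 ≤ G := mul_nonneg hE (pow_nonneg Sg_nonneg _)
  have hcl : ∀ r, wn t w (fS c y (cl p y S2 B r)) ≤ G ^ ((t : ℝ)⁻¹) * Sg p k L n c y (cl p y S2 B r) := by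
    intro r
    rcases (cl p y S2 B r).eq_empty_or_nonempty with h0 | ⟨x0, hx0⟩
    · rw [h0, wn_empty ht]; exact mul_nonneg (rpow_nonneg hG0 _) Sg_nonneg
    · have hx0' := mem_filter.1 hx0
      have hd : (p : ℤ) ∣ y x0 - b := by simpa using h2 x0 hx0'.1
      have := h L hL c y S1 (cl p y S2 B r) a (y x0)
        (fun hc => hab (by have := dvd_add hc hd; rwa [show a - y x0 + (y x0 - b) = a - b by ring] at this)) h1
        (by
          intro x hx
          have hx' := mem_filter.1 hx
          have := (ZMod.intCast_eq_intCast_iff_dvd_sub (y x0) (y x) (p ^ B)).1 (by rw [hx0'.2, hx'.2])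
          push_cast at this; exact this)
      apply le_of_pow_le_pow_left₀ (n := t) OO (mul_nonneg (rpow_nonneg hG0 _) Sg_nonneg)
      rw [wn_pow ht _ _ hw0, mul_pow, rpow_inv_natCast_pow hG0 OO]
      refine le_trans (le_of_eq ?_) (this.trans (le_of_eq ?_))
      · exact sum_congr rfl fun α _ => by rw [hw]; ring
      · rw [hG]; ring
  have h3 : wn t w (fS c y S2) ≤ ~p ^ B * (G ^ ((t : ℝ)⁻¹) * Sg p k L n c y S2) := by
    refine (triv (n := B) ht w hw0 c y S2).trans (mul_le_mul_of_nonneg_left ?_ PP)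
    rw [← Sg_add hk hBn c y S2, mul_sum]
    exact sum_le_sum fun r _ => hcl r
  have h4 := pow_le_pow_left₀ (wn_nonneg _ _ _ hw0) h3 t
  rw [wn_pow ht _ _ hw0, mul_pow, mul_pow, rpow_inv_natCast_pow hG0 OO] at h4
  refine le_trans (le_of_eq ?_) (h4.trans (le_of_eq ?_))
  · exact sum_congr rfl fun α _ => by rw [hw]; ring
  · rw [hG]; ring

/-- pointwise broad-narrow -/
lemma broad_pt {ι : Type*} [Fintype ι] [DecidableEq ι] [Nonempty ι] (f : ι → ℂ) (n : ℕ) (hn : 1 ≤ n) (s t : ℕ) (hts : t ≤ s) :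
    ‖∑ i, f i‖ ^ (2 * s) ≤ (1 + 1 / ~n) ^ (2 * s) * ∑ i, ‖f i‖ ^ (2 * s) +
      ((~n + 1) * Fintype.card ι) ^ (2 * s) * ∑ i, ∑ j, if i ≠ j then ‖f j‖ ^ (2 * (s - t)) * ‖f i‖ ^ (2 * t) else 0 := by
  have hn0 : ~0 < n := by exact_mod_cast hn
  set N : ℝ := (Fintype.card ι : ℝ) with hN
  have hN0 : 0 < N := by rw [hN]; exact_mod_cast Fintype.card_pos
  set F := ‖∑ i, f i‖ with hF
  have hF0 : 0 ≤ F := norm_nonneg _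
  obtain ⟨i, -, hi⟩ := exists_max_image univ (fun i => ‖f i‖) univ_nonempty
  have hsum0 : 0 ≤ ∑ i, ∑ j, if i ≠ j then ‖f j‖ ^ (2 * (s - t)) * ‖f i‖ ^ (2 * t) else 0 :=
    sum_nonneg fun i _ => sum_nonneg fun j _ => by split_ifs <;> positivity
  have hsum1 : 0 ≤ ∑ i, ‖f i‖ ^ (2 * s) := by positivity
  by_cases hc : F ≤ (1 + 1 / ~n) * ‖f i‖
  · have h1 := pow_le_pow_left₀ hF0 hc (2 * s)
    rw [mul_pow] at h1
    have h2 : ‖f i‖ ^ (2 * s) ≤ ∑ i, ‖f i‖ ^ (2 * s) :=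
      single_le_sum (f := fun i => ‖f i‖ ^ (2 * s)) (fun _ _ => by positivity) (mem_univ i)
    have h3 := mul_le_mul_of_nonneg_left h2 (show 0 ≤ (1 + 1 / ~n) ^ (2 * s) by positivity)
    have : 0 ≤ ((~n + 1) * N) ^ (2 * s) * ∑ i, ∑ j, if i ≠ j then ‖f j‖ ^ (2 * (s - t)) * ‖f i‖ ^ (2 * t) else 0 := by positivity
    linarith
  · push Not at hc
    have hex : ∃ j, j ≠ i ∧ F ≤ (~n + 1) * N * ‖f j‖ := by
      by_contra hcon
      push Not at hcon
      have hsplit : F ≤ ‖f i‖ + ∑ j ∈ univ.erase i, ‖f j‖ := by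
        rw [hF]
        refine (norm_sum_le _ _).trans (le_of_eq ?_)
        rw [add_sum_erase _ (fun j => ‖f j‖) (mem_univ i)]
      have hb : ∑ j ∈ univ.erase i, ‖f j‖ ≤ ∑ j ∈ univ.erase i, F / ((n + 1) * N) := by
        refine sum_le_sum fun j hj => ?_
        rw [le_div_iff₀ PP]
        linarith [hcon j (ne_of_mem_erase hj)]
      rw [sum_const, card_erase_of_mem (mem_univ i), nsmul_eq_mul] at hb
      have hcard : ((univ.card (α := ι) - 1 : ℕ) : ℝ) ≤ N := by
        rw [hN]; exact_mod_cast Nat.sub_le _ _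
      have hb2 : ((univ.card (α := ι) - 1 : ℕ) : ℝ) * (F / ((n + 1) * N)) ≤ N * (F / ((n + 1) * N)) :=
        mul_le_mul_of_nonneg_right hcard PP
      have hb3 : N * (F / ((n + 1) * N)) = F / (n + 1) := by field_simp
      have h5 : F - F / (n + 1) ≤ ‖f i‖ := by linarith
      have h6 : F * (n / (n + 1)) ≤ ‖f i‖ := by
        refine le_trans (le_of_eq ?_) h5; field_simp; ring
      have h7 := mul_le_mul_of_nonneg_left h6 (show 0 ≤ 1 + 1 / ~n by positivity)
      have h8 : (1 + 1 / ~n) * (F * (n / (n + 1))) = F := by field_simp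
      linarith
    obtain ⟨j, hji, hj⟩ := hex
    have hi' : F ≤ (~n + 1) * N * ‖f i‖ := hj.trans (mul_le_mul_of_nonneg_left (hi j (mem_univ j)) PP)
    have h1 : F ^ (2 * s) ≤ ((~n + 1) * N) ^ (2 * s) * (‖f j‖ ^ (2 * (s - t)) * ‖f i‖ ^ (2 * t)) := by
      calc F ^ (2 * s) = F ^ (2 * (s - t)) * F ^ (2 * t) := by rw [← pow_add]; congr 1; omega
        _ ≤ ((~n + 1) * N * ‖f j‖) ^ (2 * (s - t)) * ((~n + 1) * N * ‖f i‖) ^ (2 * t) :=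
          mul_le_mul (pow_le_pow_left₀ hF0 hj _) (pow_le_pow_left₀ hF0 hi' _) PP PP
        _ = ((~n + 1) * N) ^ (2 * (s - t) + 2 * t) * (‖f j‖ ^ (2 * (s - t)) * ‖f i‖ ^ (2 * t)) := by
          rw [mul_pow, mul_pow _ ‖f i‖, pow_add]; ring
        _ = _ := by rw [show 2 * (s - t) + 2 * t = 2 * s by omega]
    have h2 : ‖f j‖ ^ (2 * (s - t)) * ‖f i‖ ^ (2 * t) ≤ ∑ i, ∑ j, if i ≠ j then ‖f j‖ ^ (2 * (s - t)) * ‖f i‖ ^ (2 * t) else 0 := by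
      have a1 := single_le_sum (f := fun j => if i ≠ j then ‖f j‖ ^ (2 * (s - t)) * ‖f i‖ ^ (2 * t) else 0)
        (fun j _ => by split_ifs <;> positivity) (mem_univ j)
      have a2 := single_le_sum (f := fun i => ∑ j, if i ≠ j then ‖f j‖ ^ (2 * (s - t)) * ‖f i‖ ^ (2 * t) else 0)
        (fun i _ => sum_nonneg fun j _ => by split_ifs <;> positivity) (mem_univ i)
      simp only [if_pos hji.symm] at a1
      exact a1.trans a2
    have h3 := mul_le_mul_of_nonneg_left h2 (show 0 ≤ ((~n + 1) * N) ^ (2 * s) by positivity)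
    have : 0 ≤ (1 + 1 / ~n) ^ (2 * s) * ∑ i, ‖f i‖ ^ (2 * s) := by positivity
    linarith

lemma broad {k l n : ℕ} (hk : 1 ≤ k) (hlk : l ≤ k) (hn : 1 ≤ n) {D1 E D : ℝ} (hD1 : 0 ≤ D1) (hE : 0 ≤ E) (hD0 : 0 ≤ D)
    (hdec : Dec p k (n - 1) D1) (hbil : BilBd p k l 1 1 n E)
    (hD : (1 + 1 / ~n) ^ (2 * tri k) * D1 ^ tri k + ((~n + 1) * p) ^ (2 * tri k) * (p ^ 2 * E) ≤ D ^ tri k) :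
    Dec p k n D := by
  intro L hL c y S
  have hs := tri_pos hk
  have hts := tri_mono hlk
  set s := tri k with hs'
  change _ ≤ D * Sg p k L n c y S
  have hSg : 0 ≤ Sg p k L n c y S := Sg_nonneg
  apply le_of_pow_le_pow_left₀ (n := s) OO PP
  rw [wn_pow hs _ _ (fun _ => zero_le_one), mul_pow]
  simp only [one_mul]
  set SI : ZMod (p ^ 1) → ℝ := fun I => Sg p k L n c y (cl p y S 1 I) with hSI
  have hSI0 : ∀ I, 0 ≤ SI I := fun I => Sg_nonneg
  have hSIsum : ∑ I, SI I = Sg p k L n c y S := Sg_add hk hn c y S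
  have hSIle : ∀ I, SI I ≤ Sg p k L n c y S := fun I => by
    rw [← hSIsum]; exact single_le_sum (f := SI) (fun I _ => hSI0 I) (mem_univ I)
  have hcong : ∀ I : ZMod (p ^ 1), ∀ x ∈ cl p y S 1 I, (p : ℤ) ^ 1 ∣ y x - (I.val : ℤ) := by
    intro I x hx
    have := (mem_filter.1 hx).2
    have h2 : ((I.val : ℤ) : ZMod (p ^ 1)) = ((y x : ℤ) : ZMod (p ^ 1)) := by
      rw [this, Int.cast_natCast, ZMod.natCast_zmod_val]
    have := (ZMod.intCast_eq_intCast_iff_dvd_sub _ _ _).1 h2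
    exact_mod_cast this
  have narrow : ∑ I : ZMod (p ^ 1), ∑ α, ‖fT p k L c y (cl p y S 1 I) α‖ ^ (2 * s) ≤ D1 ^ s * Sg p k L n c y S ^ s := by
    have h1 : ∀ I : ZMod (p ^ 1), ∑ α, ‖fT p k L c y (cl p y S 1 I) α‖ ^ (2 * s) ≤ D1 ^ s * SI I ^ s := by
      intro I
      have := rescale hk hn hL hD1 hdec c y (cl p y S 1 I) (I.val : ℤ) (hcong I)
      have h2 := pow_le_pow_left₀ (wn_nonneg _ _ _ fun _ => zero_le_one) this s
      rw [wn_pow hs _ _ (fun _ => zero_le_one), mul_pow] at h2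
      simp only [one_mul] at h2
      exact h2
    refine (sum_le_sum fun I _ => h1 I).trans ?_
    rw [← mul_sum]
    refine mul_le_mul_of_nonneg_left ?_ PP
    obtain ⟨q, hq⟩ : ∃ q, s = q + 1 := ⟨s - 1, by omega⟩
    rw [hq]
    calc ∑ I, SI I ^ (q + 1) ≤ ∑ I, Sg p k L n c y S ^ q * SI I := sum_le_sum fun I _ => by
          rw [pow_succ]; exact mul_le_mul_of_nonneg_right (pow_le_pow_left₀ (hSI0 I) (hSIle I) _) (hSI0 I)
      _ = _ := by rw [← mul_sum, hSIsum, pow_succ]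
  have brd : ∑ I : ZMod (p ^ 1), ∑ J : ZMod (p ^ 1), ∑ α, (if I ≠ J then ‖fT p k L c y (cl p y S 1 J) α‖ ^ (2 * (s - tri l)) *
      ‖fT p k L c y (cl p y S 1 I) α‖ ^ (2 * tri l) else 0) ≤ p ^ 2 * E * Sg p k L n c y S ^ s := by
    have h1 : ∀ I J : ZMod (p ^ 1), ∑ α, (if I ≠ J then ‖fT p k L c y (cl p y S 1 J) α‖ ^ (2 * (s - tri l)) *
      ‖fT p k L c y (cl p y S 1 I) α‖ ^ (2 * tri l) else 0) ≤ E * Sg p k L n c y S ^ s := by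
      intro I J
      by_cases hIJ : I = J
      · simp only [hIJ, ne_eq, not_true, if_false, sum_const_zero]; positivity
      · simp only [ne_eq, hIJ, not_false_eq_true, if_true]
        refine (hbil L hL c y (cl p y S 1 I) (cl p y S 1 J) (I.val : ℤ) (J.val : ℤ) ?_ (hcong I) (hcong J)).trans ?_
        · intro hd
          apply hIJ
          have : ((J.val : ℤ) : ZMod (p ^ 1)) = ((I.val : ℤ) : ZMod (p ^ 1)) := by
            rw [ZMod.intCast_eq_intCast_iff_dvd_sub]; simpa using hd
          rw [Int.cast_natCast, Int.cast_natCast, ZMod.natCast_zmod_val, ZMod.natCast_zmod_val] at this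
          exact this.symm
        · refine mul_le_mul_of_nonneg_left ?_ hE
          calc _ ≤ Sg p k L n c y S ^ tri l * Sg p k L n c y S ^ (s - tri l) :=
                mul_le_mul (pow_le_pow_left₀ (hSI0 I) (hSIle I) _) (pow_le_pow_left₀ (hSI0 J) (hSIle J) _)
                  (pow_nonneg (hSI0 J) _) PP
            _ = _ := by rw [← pow_add]; congr 1; omega
    refine (sum_le_sum fun I _ => sum_le_sum fun J _ => h1 I J).trans (le_of_eq ?_)
    simp only [sum_const, card_univ, ZMod.card, nsmul_eq_mul]
    push_cast; ring
  have hpt : ∀ α, ‖fT p k L c y S α‖ ^ (2 * s) ≤ (1 + 1 / ~n) ^ (2 * s) * ∑ I : ZMod (p ^ 1), ‖fS c y (cl p y S 1 I) α‖ ^ (2 * s) +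
      ((~n + 1) * Fintype.card (ZMod (p ^ 1))) ^ (2 * s) * ∑ I : ZMod (p ^ 1), ∑ J : ZMod (p ^ 1), (if I ≠ J then ‖fT p k L c y (cl p y S 1 J) α‖ ^ (2 * (s - tri l)) *
      ‖fT p k L c y (cl p y S 1 I) α‖ ^ (2 * tri l) else 0) := fun α => by
    have := broad_pt (fun I : ZMod (p ^ 1) => fT p k L c y (cl p y S 1 I) α) n hn s (tri l) hts
    rw [← fS_cl c y S 1 α] at this
    convert this using 6
  refine (sum_le_sum fun α _ => hpt α).trans ?_
  rw [sum_add_distrib, ← mul_sum, ← mul_sum, sum_comm]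
  rw [sum_comm (s := (univ : Finset (Fin k → ZMod (p ^ L))))]
  have hcomm : ∀ I : ZMod (p ^ 1), ∑ α : Fin k → ZMod (p ^ L), ∑ J : ZMod (p ^ 1), (if I ≠ J then ‖fT p k L c y (cl p y S 1 J) α‖ ^ (2 * (s - tri l)) *
      ‖fT p k L c y (cl p y S 1 I) α‖ ^ (2 * tri l) else 0) = ∑ J : ZMod (p ^ 1), ∑ α : Fin k → ZMod (p ^ L), (if I ≠ J then ‖fT p k L c y (cl p y S 1 J) α‖ ^ (2 * (s - tri l)) *
      ‖fT p k L c y (cl p y S 1 I) α‖ ^ (2 * tri l) else 0) := fun I => sum_comm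
  simp_rw [hcomm]
  rw [ZMod.card, Nat.cast_pow, pow_one ~p]
  refine (add_le_add (mul_le_mul_of_nonneg_left narrow PP) (mul_le_mul_of_nonneg_left brd PP)).trans ?_
  refine le_trans (le_of_eq ?_) (mul_le_mul_of_nonneg_right hD PP)
  ring

end VM

namespace VM
set_option linter.unusedSectionVars false
variable {p : ℕ} [hp : Fact p.Prime]

lemma poly_absorb (δ : ℝ) (hδ : 0 < δ) : ∃ C : ℝ, 1 ≤ C ∧ ∀ n : ℕ, (~n + 1) ^ 5 ≤ C * ~p ^ (δ * n) := by
  have hp1 : ~1 < p := by exact_mod_cast hp.out.one_lt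
  set q : ℝ := ~p ^ (δ / 5) with hq
  have hq1 : 1 < q := one_lt_rpow hp1 PP
  have ha : 0 < q - 1 := by linarith
  refine ⟨(q / (q - 1)) ^ 5, one_le_pow₀ (by rw [le_div_iff₀ ha]; linarith), fun n => ?_⟩
  have h1 : ~1 + (n + 1 : ℕ) * (q - 1) ≤ (1 + (q - 1)) ^ (n + 1) :=
    one_add_mul_le_pow LL _
  have h2 : ~n + 1 ≤ q / (q - 1) * q ^ n := by
    rw [div_mul_eq_mul_div, le_div_iff₀ ha]
    push_cast at h1
    rw [add_sub_cancel, pow_succ] at h1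
    linarith
  have h3 := pow_le_pow_left₀ PP h2 5
  rw [mul_pow] at h3
  refine h3.trans (le_of_eq ?_)
  rw [hq, ← rpow_natCast, ← rpow_natCast (~p ^ (δ / 5)), ← rpow_mul PP, ← rpow_natCast (~p ^ _) 5, ← rpow_mul PP]
  congr 2; push_cast; ring

lemma improve {k : ℕ} (hk : 2 ≤ k) (hpk : k < p) (hlow : ∀ l, 1 ≤ l → l < k → EpsDec p l) (η1 : ℝ) (hη1 : 0 < η1) :
    ∃ c' : ℝ, 0 < c' ∧ ∀ η, η1 ≤ η → (∃ C : ℝ, 1 ≤ C ∧ ∀ n : ℕ, Dec p k n (C * ~p ^ (η * n))) →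
      ∃ C : ℝ, 1 ≤ C ∧ ∀ n : ℕ, Dec p k n (C * ~p ^ ((η - c') * n)) := by
  have hp1 : ~1 < p := by exact_mod_cast hp.out.one_lt
  have hp0 : ~0 < p := by linarith
  have hk0 : ~2 ≤ k := by exact_mod_cast hk
  obtain ⟨r, hr⟩ := exists_nat_ge (2 * k / η1)
  have hr1 : 1 ≤ r := by
    have : ~0 < r := lt_of_lt_of_le PP hr
    exact_mod_cast this
  obtain ⟨l, hl1, hlk, hgl⟩ := gg_large k hk r
  set g := gg k r l
  set F := k.factorial ^ r with hF
  set Kr := k ^ r with hKr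
  have hF1 : 1 ≤ F := Nat.one_le_pow _ _ (Nat.factorial_pos k)
  have hKr1 : 1 ≤ Kr := Nat.one_le_pow _ _ OO
  have hKrr : (r : ℝ) ≤ Kr := by
    have : r < k ^ r := Nat.lt_pow_self OO
    exact_mod_cast this.le
  have hKr0 : ~0 < Kr := by exact_mod_cast hKr1
  set s := tri k with hs
  have hs1 : 1 ≤ s := tri_pos OO
  have hs0 : ~1 ≤ s := by exact_mod_cast hs1
  set c0 : ℝ := 1 / Kr with hc0
  have hc00 : 0 < c0 := by positivity
  have hc0le : c0 ≤ η1 := by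
    rw [hc0, div_le_iff₀ hKr0]
    rw [div_le_iff₀ hη1] at hr
    nlinarith
  refine ⟨c0 / 4, by positivity, fun η hη ⟨CD, hCD, hD⟩ => ?_⟩
  have hηg : 2 ≤ η * g := by
    have h1 : 2 ≤ η1 * (r / k) := by
      rw [div_le_iff₀ hη1] at hr
      rw [← mul_div_assoc, le_div_iff₀ LL]; linarith
    have : η1 * (r / k) ≤ η * g := mul_le_mul hη hgl PP LL
    linarith
  obtain ⟨C, hC, hbil⟩ := claim hk hpk hlow η CD hCD hD r (s * c0 / 2) PP
  set ρ := η - c0 / 2 with hρ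
  have hρ0 : 0 ≤ ρ := by rw [hρ]; linarith
  set C' : ℝ := C * ~p ^ (s * F) with hC'
  have hC'1 : 1 ≤ C' := one_le_mul_of_one_le_of_one_le hC (one_le_pow₀ hp1.le)
  set N0 := F * Kr with hN0
  have hE : ∀ n, N0 ≤ n → BilBd p k l 1 1 n (C' * ~p ^ (s * ρ * n)) := by
    intro n hn
    set B := F * (n / N0) with hB
    have hdiv1 : 1 ≤ n / N0 := (Nat.one_le_div_iff PP).2 hn
    have hB1 : F ≤ B := Nat.le_mul_of_pos_right _ hdiv1
    have hKB : Kr * B ≤ n := by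
      calc Kr * B = N0 * (n / N0) := by rw [hB, hN0]; ring
        _ ≤ n := Nat.mul_div_le n N0
    have hBn : B ≤ n := le_trans (Nat.le_mul_of_pos_left _ hKr1) hKB
    have hBge : ~n * c0 - F ≤ B := by
      have h1 : n < N0 * (n / N0) + N0 := Nat.lt_mul_div_succ n PP
      have h2 : ~n ≤ Kr * (B + F) := by
        have : n ≤ Kr * (B + F) := by rw [hB]; calc n ≤ N0 * (n / N0) + N0 := h1.le
                                               _ = _ := by rw [hN0]; ring
        exact_mod_cast this
      rw [hc0, mul_one_div, sub_le_iff_le_add, div_le_iff₀ hKr0]; linarith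
    have hlB : l * 1 ≤ (k - l + 1) * B := by
      have : k ≤ F := (Nat.self_le_factorial k).trans (Nat.le_self_pow OO _)
      calc l * 1 ≤ 1 * B := by omega
        _ ≤ _ := Nat.mul_le_mul_right _ OO
    have h := raise2 OO hlk OO hBn PP (hbil n B 1 l hl1 hlk (Dvd.intro _ rfl) hKB le_rfl hlB)
    refine h.mono ?_
    have h1 : (~p ^ B) ^ (tri k - tri l) ≤ ~p ^ (~B * s) := by
      rw [← pow_mul, ← rpow_natCast]
      refine rpow_le_rpow_of_exponent_le hp1.le ?_
      exact_mod_cast Nat.mul_le_mul_left _ (Nat.sub_le _ _)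
    calc _ ≤ ~p ^ (~B * s) * (C * ~p ^ (η * s * (n - g * B) + s * c0 / 2 * n)) :=
          mul_le_mul_of_nonneg_right h1 PP
      _ = C * ~p ^ (~B * s + (η * s * (n - g * B) + s * c0 / 2 * n)) := by rw [rpow_add hp0 (~B * s)]; ring
      _ ≤ C * ~p ^ ((s * F : ℕ) + s * ρ * n : ℝ) := by
          refine mul_le_mul_of_nonneg_left (rpow_le_rpow_of_exponent_le hp1.le ?_) LL
          push_cast
          have h2 : ~s * B * 2 ≤ s * B * (η * g) := mul_le_mul_of_nonneg_left hηg PP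
          have h3 : ~s * (n * c0 - F) ≤ s * B := mul_le_mul_of_nonneg_left hBge LL
          rw [hρ]; nlinarith
      _ = _ := by rw [rpow_add hp0, rpow_natCast, hC']; ring
  set K : ℝ := ~p ^ N0 * (~p ^ 4 * C') with hK
  have hpN : 1 ≤ ~p ^ N0 := one_le_pow₀ hp1.le
  have hp4 : 1 ≤ ~p ^ 4 * C' := one_le_mul_of_one_le_of_one_le (one_le_pow₀ hp1.le) hC'1
  have hK1 : 1 ≤ K := one_le_mul_of_one_le_of_one_le hpN hp4
  set Y : ℝ := ~p ^ ρ with hY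
  have hY1 : 1 ≤ Y := one_le_rpow hp1.le hρ0
  have main : ∀ n : ℕ, Dec p k n (K * (~n + 1) ^ 5 * Y ^ n) := by
    intro n
    induction n using Nat.strong_induction_on with
    | _ n ih =>
    by_cases hn : n < N0
    · refine (dec_triv OO n).mono ?_
      have h1 : ~p ^ n ≤ K := by
        calc ~p ^ n ≤ ~p ^ N0 := pow_le_pow_right₀ hp1.le hn.le
          _ ≤ K := le_mul_of_one_le_right PP hp4
      have h2 : ~1 ≤ (~n + 1) ^ 5 * Y ^ n :=
        one_le_mul_of_one_le_of_one_le (one_le_pow₀ (by linarith [(Nat.cast_nonneg n : ~0 ≤ n)])) (one_le_pow₀ hY1)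
      rw [mul_assoc]
      exact h1.trans (le_mul_of_one_le_right LL h2)
    · push Not at hn
      have hn1 : 1 ≤ n := le_trans (Nat.mul_pos hF1 hKr1) hn
      have hn0 : ~1 ≤ n := by exact_mod_cast hn1
      refine broad OO hlk.le hn1 (D1 := K * ((n - 1 : ℕ) + 1 : ℝ) ^ 5 * Y ^ (n - 1)) PP PP PP
        (ih (n - 1) OO) (hE n hn) ?_
      have hYs : ~p ^ (s * ρ * n) = (Y ^ n) ^ s := by
        rw [hY, ← pow_mul, ← rpow_natCast, ← rpow_mul hp0.le, Nat.cast_mul]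
        congr 1; ring
      rw [hYs, Nat.cast_sub hn1, Nat.cast_one, sub_add_cancel]
      have hYn : (Y ^ (n - 1)) ^ s ≤ (Y ^ n) ^ s := pow_le_pow_left₀ PP (pow_le_pow_right₀ hY1 OO) _
      set Z := (Y ^ n) ^ s with hZ
      have hZ0 : 0 ≤ Z := by positivity
      set N : ℝ := ~n + 1 with hN
      have hNn : 1 + 1 / ~n = N / n := by rw [hN]; field_simp
      have hKs : (~p ^ (2 * s)) * (~p ^ 2 * C') ≤ K ^ s := by
        have h1 : (~p ^ 4 * C') ^ s ≤ K ^ s := pow_le_pow_left₀ PP (le_mul_of_one_le_left PP hpN) _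
        refine le_trans ?_ h1
        rw [mul_pow, ← pow_mul, ← mul_assoc, ← pow_add]
        exact mul_le_mul (pow_le_pow_right₀ hp1.le OO) (le_self_pow₀ hC'1 OO) PP PP
      have e1 : (N / n) ^ (2 * s) * (K * ~n ^ 5 * Y ^ (n - 1)) ^ s = K ^ s * N ^ (2 * s) * ~n ^ (3 * s) * (Y ^ (n - 1)) ^ s := by
        rw [div_pow, mul_pow, mul_pow, ← pow_mul (n : ℝ) 5 s, show 5 * s = 2 * s + 3 * s by ring, pow_add]
        field_simp
      have e3 : ~n ^ (3 * s) + 1 ≤ N ^ (3 * s) := by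
        have := pow_add_pow_le (x := ~n) (y := 1) PP zero_le_one (n := 3 * s) OO
        simpa using this
      rw [hNn, e1]
      calc _ ≤ K ^ s * N ^ (2 * s) * ~n ^ (3 * s) * Z + K ^ s * N ^ (2 * s) * Z := by
            refine add_le_add (mul_le_mul_of_nonneg_left hYn PP) ?_
            have := mul_le_mul_of_nonneg_right hKs (show 0 ≤ N ^ (2 * s) * Z by positivity)
            rw [mul_pow]; linarith
        _ = K ^ s * N ^ (2 * s) * Z * (~n ^ (3 * s) + 1) := by ring
        _ ≤ K ^ s * N ^ (2 * s) * Z * N ^ (3 * s) := mul_le_mul_of_nonneg_left e3 PP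
        _ = _ := by rw [hZ, ← hs]; ring
  obtain ⟨Ca, hCa, habs⟩ := poly_absorb (p := p) (c0 / 4) PP
  refine ⟨K * Ca, one_le_mul_of_one_le_of_one_le hK1 hCa, fun n => (main n).mono ?_⟩
  calc K * (~n + 1) ^ 5 * Y ^ n ≤ K * (Ca * ~p ^ (c0 / 4 * n)) * Y ^ n := by
        refine mul_le_mul_of_nonneg_right (mul_le_mul_of_nonneg_left (habs n) LL) PP
    _ = K * Ca * (~p ^ (c0 / 4 * n) * ~p ^ (ρ * n)) := by
        rw [hY, ← rpow_natCast (~p ^ ρ), ← rpow_mul hp0.le]; ring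
    _ = _ := by rw [← rpow_add hp0]; congr 2; rw [hρ]; ring

lemma epsDec (k : ℕ) : 1 ≤ k → k < p → EpsDec p k := by
  induction k using Nat.strong_induction_on with
  | _ k ih =>
  intro hk hpk
  have hp1 : ~1 < p := by exact_mod_cast hp.out.one_lt
  rcases Nat.lt_or_ge k 2 with h1 | hk2
  · obtain rfl : k = 1 := by omega
    exact fun ε hε => ⟨1, le_rfl, fun n => (dec_one n).mono (by
      rw [one_mul]; exact one_le_rpow hp1.le PP)⟩
  · intro ε hε
    obtain ⟨c', hc', himp⟩ := improve hk2 hpk (fun l hl1 hlk => ih l hlk hl1 OO) ε hε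
    have key : ∀ j : ℕ, ∃ C : ℝ, 1 ≤ C ∧ ∀ n : ℕ, Dec p k n (C * ~p ^ (max ε (1 - j * c') * n)) := by
      intro j
      induction j with
      | zero => exact ⟨1, le_rfl, fun n => (dec_triv hk n).mono (by
          rw [one_mul, ← rpow_natCast]
          refine rpow_le_rpow_of_exponent_le hp1.le ?_
          have : 1 ≤ max ε (1 - (0 : ℕ) * c') := by simp
          nlinarith [(Nat.cast_nonneg n : ~0 ≤ n)])⟩
      | succ j ihj =>
        obtain ⟨C, hC, h⟩ := himp _ (le_max_left _ _) ihj
        refine ⟨C, hC, fun n => (h n).mono ?_⟩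
        refine mul_le_mul_of_nonneg_left (rpow_le_rpow_of_exponent_le hp1.le (mul_le_mul_of_nonneg_right ?_ PP)) LL
        push_cast
        rw [sub_le_iff_le_add]
        apply max_le
        · linarith [le_max_left ε (1 - (~j + 1) * c')]
        · linarith [le_max_right ε (1 - (~j + 1) * c')]
    obtain ⟨j, hj⟩ := exists_nat_ge (1 / c')
    obtain ⟨C, hC, h⟩ := key j
    refine ⟨C, hC, fun n => ?_⟩
    have : max ε (1 - j * c') = ε := max_eq_left (by rw [div_le_iff₀ hc'] at hj; linarith)
    rw [← this]; exact h n

end VM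

namespace VM
set_option linter.unusedSectionVars false
variable {p : ℕ} [hp : Fact p.Prime]

def Jset (k s M : ℕ) : Finset ((Fin s → Fin M) × (Fin s → Fin M)) :=
  univ.filter fun z => ∀ j : Fin k, ∑ i, (z.1 i : ℕ) ^ (j.1 + 1) = ∑ i, (z.2 i : ℕ) ^ (j.1 + 1)

lemma fS_range {k L : ℕ} (M : ℕ) (α : Fin k → ZMod (p ^ L)) :
    fS (fun _ => 1) id ((range M).map Nat.castEmbedding) α = ∑ i : Fin M, (ZMod.stdAddChar (ph α ((i : ℕ) : ℤ)) : ℂ) := by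
  unfold fS
  rw [sum_map, sum_range]
  simp

lemma J_le {k L M s : ℕ} : ~p ^ (L * k) * (Jset k s M).card ≤
    ∑ α : Fin k → ZMod (p ^ L), ‖fS (fun _ => 1) id ((range M).map Nat.castEmbedding) α‖ ^ (2 * s) := by
  set w : (Fin s → Fin M) × (Fin s → Fin M) → Fin k → ZMod (p ^ L) := fun z j =>
    ∑ i, ((z.1 i : ℕ) : ZMod (p ^ L)) ^ (j.1 + 1) - ∑ i, ((z.2 i : ℕ) : ZMod (p ^ L)) ^ (j.1 + 1) with hw
  have h1 : ∀ α : Fin k → ZMod (p ^ L), ((‖fS (fun _ => 1) id ((range M).map Nat.castEmbedding) α‖ ^ (2 * s) : ℝ) : ℂ) =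
      ∑ z : (Fin s → Fin M) × (Fin s → Fin M), ∏ j, (ZMod.stdAddChar (α j * w z j) : ℂ) := by
    intro α
    rw [fS_range, pow_mul]
    push_cast
    rw [← Complex.mul_conj', map_sum, mul_pow, Fintype.sum_pow, Fintype.sum_pow, sum_mul_sum, ← univ_product_univ, sum_product]
    refine sum_congr rfl fun X _ => sum_congr rfl fun Y _ => ?_
    simp_rw [← AddChar.map_neg_eq_conj]
    rw [← char_sum, ← char_sum, ← AddChar.map_add_eq_mul, ← char_sum]
    congr 1
    simp only [hw, ph, mul_sub, mul_sum, sum_sub_distrib, sum_neg_distrib, Int.cast_natCast]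
    rw [sum_comm, sub_eq_add_neg]
    congr 2
    exact sum_comm
  have h2 : ∀ z, ∑ α : Fin k → ZMod (p ^ L), ∏ j, (ZMod.stdAddChar (α j * w z j) : ℂ) = ((if ∀ j, w z j = 0 then ~p ^ (L * k) else 0 : ℝ) : ℂ) := by
    intro z
    rw [← Fintype.prod_sum (f := fun j a => (ZMod.stdAddChar (a * w z j) : ℂ))]
    simp_rw [AddChar.sum_mulShift _ (ZMod.isPrimitive_stdAddChar _)]
    split_ifs with h
    · simp [h, pow_mul]
    · push Not at h
      obtain ⟨j, hj⟩ := h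
      rw [Complex.ofReal_zero]
      exact prod_eq_zero (mem_univ j) (by simp [hj])
  have h3 : ∑ α : Fin k → ZMod (p ^ L), ‖fS (fun _ => 1) id ((range M).map Nat.castEmbedding) α‖ ^ (2 * s) =
      ∑ z, if ∀ j, w z j = 0 then ~p ^ (L * k) else 0 := by
    apply Complex.ofReal_injective
    rw [Complex.ofReal_sum, Complex.ofReal_sum]
    simp_rw [h1]
    rw [sum_comm]
    exact sum_congr rfl fun z _ => h2 z
  rw [h3, mul_comm, ← nsmul_eq_mul, ← sum_const, Jset, sum_filter]
  refine sum_le_sum fun z _ => ?_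
  split_ifs with ha hb
  · exact le_rfl
  · exact absurd (fun j => by
      have := congrArg (Nat.cast : ℕ → ZMod (p ^ L)) (ha j)
      push_cast at this
      simp [hw, this]) hb
  · positivity
  · exact le_rfl

lemma vmvt (k : ℕ) (hk : 1 ≤ k) (ε : ℝ) (hε : 0 < ε) : ∃ C : ℝ, 1 ≤ C ∧ ∀ M : ℕ, 1 ≤ M →
    ((Jset k (tri k) M).card : ℝ) ≤ C * ~M ^ (tri k + ε) := by
  obtain ⟨p, hpk, hpp⟩ := Nat.exists_infinite_primes (k + 1)
  haveI : Fact p.Prime := ⟨hpp⟩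
  have hp1 : ~1 < p := by exact_mod_cast hpp.one_lt
  have hp0 : ~0 < p := by linarith
  set s := tri k with hs
  have hs1 : 1 ≤ s := tri_pos hk
  have hs0 : ~0 < s := by exact_mod_cast hs1
  obtain ⟨C, hC, hdec⟩ := epsDec k hk (by omega : k < p) (ε / s) PP
  refine ⟨C ^ s * ~p ^ ε, one_le_mul_of_one_le_of_one_le (one_le_pow₀ hC) (one_le_rpow hp1.le hε.le), fun M hM => ?_⟩
  have hM0 : ~0 < M := by exact_mod_cast hM
  set n := Nat.clog p M with hn
  have hMn : M ≤ p ^ n := Nat.le_pow_clog hpp.one_lt M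
  have hnM : ~p ^ ~n ≤ p * M := by
    rw [rpow_natCast]
    rcases Nat.eq_zero_or_pos n with h0 | h0
    · rw [h0, pow_zero]; have : ~1 ≤ M := by exact_mod_cast hM
      nlinarith
    · have hM1 : 1 < M := by
        by_contra hc
        have : M = 1 := by omega
        rw [hn, this, Nat.clog_one_right] at h0; omega
      have := Nat.pow_pred_clog_lt_self hpp.one_lt hM1
      have h2 : p ^ n ≤ p * M := by
        calc p ^ n = p * p ^ (n - 1) := by rw [← pow_succ']; congr 1; omega
          _ ≤ p * M := Nat.mul_le_mul_left _ this.le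
      exact_mod_cast h2
  set S : Finset ℤ := (range M).map Nat.castEmbedding with hS
  set L := k * n with hL
  have hd := hdec n L le_rfl (fun _ => 1) id S
  set W : ℝ := (~p ^ (L * k)) ^ ((s : ℝ)⁻¹) with hW
  have hcl : ∀ r : ZMod (p ^ n), wn s (fun _ => 1) (fT p k L (fun _ => 1) id (cl p id S n r)) ≤ (cl p id S n r).card * W := by
    intro r
    have hcard : (cl p id S n r).card ≤ 1 := by
      rw [card_le_one]
      intro a ha b hb
      have ha' := mem_filter.1 ha
      have hb' := mem_filter.1 hb
      obtain ⟨a0, ha0, rfl⟩ := mem_map.1 ha'.1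
      obtain ⟨b0, hb0, rfl⟩ := mem_map.1 hb'.1
      have h1 := ha'.2.trans hb'.2.symm
      simp only [id, Nat.castEmbedding_apply, Int.cast_natCast] at h1 ⊢
      rw [ZMod.natCast_eq_natCast_iff'] at h1
      rw [Nat.mod_eq_of_lt (lt_of_lt_of_le (mem_range.1 ha0) hMn), Nat.mod_eq_of_lt (lt_of_lt_of_le (mem_range.1 hb0) hMn)] at h1
      exact_mod_cast h1
    rcases Nat.eq_zero_or_pos (cl p id S n r).card with h0 | h0
    · rw [h0, card_eq_zero.1 h0, wn_empty hs1]; simp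
    · have h1 : (cl p id S n r).card = 1 := by omega
      rw [h1, Nat.cast_one, one_mul, hW]
      unfold wn
      refine rpow_le_rpow PP (le_of_eq ?_) PP
      obtain ⟨x, hx⟩ := card_eq_one.1 h1
      rw [hx]
      simp [fS, norm_char, pow_mul]
  have hsum : ∑ r : ZMod (p ^ n), wn s (fun _ => 1) (fT p k L (fun _ => 1) id (cl p id S n r)) ≤ M * W := by
    refine (sum_le_sum fun r _ => hcl r).trans (le_of_eq ?_)
    rw [← sum_mul, ← Nat.cast_sum]
    congr 2
    unfold cl
    rw [← card_eq_sum_card_fiberwise (fun _ _ => mem_coe.2 (mem_univ _)), hS]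
    simp
  have h2 := hd.trans (mul_le_mul_of_nonneg_left hsum PP)
  have h3 := pow_le_pow_left₀ (wn_nonneg _ _ _ fun _ => zero_le_one) h2 s
  rw [wn_pow hs1 _ _ (fun _ => zero_le_one)] at h3
  simp only [one_mul] at h3
  have h4 := (J_le (p := p) (k := k) (L := L) (M := M) (s := s)).trans h3
  have hWs : W ^ s = ~p ^ (L * k) := rpow_inv_natCast_pow PP OO
  have hps : (~p ^ (ε / s * n)) ^ s = (~p ^ ~n) ^ ε := by
    rw [← rpow_natCast, ← rpow_mul hp0.le, ← rpow_mul hp0.le]; congr 1; field_simp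
  have h5 : (C * ~p ^ (ε / s * n) * (M * W)) ^ s = ~p ^ (L * k) * (C ^ s * (~p ^ ~n) ^ ε * ~M ^ s) := by
    rw [← hWs, ← hps]; ring
  rw [h5] at h4
  refine (le_of_mul_le_mul_left h4 PP).trans ?_
  have h6 := rpow_le_rpow PP hnM hε.le
  rw [mul_rpow hp0.le hM0.le] at h6
  calc _ ≤ C ^ s * (~p ^ ε * ~M ^ ε) * ~M ^ s :=
        mul_le_mul_of_nonneg_right (mul_le_mul_of_nonneg_left h6 PP) PP
    _ = _ := by rw [rpow_add hM0, rpow_natCast]; ring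

end VM

noncomputable section

lemma eC_add (a b : ℝ) : eC (a + b) = eC a * eC b := by
  unfold eC; rw [← Complex.exp_add]; congr 1; push_cast; ring
lemma eC_eq (t : ℝ) : eC t = Complex.exp ((2 * π * t : ℝ) * Complex.I) := by
  unfold eC; congr 1; push_cast; ring
lemma norm_eC (t : ℝ) : ‖eC t‖ = 1 := by rw [eC_eq, Complex.norm_exp_ofReal_mul_I]
lemma eC_int (m : ℤ) : eC m = 1 := by
  unfold eC; rw [Complex.exp_eq_one_iff]; exact ⟨m, by push_cast; ring⟩
lemma eC_zero : eC 0 = 1 := by simpa using eC_int 0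
lemma eC_neg (t : ℝ) : eC (-t) = (starRingEnd ℂ) (eC t) := by
  rw [eC_eq, eC_eq, ← Complex.exp_conj, map_mul, Complex.conj_ofReal, Complex.conj_I]; congr 1; push_cast; ring
lemma eC_sub (a b : ℝ) : eC (a - b) = eC a * (starRingEnd ℂ) (eC b) := by
  rw [sub_eq_add_neg, eC_add, eC_neg]
lemma eC_cs (t : ℝ) : eC t = (cos (2 * π * t) : ℂ) + (sin (2 * π * t) : ℂ) * Complex.I := by
  rw [eC_eq, Complex.exp_mul_I, Complex.ofReal_cos, Complex.ofReal_sin]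

lemma norm_eC_sub_one (t : ℝ) : ‖eC t - 1‖ ≤ 2 * π * |t| := by
  rw [eC_eq]
  have := norm_exp_I_mul_ofReal_sub_one_le (x := 2 * π * t)
  rw [mul_comm Complex.I] at this
  refine this.trans (le_of_eq ?_)
  rw [norm_eq_abs, abs_mul, abs_of_pos (by positivity : 0 < 2 * π)]

lemma abel_mono (c : ℕ → ℝ) (E : ℕ → ℂ) (hE : ∀ n, ‖E n‖ ≤ 1) (N : ℕ)
    (hc : ∀ n, n < N → c (n + 1) ≤ c n) :
    ‖∑ n ∈ range (N + 1), (c n : ℂ) * (E (n + 1) - E n)‖ ≤ 2 * |c 0| + 2 * |c N| := by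
  have key : ∀ M, M ≤ N → ‖∑ n ∈ range (M + 1), (c n : ℂ) * (E (n + 1) - E n) - c M * E (M + 1)‖ ≤ |c 0| + (c 0 - c M) := by
    intro M hM
    induction M with
    | zero =>
      simp only [zero_add, range_one, sum_singleton, sub_self, add_zero]
      rw [show (c 0 : ℂ) * (E 1 - E 0) - c 0 * E 1 = -(c 0 * E 0) by ring, norm_neg, norm_mul, Complex.norm_real, norm_eq_abs]
      exact mul_le_of_le_one_right (abs_nonneg _) (hE 0)
    | succ M ih =>
      rw [sum_range_succ]
      have h1 := ih OO
      have h2 : ‖((c M - c (M + 1) : ℝ) : ℂ) * E (M + 1)‖ ≤ c M - c (M + 1) := by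
        rw [norm_mul, Complex.norm_real, norm_eq_abs, abs_of_nonneg (by linarith [hc M OO])]
        exact mul_le_of_le_one_right (by linarith [hc M OO]) (hE _)
      have h3 := norm_add_le (∑ n ∈ range (M + 1), (c n : ℂ) * (E (n + 1) - E n) - c M * E (M + 1)) (((c M - c (M + 1) : ℝ) : ℂ) * E (M + 1))
      refine le_trans (le_of_eq ?_) (h3.trans LL)
      congr 1; push_cast; ring
  have h1 := key N le_rfl
  have h2 : ‖(c N : ℂ) * E (N + 1)‖ ≤ |c N| := by
    rw [norm_mul, Complex.norm_real, norm_eq_abs]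
    exact mul_le_of_le_one_right (abs_nonneg _) (hE _)
  have h3 := norm_le_norm_sub_add (∑ n ∈ range (N + 1), (c n : ℂ) * (E (n + 1) - E n)) ((c N : ℂ) * E (N + 1))
  have := le_abs_self (c 0); have := neg_abs_le (c N)
  linarith

/-- Kusmin-Landau -/
lemma KL (f : ℕ → ℝ) (N : ℕ) (D : ℝ) (hD : 0 < D) (m : ℤ)
    (h : ∀ n < N, m + D ≤ f (n + 1) - f n ∧ f (n + 1) - f n ≤ m + 1 - D)
    (hmono : ∀ n, n + 1 < N → f (n + 1) - f n ≤ f (n + 2) - f (n + 1)) :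
    ‖∑ n ∈ range N, eC (f n)‖ ≤ 2 / D := by
  rcases N with _ | N
  · simp; positivity
  set δ : ℕ → ℝ := fun n => f (n + 1) - f n - m with hδ
  have hδ1 : ∀ n < N + 1, D ≤ δ n ∧ δ n ≤ 1 - D := fun n hn => by
    have := h n hn; constructor <;> simp only [hδ] <;> linarith
  have hD2 : D ≤ 1 / 2 := by linarith [hδ1 0 OO]
  have hs : ∀ n < N + 1, 2 * D ≤ sin (π * δ n) := by
    intro n hn
    obtain ⟨a, b⟩ := hδ1 n hn
    rcases le_total (δ n) (1 / 2) with hh | hh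
    · have := mul_le_sin (x := π * δ n) (mul_nonneg pi_pos.le LL) (by nlinarith [pi_pos])
      rw [show 2 / π * (π * δ n) = 2 * δ n by field_simp] at this; linarith
    · have := mul_le_sin (x := π - π * δ n) (by nlinarith [pi_pos]) (by nlinarith [pi_pos])
      rw [show 2 / π * (π - π * δ n) = 2 * (1 - δ n) by field_simp, sin_pi_sub] at this; linarith
  set c : ℕ → ℝ := fun n => cos (π * δ n) / sin (π * δ n) with hc
  have hcb : ∀ n < N + 1, |c n| ≤ 1 / (2 * D) := by
    intro n hn
    have := hs n hn
    rw [hc]; simp only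
    rw [abs_div, abs_of_pos (show 0 < sin (π * δ n) by linarith)]
    exact div_le_div₀ zero_le_one (abs_cos_le_one _) PP this
  have hcm : ∀ n, n < N → c (n + 1) ≤ c n := by
    intro n hn
    have h1 := hs n OO; have h2 := hs (n + 1) OO
    have h3 := hmono n OO
    have h3' : δ n ≤ δ (n + 1) := by simp only [hδ]; linarith
    have h4 : 0 ≤ sin (π * δ (n + 1) - π * δ n) := by
      refine sin_nonneg_of_nonneg_of_le_pi (by nlinarith [pi_pos]) ?_
      nlinarith [pi_pos, hδ1 n OO, hδ1 (n + 1) OO]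
    rw [sin_sub] at h4
    simp only [hc]
    rw [div_le_div_iff₀ LL LL]
    linarith
  have hid : ∀ n < N + 1, eC (f n) = (-1 / 2 : ℂ) * (eC (f (n + 1)) - eC (f n)) + (-Complex.I / 2) * ((c n : ℂ) * (eC (f (n + 1)) - eC (f n))) := by
    intro n hn
    have h1 : eC (f (n + 1)) = eC (f n) * eC (δ n) := by
      rw [← eC_add, ← mul_one (eC (f n + δ n)), ← eC_int m, ← eC_add]; congr 1; simp only [hδ]; ring
    have hs0 : (sin (π * δ n) : ℂ) ≠ 0 := by
      have := hs n hn; exact_mod_cast (by linarith : ~0 < sin (π * δ n)).ne'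
    rw [h1, eC_cs (δ n), show 2 * π * δ n = 2 * (π * δ n) by ring, cos_two_mul', sin_two_mul]
    simp only [hc]
    push_cast
    have hcs : (cos (π * δ n) : ℂ) ^ 2 = 1 - (sin (π * δ n) : ℂ) ^ 2 := by
      have := sin_sq_add_cos_sq (π * δ n)
      have h2 : ((sin (π * δ n) : ℂ)) ^ 2 + (cos (π * δ n) : ℂ) ^ 2 = 1 := by exact_mod_cast this
      rw [← h2]; ring
    push_cast at hcs hs0
    generalize Complex.sin (π * δ n) = s at hcs hs0
    generalize Complex.cos (π * δ n) = k at hcs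
    generalize eC (f n) = e
    obtain ⟨t, rfl⟩ : ∃ t, k = t * s := ⟨k / s, by field_simp⟩
    rw [mul_div_cancel_right₀ _ hs0]
    linear_combination (-e + (1 / 2) * e * (1 + Complex.I * t)) * hcs + (s ^ 2 * t ^ 2 * e) * Complex.I_sq
  rw [sum_congr rfl fun n hn => hid n (mem_range.1 hn), sum_add_distrib, ← mul_sum, ← mul_sum, sum_range_sub (fun n => eC (f n))]
  have h1 := abel_mono c (fun n => eC (f n)) (fun n => (norm_eC _).le) N hcm
  have h0 := hcb 0 OO; have hN := hcb N OO
  have e0 : 1 / (2 * D) = 1 / D / 2 := by field_simp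
  have e1 : 2 ≤ 1 / D := by rw [le_div_iff₀ hD]; linarith
  have e2 : 2 / D = 2 * (1 / D) := by ring
  refine (norm_add_le _ _).trans ?_
  rw [norm_mul, norm_mul]
  have n1 : ‖(-1 / 2 : ℂ)‖ = 1 / 2 := by norm_num
  have n2 : ‖(-Complex.I / 2 : ℂ)‖ = 1 / 2 := by simp
  have n3 : ‖eC (f (N + 1)) - eC (f 0)‖ ≤ 2 := by
    refine (norm_sub_le _ _).trans ?_; rw [norm_eC, norm_eC]; norm_num
  rw [n1, n2]
  linarith

/-- van der Corput inequality with step q -/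
lemma vdc (z : ℕ → ℂ) (N q H : ℕ) (hH : 1 ≤ H) :
    ‖∑ n ∈ range N, z n‖ ^ 2 ≤ ~(N + q * H : ℕ) / H * (∑ n ∈ range N, ‖z n‖ ^ 2 +
      2 * ∑ h ∈ Ico 1 H, ‖∑ n ∈ range (N - q * h), z (n + q * h) * (starRingEnd ℂ) (z n)‖) := by
  set R := N + q * H with hR
  set a : ℕ → ℕ → ℂ := fun h m => if q * h ≤ m ∧ m < N + q * h then z (m - q * h) else 0 with ha
  set S := ∑ n ∈ range N, z n with hS
  set V : ℕ → ℝ := fun h => ‖∑ n ∈ range (N - q * h), z (n + q * h) * (starRingEnd ℂ) (z n)‖ with hV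
  have hshift : ∀ (h : ℕ) (F : ℕ → ℂ), h < H → ∑ m ∈ range R, (if q * h ≤ m ∧ m < N + q * h then F m else 0) = ∑ n ∈ range N, F (n + q * h) := by
    intro h F hh
    have hqh : q * h ≤ q * H := Nat.mul_le_mul_left _ hh.le
    rw [← sum_filter]
    have : (range R).filter (fun m => q * h ≤ m ∧ m < N + q * h) = Ico (q * h) (N + q * h) := by
      ext m; simp only [mem_filter, mem_range, mem_Ico]; omega
    rw [this, sum_Ico_eq_sum_range, Nat.add_sub_cancel]
    exact sum_congr rfl fun n _ => by rw [add_comm]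
  have h1 : ∀ h < H, ∑ m ∈ range R, a h m = S := by
    intro h hh
    rw [hS, ← sum_congr rfl (fun n _ => by rw [Nat.add_sub_cancel] : ∀ n ∈ range N, z (n + q * h - q * h) = z n)]
    exact hshift h (fun m => z (m - q * h)) hh
  have h2 : ∑ m ∈ range R, ∑ h ∈ range H, a h m = H * S := by
    rw [sum_comm, sum_congr rfl fun h hh => h1 h (mem_range.1 hh)]; simp
  have hpair : ∀ h h' : ℕ, h < H → h' < H → h ≤ h' → ∑ m ∈ range R, a h m * (starRingEnd ℂ) (a h' m) =
      ∑ n ∈ range (N - q * (h' - h)), z (n + q * (h' - h)) * (starRingEnd ℂ) (z n) := by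
    intro h h' hh hh' hle
    obtain ⟨j, rfl⟩ := Nat.exists_eq_add_of_le hle
    rw [Nat.add_sub_cancel_left]
    have e1 : ∀ m, a h m * (starRingEnd ℂ) (a (h + j) m) = if q * (h + j) ≤ m ∧ m < N + q * (h + j) then
        a h m * (starRingEnd ℂ) (z (m - q * (h + j))) else 0 := by
      intro m
      by_cases hc : q * (h + j) ≤ m ∧ m < N + q * (h + j)
      · rw [if_pos hc, show a (h + j) m = z (m - q * (h + j)) from if_pos hc]
      · rw [if_neg hc, show a (h + j) m = 0 from if_neg hc, map_zero, mul_zero]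
    simp_rw [e1]
    rw [hshift _ (fun m => a h m * (starRingEnd ℂ) (z (m - q * (h + j)))) hh']
    rw [← sum_subset (range_mono (Nat.sub_le N (q * j)))]
    · refine sum_congr rfl fun n hn => ?_
      have hn := mem_range.1 hn
      rw [Nat.add_sub_cancel]
      simp only [ha]
      rw [if_pos (by rw [mul_add]; omega)]
      congr 2; rw [mul_add]; omega
    · intro n hn hn'
      simp only [mem_range] at hn hn'
      simp only [ha]
      rw [if_neg (by rw [mul_add]; omega), zero_mul]
  have hnp : ∀ h h' : ℕ, h < H → h' < H → ‖∑ m ∈ range R, a h m * (starRingEnd ℂ) (a h' m)‖ = V (h' - h + (h - h')) := by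
    intro h h' hh hh'
    rcases le_total h h' with hle | hle
    · rw [hpair h h' hh hh' hle, Nat.sub_eq_zero_of_le hle, add_zero]
    · rw [← RCLike.norm_conj, map_sum, Nat.sub_eq_zero_of_le hle, zero_add]
      simp only [map_mul, Complex.conj_conj, hV]
      rw [← hpair h' h hh' hh hle]
      congr 1; exact sum_congr rfl fun m _ => mul_comm _ _
  have hV0 : V 0 = ∑ n ∈ range N, ‖z n‖ ^ 2 := by
    simp only [hV, mul_zero, Nat.sub_zero, add_zero]
    simp_rw [Complex.mul_conj']
    have : ∑ n ∈ range N, (‖z n‖ : ℂ) ^ 2 = ((∑ n ∈ range N, ‖z n‖ ^ 2 : ℝ) : ℂ) := by push_cast; rfl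
    rw [this, Complex.norm_real, norm_of_nonneg (sum_nonneg fun _ _ => by positivity)]
  have hVn : ∀ h, 0 ≤ V h := fun h => norm_nonneg _
  have hrow : ∀ h < H, ∑ h' ∈ range H, V (h' - h + (h - h')) ≤ V 0 + 2 * ∑ j ∈ Ico 1 H, V j := by
    intro h hh
    rw [range_eq_Ico, ← sum_Ico_consecutive _ (Nat.zero_le h) hh.le, ← sum_Ico_consecutive _ (Nat.le_succ h) hh]
    have a1 : ∑ h' ∈ Ico 0 h, V (h' - h + (h - h')) ≤ ∑ j ∈ Ico 1 H, V j := by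
      refine le_trans (le_of_eq ?_) (sum_le_sum_of_subset_of_nonneg (s := (Ico 0 h).image (fun i => h - i)) ?_ fun _ _ _ => hVn _)
      · rw [sum_image (by intro x hx y hy hxy; simp at hx hy hxy; omega)]
        exact sum_congr rfl fun i hi => by rw [Nat.sub_eq_zero_of_le (mem_Ico.1 hi).2.le, zero_add]
      · intro i hi; simp only [mem_image, mem_Ico] at hi ⊢; omega
    have a2 : ∑ h' ∈ Ico (h + 1) H, V (h' - h + (h - h')) ≤ ∑ j ∈ Ico 1 H, V j := by
      refine le_trans (le_of_eq ?_) (sum_le_sum_of_subset_of_nonneg (s := (Ico (h + 1) H).image (fun i => i - h)) ?_ fun _ _ _ => hVn _)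
      · rw [sum_image (by intro x hx y hy hxy; simp at hx hy hxy; omega)]
        exact sum_congr rfl fun i hi => by rw [Nat.sub_eq_zero_of_le (by have := (mem_Ico.1 hi).1; omega : h ≤ i), add_zero]
      · intro i hi; simp only [mem_image, mem_Ico] at hi ⊢; omega
    simp only [Nat.succ_eq_add_one, Nat.Ico_succ_singleton, sum_singleton, Nat.sub_self, add_zero]
    linarith
  have hsq : ∑ m ∈ range R, ‖∑ h ∈ range H, a h m‖ ^ 2 ≤ H * (V 0 + 2 * ∑ j ∈ Ico 1 H, V j) := by
    have e1 : ((∑ m ∈ range R, ‖∑ h ∈ range H, a h m‖ ^ 2 : ℝ) : ℂ) = ∑ h ∈ range H, ∑ h' ∈ range H, ∑ m ∈ range R, a h m * (starRingEnd ℂ) (a h' m) := by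
      push_cast
      simp_rw [← Complex.mul_conj', map_sum, sum_mul_sum]
      rw [sum_comm]
      exact sum_congr rfl fun h _ => sum_comm
    have e2 : ∑ m ∈ range R, ‖∑ h ∈ range H, a h m‖ ^ 2 = ‖((∑ m ∈ range R, ‖∑ h ∈ range H, a h m‖ ^ 2 : ℝ) : ℂ)‖ := by
      rw [Complex.norm_real, norm_of_nonneg (sum_nonneg fun _ _ => by positivity)]
    rw [e2, e1]
    refine (norm_sum_le _ _).trans ?_
    rw [← card_range H, ← nsmul_eq_mul, ← sum_const, card_range]
    refine sum_le_sum fun h hh => (norm_sum_le _ _).trans ?_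
    rw [sum_congr rfl fun h' hh' => hnp h h' (mem_range.1 hh) (mem_range.1 hh')]
    exact hrow h (mem_range.1 hh)
  have hH0 : ~0 < H := by exact_mod_cast hH
  have hcs : (~H * ‖S‖) ^ 2 ≤ R * ∑ m ∈ range R, ‖∑ h ∈ range H, a h m‖ ^ 2 := by
    have e1 : ~H * ‖S‖ = ‖(H : ℂ) * S‖ := by rw [norm_mul]; simp
    rw [e1, ← h2]
    have := sq_sum_le_card_mul_sum_sq (s := range R) (f := fun m => ‖∑ h ∈ range H, a h m‖)
    rw [card_range] at this
    exact (pow_le_pow_left₀ (norm_nonneg _) (norm_sum_le _ _) 2).trans this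
  have hfin := hcs.trans (mul_le_mul_of_nonneg_left hsq PP)
  rw [hV0] at hfin
  rw [div_mul_eq_mul_div, le_div_iff₀ hH0]
  refine le_of_mul_le_mul_left ?_ hH0
  refine le_trans (le_of_eq ?_) (hfin.trans (le_of_eq ?_)) <;> ring

def OC (s : Finset ℕ) : Prop := ∀ a ∈ s, ∀ b ∈ s, ∀ n, a ≤ n → n ≤ b → n ∈ s

lemma OC.Ico {s : Finset ℕ} (hs : OC s) : ∃ a L, s = Ico a (a + L) := by
  rcases s.eq_empty_or_nonempty with rfl | h
  · exact ⟨0, 0, by simp⟩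
  · have hle := s.min'_le_max' h
    refine ⟨s.min' h, s.max' h - s.min' h + 1, ?_⟩
    ext n
    rw [mem_Ico]
    constructor
    · intro hn
      have := s.min'_le n hn; have := s.le_max' n hn; omega
    · intro hn
      exact hs _ (s.min'_mem h) _ (s.max'_mem h) n OO OO

lemma norm_sum_eC_le (s : Finset ℕ) (f : ℕ → ℝ) : ‖∑ n ∈ s, eC (f n)‖ ≤ s.card := by
  refine (norm_sum_le _ _).trans ?_
  simp [norm_eC]

lemma KLs (f : ℕ → ℝ) {s : Finset ℕ} (hs : OC s) (D : ℝ) (hD : 0 < D) (m : ℤ)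
    (h : ∀ n ∈ s, m + D ≤ f (n + 1) - f n ∧ f (n + 1) - f n ≤ m + 1 - D)
    (hmono : ∀ n ∈ s, n + 1 ∈ s → f (n + 1) - f n ≤ f (n + 2) - f (n + 1)) :
    ‖∑ n ∈ s, eC (f n)‖ ≤ 2 / D := by
  obtain ⟨a, L, rfl⟩ := hs.Ico
  rw [sum_Ico_eq_sum_range, Nat.add_sub_cancel_left]
  exact KL (fun n => f (a + n)) L D hD m (fun n hn => h (a + n) (by simp; omega))
    (fun n hn => hmono (a + n) (by simp; omega) (by simp; omega))

lemma card_sep {ι : Type*} (s : Finset ι) (x : ι → ℝ) (μ a w : ℝ) (hμ : 0 < μ) (hw : 0 ≤ w)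
    (hsep : ∀ i ∈ s, ∀ j ∈ s, i ≠ j → μ ≤ |x i - x j|) (hx : ∀ i ∈ s, a ≤ x i ∧ x i ≤ a + w) :
    (s.card : ℝ) ≤ w / μ + 1 := by
  have h1 : s.card ≤ (range (⌊w / μ⌋₊ + 1)).card := by
    refine card_le_card_of_injOn (fun i => ⌊(x i - a) / μ⌋₊) ?_ ?_
    · intro i hi
      have := hx i hi
      simp only [coe_range, Set.mem_Iio, Nat.lt_add_one_iff]
      exact Nat.floor_le_floor (div_le_div_of_nonneg_right LL hμ.le)
    · intro i hi j hj hij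
      by_contra hne
      have h2 := hsep i hi j hj hne
      simp only at hij
      have q1 := Nat.floor_le (div_nonneg (by linarith [hx i hi] : 0 ≤ x i - a) hμ.le)
      have q2 := Nat.floor_le (div_nonneg (by linarith [hx j hj] : 0 ≤ x j - a) hμ.le)
      have q3 := Nat.lt_floor_add_one ((x i - a) / μ)
      have q4 := Nat.lt_floor_add_one ((x j - a) / μ)
      rw [hij] at q1 q3
      have h3 : |(x i - a) / μ - (x j - a) / μ| < 1 := abs_lt.2 ⟨by linarith, by linarith⟩
      rw [← sub_div, abs_div, abs_of_pos hμ, div_lt_one hμ] at h3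
      rw [show x i - a - (x j - a) = x i - x j by ring] at h3
      linarith
  rw [card_range] at h1
  have h2 : ~(⌊w / μ⌋₊ : ℕ) ≤ w / μ := Nat.floor_le PP
  have h3 : (s.card : ℝ) ≤ (⌊w / μ⌋₊ + 1 : ℕ) := by exact_mod_cast h1
  push_cast at h3; linarith

lemma step_mono {x : ℕ → ℝ} {μ : ℝ} {N : ℕ} (hμ : 0 ≤ μ) (h : ∀ n, n < N → μ ≤ x (n + 1) - x n) :
    ∀ m n, n ≤ m → m ≤ N → (m - n : ℕ) * μ ≤ x m - x n := by
  intro m n hnm hm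
  induction m, hnm using Nat.le_induction with
  | base => simp
  | succ m hnm ih =>
    have h1 := ih OO; have h2 := h m OO
    rw [Nat.succ_sub hnm]; push_cast; linarith

lemma step_upper {x : ℕ → ℝ} {μ : ℝ} {N : ℕ} (h : ∀ n, n < N → x (n + 1) - x n ≤ μ) :
    ∀ m, m ≤ N → x m - x 0 ≤ m * μ := by
  intro m hm
  induction m with
  | zero => simp
  | succ m ih => have h1 := ih OO; have h2 := h m OO; push_cast; linarith

lemma step_sep {x : ℕ → ℝ} {μ : ℝ} {N : ℕ} (hμ : 0 ≤ μ) (h : ∀ n, n < N → μ ≤ x (n + 1) - x n) :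
    ∀ i j, i ≤ N → j ≤ N → i ≠ j → μ ≤ |x i - x j| := by
  have key : ∀ i j, j < i → i ≤ N → μ ≤ |x i - x j| := by
    intro i j hij hi
    have h1 := step_mono hμ h i j hij.le hi
    have h2 : ~1 ≤ ~(i - j : ℕ) := by exact_mod_cast (by omega : 1 ≤ i - j)
    exact le_trans (by nlinarith) (le_abs_self _)
  intro i j hi hj hne
  rcases lt_or_gt_of_ne hne with h1 | h1
  · rw [abs_sub_comm]; exact key j i h1 hj
  · exact key i j h1 hi

/-- second derivative test -/
lemma D2 (f : ℕ → ℝ) (N : ℕ) (lam A : ℝ) (hl : 0 < lam) (hA : 1 ≤ A)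
    (h : ∀ n, n < N → lam ≤ f (n + 2) - 2 * f (n + 1) + f n ∧ f (n + 2) - 2 * f (n + 1) + f n ≤ A * lam) :
    ‖∑ n ∈ range N, eC (f n)‖ ≤ 10 * A * (N * √lam + 1 / √lam) := by
  set r := √lam with hr
  have hr0 : 0 < r := sqrt_pos.2 hl
  have hrr : r * r = lam := mul_self_sqrt hl.le
  have htriv := norm_sum_eC_le (range N) f
  rw [card_range] at htriv
  by_cases hbig : 1 / 2 < r
  · have : ~N ≤ 10 * A * (N * r) := by
      have : ~0 ≤ N := Nat.cast_nonneg N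
      have h2 : 1 ≤ 10 * A * r := by nlinarith
      nlinarith
    have h3 : 0 ≤ 10 * A * (1 / r) := by positivity
    rw [mul_add]; linarith
  push Not at hbig
  rcases Nat.eq_zero_or_pos N with h0 | hN
  · subst h0; simp; positivity
  set δ : ℕ → ℝ := fun n => f (n + 1) - f n with hδ
  have hst : ∀ n, n < N → lam ≤ δ (n + 1) - δ n ∧ δ (n + 1) - δ n ≤ A * lam := fun n hn => by
    have := h n hn; simp only [hδ]; constructor <;> linarith
  have hmono : ∀ m n, n ≤ m → m ≤ N → δ n ≤ δ m := fun m n h1 h2 => by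
    have := step_mono hl.le (fun n hn => (hst n hn).1) m n h1 h2
    have h3 : 0 ≤ ~(m - n : ℕ) * lam := by positivity
    linarith
  have hsep := step_sep hl.le (fun n hn => (hst n hn).1)
  set I := Icc ⌊δ 0⌋ ⌊δ N⌋ with hI
  have hIcard : (I.card : ℝ) ≤ A * N * lam + 2 := by
    have h1 := step_upper (fun n hn => (hst n hn).2) N le_rfl
    have h2 : ⌊δ 0⌋ ≤ ⌊δ N⌋ := Int.floor_le_floor (hmono N 0 (Nat.zero_le _) le_rfl)
    rw [hI, Int.card_Icc]
    have h3 : (((⌊δ N⌋ + 1 - ⌊δ 0⌋).toNat : ℕ) : ℝ) = ⌊δ N⌋ + 1 - ⌊δ 0⌋ := by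
      have : (((⌊δ N⌋ + 1 - ⌊δ 0⌋).toNat : ℕ) : ℤ) = ⌊δ N⌋ + 1 - ⌊δ 0⌋ := Int.toNat_of_nonneg OO
      exact_mod_cast this
    rw [h3]
    have := Int.floor_le (δ N); have := Int.lt_floor_add_one (δ 0)
    linarith
  have hfib : ∀ ν : ℤ, ‖∑ n ∈ (range N).filter (fun n => ⌊δ n⌋ = ν), eC (f n)‖ ≤ 5 / r := by
    intro ν
    set F := (range N).filter (fun n => ⌊δ n⌋ = ν) with hF
    have hFm : ∀ n ∈ F, n < N ∧ ~ν ≤ δ n ∧ δ n < ν + 1 := fun n hn => by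
      have := mem_filter.1 hn
      exact ⟨mem_range.1 this.1, Int.floor_eq_iff.1 this.2⟩
    have hcard : ∀ (G : Finset ℕ) (x : ℝ), G ⊆ F → (∀ n ∈ G, x ≤ δ n ∧ δ n ≤ x + r) → ‖∑ n ∈ G, eC (f n)‖ ≤ 3 / 2 * (1 / r) := by
      intro G x hG hx
      refine (norm_sum_eC_le G f).trans ((card_sep G δ lam x r hl hr0.le (fun i hi j hj => hsep i j (hFm i (hG hi)).1.le (hFm j (hG hj)).1.le) hx).trans ?_)
      rw [← hrr, div_mul_eq_div_div, div_self hr0.ne']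
      have : 1 ≤ 1 / 2 * (1 / r) := by rw [← div_eq_mul_one_div, le_div_iff₀ hr0]; linarith
      linarith
    rw [← sum_filter_add_sum_filter_not F (fun n => δ n < ν + r),
      ← sum_filter_add_sum_filter_not (F.filter fun n => ¬ δ n < ν + r) (fun n => ν + 1 - r < δ n)]
    have b1 := hcard (F.filter fun n => δ n < ν + r) ν (filter_subset _ _) (fun n hn => by
      have := mem_filter.1 hn; exact ⟨(hFm n this.1).2.1, this.2.le⟩)
    have b2 := hcard ((F.filter fun n => ¬ δ n < ν + r).filter (fun n => ν + 1 - r < δ n)) (ν + 1 - r)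
      ((filter_subset _ _).trans (filter_subset _ _)) (fun n hn => by
      have h1 := mem_filter.1 hn; have h2 := mem_filter.1 h1.1
      exact ⟨h1.2.le, by linarith [(hFm n h2.1).2.2]⟩)
    have b3 : ‖∑ n ∈ (F.filter fun n => ¬ δ n < ν + r).filter (fun n => ¬ ν + 1 - r < δ n), eC (f n)‖ ≤ 2 / r := by
      have hm : ∀ n, n ∈ (F.filter fun n => ¬ δ n < ν + r).filter (fun n => ¬ ν + 1 - r < δ n) ↔ n < N ∧ ν + r ≤ δ n ∧ δ n ≤ ν + 1 - r := by
        intro n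
        simp only [mem_filter, hF, mem_range, not_lt, Int.floor_eq_iff]
        constructor
        · tauto
        · rintro ⟨a, b, c⟩; exact ⟨⟨⟨a, by linarith, by linarith⟩, b⟩, c⟩
      refine KLs f ?_ r hr0 ν (fun n hn => ((hm n).1 hn).2) (fun n hn hn' => hmono (n + 1) n OO ((hm _).1 hn').1.le)
      intro a ha b hb n h1 h2
      have ha := (hm a).1 ha; have hb := (hm b).1 hb
      exact (hm n).2 ⟨by omega, ha.2.1.trans (hmono n a h1 OO), (hmono b n h2 hb.1.le).trans hb.2.2⟩
    refine (norm_add_le _ _).trans ?_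
    have := norm_add_le (∑ n ∈ (F.filter fun n => ¬ δ n < ν + r).filter (fun n => ν + 1 - r < δ n), eC (f n))
      (∑ n ∈ (F.filter fun n => ¬ δ n < ν + r).filter (fun n => ¬ ν + 1 - r < δ n), eC (f n))
    have e : 5 / r = 3 / 2 * (1 / r) + (3 / 2 * (1 / r) + 2 / r) := by ring
    linarith
  rw [← sum_fiberwise_of_maps_to (t := I) (g := fun n => ⌊δ n⌋)]
  · refine (norm_sum_le _ _).trans ((sum_le_sum fun ν _ => hfib ν).trans ?_)
    rw [sum_const, nsmul_eq_mul]
    refine (mul_le_mul_of_nonneg_right hIcard PP).trans ?_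
    have e : (A * N * lam + 2) * (5 / r) = 5 * A * (N * r) + 10 * (1 / r) := by rw [← hrr]; field_simp; ring
    rw [e]
    have h1 : 0 ≤ A * (N * r) := by positivity
    have h2 : 1 / r ≤ A * (1 / r) := le_mul_of_one_le_left PP hA
    linarith
  · intro n hn
    have := mem_range.1 hn
    exact mem_Icc.2 ⟨Int.floor_le_floor (hmono n 0 (Nat.zero_le _) this.le), Int.floor_le_floor (hmono N n this.le le_rfl)⟩

/-- layer lemma -/
lemma layer {ι : Type*} (s : Finset ι) (g y : ι → ℝ) (a b : ℝ) (R : ℕ) (hg : ∀ i ∈ s, g i ≤ 2 ^ R)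
    (hgy : ∀ i ∈ s, g i * y i ≤ 1) (hy : ∀ i ∈ s, y i ≤ 1)
    (hb : 0 ≤ b) (hcount : ∀ D : ℝ, 0 < D → ((s.filter (fun i => y i ≤ D)).card : ℝ) ≤ a * D + b) :
    ∑ i ∈ s, g i ≤ 2 * a * (R + 1) + 2 * b * 2 ^ R := by
  have h1 : ∀ i ∈ s, g i ≤ ∑ t ∈ range (R + 1), if y i ≤ 2 / 2 ^ t then ~2 ^ t else 0 := by
    intro i hi
    have hnn : ∀ t ∈ range (R + 1), ~0 ≤ if y i ≤ 2 / 2 ^ t then ~2 ^ t else 0 := fun t _ => by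
      split_ifs <;> positivity
    have hex : ∃ t, g i ≤ 2 ^ t := ⟨R, hg i hi⟩
    set t := Nat.find hex with ht
    have ht1 : g i ≤ 2 ^ t := Nat.find_spec hex
    have htR : t ≤ R := Nat.find_min' hex (hg i hi)
    refine le_trans ?_ (single_le_sum hnn (mem_range.2 (Nat.lt_succ_of_le htR)))
    rw [if_pos]
    · exact ht1
    · rcases Nat.eq_zero_or_pos t with h0 | h0
      · rw [h0]; linarith [hy i hi]
      · have h2 := Nat.find_min hex (m := t - 1) OO
        push Not at h2
        have h3 : ~2 ^ t = 2 * 2 ^ (t - 1) := by rw [← pow_succ']; congr 1; omega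
        have hp : ~0 < 2 ^ (t - 1) := by positivity
        rw [h3, le_div_iff₀ PP]
        have h4 := hgy i hi
        rcases le_or_gt (y i) 0 with h5 | h5
        · nlinarith
        · nlinarith
  refine (sum_le_sum h1).trans ?_
  rw [sum_comm]
  have h2 : ∀ t ∈ range (R + 1), ∑ i ∈ s, (if y i ≤ 2 / 2 ^ t then ~2 ^ t else 0) ≤ 2 * a + b * 2 ^ t := by
    intro t _
    rw [← sum_filter, sum_const, nsmul_eq_mul]
    refine (mul_le_mul_of_nonneg_right (hcount (2 / 2 ^ t) PP) PP).trans (le_of_eq ?_)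
    field_simp
  refine (sum_le_sum h2).trans ?_
  rw [sum_add_distrib, sum_const, card_range, nsmul_eq_mul, ← mul_sum, geom_sum_eq (by norm_num)]
  have h3 : b * ((~2 ^ (R + 1) - 1) / (2 - 1)) ≤ 2 * b * 2 ^ R := by
    rw [pow_succ]; nlinarith
  push_cast
  linarith

lemma exists_R (V : ℝ) (hV : 1 ≤ V) : ∃ R : ℕ, V ≤ 2 ^ R ∧ ~2 ^ R ≤ 2 * V ∧ ~R ≤ 2 * log V + 1 := by
  have hl : 0 ≤ logb 2 V := logb_nonneg (by norm_num) hV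
  have h0 : ~2 ^ logb 2 V = V := rpow_logb (by norm_num) (by norm_num) LL
  have hc := Nat.ceil_lt_add_one hl
  refine ⟨⌈logb 2 V⌉₊, ?_, ?_, ?_⟩
  · rw [← rpow_natCast]
    conv_lhs => rw [← h0]
    exact rpow_le_rpow_of_exponent_le (by norm_num) (Nat.le_ceil _)
  · rw [← rpow_natCast]
    calc ~2 ^ (⌈logb 2 V⌉₊ : ℝ) ≤ 2 ^ (logb 2 V + 1) := rpow_le_rpow_of_exponent_le (by norm_num) hc.le
      _ = 2 * V := by rw [rpow_add (by norm_num), h0]; norm_num; ring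
  · have : logb 2 V ≤ 2 * log V := by
      rw [logb, div_le_iff₀ (log_pos (by norm_num))]
      have := log_two_gt_d9
      nlinarith [log_nonneg hV]
    linarith

def dd (f : ℕ → ℝ) (n : ℕ) : ℝ := f (n + 2) - 2 * f (n + 1) + f n

lemma dd_sum (f : ℕ → ℝ) (n h : ℕ) :
    (f (n + 1 + h) - f (n + 1)) - (f (n + h) - f n) = ∑ i ∈ range h, dd f (n + i) := by
  induction h with
  | zero => simp
  | succ h ih =>
    rw [sum_range_succ, ← ih, dd, show n + 1 + (h + 1) = n + h + 2 by ring,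
      show n + (h + 1) = n + h + 1 by ring, show n + 1 + h = n + h + 1 by ring]
    ring

lemma vdc_eC (f : ℕ → ℝ) (N q H : ℕ) (hH : 1 ≤ H) :
    ‖∑ n ∈ range N, eC (f n)‖ ^ 2 ≤ ~(N + q * H : ℕ) / H *
      (N + 2 * ∑ h ∈ Ico 1 H, ‖∑ n ∈ range (N - q * h), eC (f (n + q * h) - f n)‖) := by
  have := vdc (fun n => eC (f n)) N q H hH
  simp only [norm_eC, one_pow, sum_const, card_range, nsmul_eq_mul, mul_one] at this
  simpa only [eC_sub] using this

lemma sum_inv_le (H W : ℕ) (hHW : H ≤ W) : ∑ h ∈ Ico 1 H, ~1 / h ≤ 1 + log W := by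
  have h1 := harmonic_le_one_add_log W
  refine le_trans ?_ h1
  rw [harmonic_eq_sum_Icc]
  push_cast
  simp only [one_div]
  refine sum_le_sum_of_subset_of_nonneg (fun x hx => ?_) (fun _ _ _ => by positivity)
  simp only [mem_Ico, mem_Icc] at *
  omega

lemma D3piece (f w : ℕ → ℝ) (W q : ℕ) (a : ℤ) (ω : ℝ) (hq : 1 ≤ q) (hω : 0 < ω) (h4 : 4 * q * ω ≤ 1)
    (hw : ∀ n, n < W → dd f n = a / q + w n) (mono : ∀ n, n + 1 < W → w n ≤ w (n + 1))
    (hs : (∀ n, n < W → ω ≤ w n ∧ w n ≤ 2 * ω) ∨ (∀ n, n < W → -(2 * ω) ≤ w n ∧ w n ≤ -ω)) :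
    ‖∑ n ∈ range W, eC (f n)‖ ^ 2 ≤
      (3 * q + 8 * q * ω * W) * (W + 4 * (1 + log W) / (q * ω)) := by
  have hq0 : ~0 < q := by exact_mod_cast hq
  have hW0 : ~0 ≤ W := Nat.cast_nonneg W
  have hlog : 0 ≤ log W := log_natCast_nonneg W
  by_cases hWq : W < q
  · have h1 := norm_sum_eC_le (range W) f
    rw [card_range] at h1
    have h2 : ‖∑ n ∈ range W, eC (f n)‖ ^ 2 ≤ ~W ^ 2 := pow_le_pow_left₀ (norm_nonneg _) h1 2
    have h3 : ~W ≤ q := by exact_mod_cast hWq.le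
    have h4 : 0 ≤ 4 * (1 + log W) / (q * ω) := by positivity
    have h5 : 0 ≤ 8 * q * ω * W := by positivity
    have h6 : ~W * W ≤ (3 * q + 8 * q * ω * W) * (W + 4 * (1 + log W) / (q * ω)) :=
      mul_le_mul LL LL hW0 LL
    linarith [h2, sq ~W]
  push Not at hWq
  have hWq' : ~q ≤ W := by exact_mod_cast hWq
  have hWp : ~0 < W := lt_of_lt_of_le hq0 hWq'
  set x := min (~W / q) (1 / (4 * q * ω)) with hx
  have hx1 : 1 ≤ x := le_min ((one_le_div hq0).2 hWq') ((one_le_div PP).2 h4)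
  set H := ⌊x⌋₊ with hH
  have hH1 : 1 ≤ H := Nat.le_floor (by simpa using hx1)
  have hHx : ~H ≤ x := Nat.floor_le LL
  have hHx2 : x ≤ 2 * H := by
    have := Nat.lt_floor_add_one x
    have : ~1 ≤ H := by exact_mod_cast hH1
    linarith
  have hH0 : ~0 < H := by exact_mod_cast hH1
  have hqH : ~q * H ≤ W := by
    have := hHx.trans (min_le_left _ _)
    rw [le_div_iff₀ hq0] at this; linarith
  have hqHω : 4 * (q * H * ω) ≤ 1 := by
    have := hHx.trans (min_le_right _ _)
    rw [le_div_iff₀ PP] at this; linarith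
  have hHW : H ≤ W := by
    have : ~H ≤ W := by
      have : ~1 ≤ q := by exact_mod_cast hq
      nlinarith
    exact_mod_cast this
  refine (vdc_eC f W q H hH1).trans ?_
  have hU : ∀ h ∈ Ico 1 H, ‖∑ n ∈ range (W - q * h), eC (f (n + q * h) - f n)‖ ≤ 2 / (q * ω) * (1 / h) := by
    intro h hh
    rw [mem_Ico] at hh
    have hh0 : ~0 < h := by exact_mod_cast hh.1
    have hhH : ~h ≤ H := by exact_mod_cast hh.2.le
    have hD4 : 4 * (q * h * ω) ≤ 1 := by
      have : ~q * h * ω ≤ q * H * ω := by gcongr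
      linarith
    have hinc : ∀ n, n < W - q * h → (f (n + 1 + q * h) - f (n + 1)) - (f (n + q * h) - f n) = h * a + ∑ i ∈ range (q * h), w (n + i) := by
      intro n hn
      rw [dd_sum, sum_congr rfl (fun i hi => hw (n + i) (by have := mem_range.1 hi; omega)),
        sum_add_distrib, sum_const, card_range, nsmul_eq_mul]
      push_cast
      field_simp
    have hmono : ∀ n, n + 1 < W - q * h → (f (n + 1 + q * h) - f (n + 1)) - (f (n + q * h) - f n) ≤ (f (n + 2 + q * h) - f (n + 2)) - (f (n + 1 + q * h) - f (n + 1)) := by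
      intro n hn
      have e := hinc (n + 1) hn
      rw [show n + 1 + 1 + q * h = n + 2 + q * h by ring, show n + 1 + 1 = n + 2 by ring] at e
      rw [hinc n OO, e]
      have : ∑ i ∈ range (q * h), w (n + i) ≤ ∑ i ∈ range (q * h), w (n + 1 + i) :=
        sum_le_sum fun i hi => by
          have := mem_range.1 hi
          rw [show n + 1 + i = n + i + 1 by ring]; exact mono _ OO
      linarith
    have hD : 0 < (q * h * ω : ℝ) := by positivity
    have e2 : 2 / (q * ω) * (1 / h) = 2 / (q * h * ω : ℝ) := by field_simp
    rw [e2]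
    have hsumle : ∀ (c : ℝ) n, (∀ i, i < q * h → w (n + i) ≤ c) → ∑ i ∈ range (q * h), w (n + i) ≤ q * h * c := by
      intro c n hc
      refine (sum_le_sum fun i hi => hc i (mem_range.1 hi)).trans (le_of_eq ?_)
      simp
    have hlesum : ∀ (c : ℝ) n, (∀ i, i < q * h → c ≤ w (n + i)) → q * h * c ≤ ∑ i ∈ range (q * h), w (n + i) := by
      intro c n hc
      refine le_trans (le_of_eq ?_) (sum_le_sum fun i hi => hc i (mem_range.1 hi))
      simp
    rcases hs with hs | hs
    · refine KL (fun n => f (n + q * h) - f n) (W - q * h) _ hD (h * a) (fun n hn => ?_) hmono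
      rw [hinc n hn]
      have h1 := hsumle (2 * ω) n (fun i hi => (hs _ OO).2)
      have h2 := hlesum ω n (fun i hi => (hs _ OO).1)
      push_cast
      constructor <;> linarith
    · refine KL (fun n => f (n + q * h) - f n) (W - q * h) _ hD (h * a - 1) (fun n hn => ?_) hmono
      rw [hinc n hn]
      have h1 := hsumle (-ω) n (fun i hi => (hs _ OO).2)
      have h2 := hlesum (-(2 * ω)) n (fun i hi => (hs _ OO).1)
      push_cast
      constructor <;> linarith
  have hsum : ∑ h ∈ Ico 1 H, ‖∑ n ∈ range (W - q * h), eC (f (n + q * h) - f n)‖ ≤ 2 / (q * ω) * (1 + log W) := by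
    refine (sum_le_sum hU).trans ?_
    rw [← mul_sum]
    exact mul_le_mul_of_nonneg_left (sum_inv_le H W hHW) PP
  have hfac : ~(W + q * H : ℕ) / H ≤ 3 * q + 8 * q * ω * W := by
    rw [div_le_iff₀ hH0]
    push_cast
    rcases le_total (~W / q) (1 / (4 * q * ω)) with hc | hc
    · have h1 : ~W / q ≤ 2 * H := by rw [hx, min_eq_left hc] at hHx2; exact hHx2
      rw [div_le_iff₀ hq0] at h1
      have : 0 ≤ 8 * q * ω * W * H := by positivity
      nlinarith
    · have h1 : 1 / (4 * q * ω) ≤ 2 * H := by rw [hx, min_eq_right hc] at hHx2; exact hHx2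
      rw [div_le_iff₀ PP] at h1
      have : ~W * 1 ≤ W * (2 * H * (4 * q * ω)) := mul_le_mul_of_nonneg_left h1 hW0
      have : 0 ≤ ~q * H := by positivity
      nlinarith
  have e3 : ~W + 4 * (1 + log W) / (q * ω) = W + 2 * (2 / (q * ω) * (1 + log W)) := by ring
  rw [e3]
  have h7 : 0 ≤ ∑ h ∈ Ico 1 H, ‖∑ n ∈ range (W - q * h), eC (f (n + q * h) - f n)‖ := sum_nonneg fun _ _ => norm_nonneg _
  exact mul_le_mul hfac LL PP PP

lemma sq_le_of {x B : ℝ} (hB : 0 ≤ B) (h : x ^ 2 ≤ B ^ 2) : x ≤ B := abs_le_of_sq_le_sq' h hB |>.2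

lemma D3aux (A L Z : ℝ) (hA : 1 ≤ A) (hL : 1 ≤ L) (hZ : 0 ≤ Z) : Z ≤ (1 + A) ^ 2 * L ^ 2 * Z / 4 ∧
    L * Z ≤ (1 + A) ^ 2 * L ^ 2 * Z / 4 ∧ (1 + A) * Z ≤ (1 + A) ^ 2 * L ^ 2 * Z / 2 := by
  have h1 : 4 ≤ (1 + A) ^ 2 := by nlinarith
  have h2 : L ≤ L ^ 2 := by nlinarith
  have h3 : 2 * (1 + A) ≤ (1 + A) ^ 2 := by nlinarith
  have k1 : 4 * L ≤ (1 + A) ^ 2 * L ^ 2 := by nlinarith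
  have k3 : 2 * (1 + A) ≤ (1 + A) ^ 2 * L ^ 2 := by nlinarith
  have a1 := mul_le_mul_of_nonneg_right k1 hZ
  have a2 := mul_le_mul_of_nonneg_right k3 hZ
  have a3 := mul_le_mul_of_nonneg_right hL hZ
  refine ⟨?_, ?_, ?_⟩ <;> linarith

set_option maxHeartbeats 800000 in
lemma D3c1 (f : ℕ → ℝ) (N : ℕ) (A Y : ℝ) (q : ℕ) (a : ℤ) (hA : 1 ≤ A) (hY : 1 ≤ Y) (hN : ~N ≤ Y ^ 3)
    (hq : 1 ≤ q) (hqY : ~q ≤ Y) (hbig : 4 * (1 + A) ≤ Y ^ 2)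
    (h : ∀ n, n < N → 1 / Y ^ 6 ≤ dd f (n + 1) - dd f n ∧ dd f (n + 1) - dd f n ≤ A / Y ^ 6)
    (h0 : |dd f 0 - a / q| ≤ 1 / (q * Y ^ 2)) :
    ‖∑ n ∈ range N, eC (f n)‖ ≤ 200 * (1 + A) ^ 2 * Y ^ 2 * (1 + log Y) ^ 2 := by
  have hY0 : 0 < Y := by linarith
  have hq0 : ~0 < q := by exact_mod_cast hq
  set L := 1 + log Y with hL
  have hlogY := log_nonneg hY
  have hL1 : 1 ≤ L := by linarith
  set w : ℕ → ℝ := fun n => dd f n - a / q with hw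
  have hst : ∀ n, n < N → 1 / Y ^ 6 ≤ w (n + 1) - w n ∧ w (n + 1) - w n ≤ A / Y ^ 6 := fun n hn => by
    have := h n hn; simp only [hw]; constructor <;> linarith
  have hlam : 0 < 1 / Y ^ 6 := by positivity
  have hmono : ∀ m n, n ≤ m → m ≤ N → w n ≤ w m := fun m n h1 h2 => by
    have := step_mono hlam.le (fun n hn => (hst n hn).1) m n h1 h2
    have h3 : 0 ≤ ~(m - n : ℕ) * (1 / Y ^ 6) := by positivity
    linarith
  have hsep := step_sep hlam.le (fun n hn => (hst n hn).1)
  have hwb : ∀ n, n < N → |w n| ≤ (1 + A) / (q * Y ^ 2) := by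
    intro n hn
    have h1 := step_upper (fun n hn => (hst n hn).2) n hn.le
    have h2 := hmono n 0 (Nat.zero_le _) hn.le
    have h3 := abs_le.1 h0
    have h4 : ~n * (A / Y ^ 6) ≤ A / (q * Y ^ 2) := by
      have : ~n ≤ Y ^ 3 := le_trans (by exact_mod_cast hn.le) hN
      calc ~n * (A / Y ^ 6) ≤ Y ^ 3 * (A / Y ^ 6) := by gcongr
        _ = A / (Y * Y ^ 2) := by field_simp
        _ ≤ A / (q * Y ^ 2) := by gcongr
    have h5 : (1 + A) / (q * Y ^ 2) = 1 / (q * Y ^ 2) + A / (q * Y ^ 2) := by ring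
    have h6 : 0 ≤ A / (q * Y ^ 2) := by positivity
    have h7 : w 0 = dd f 0 - a / q := rfl
    rw [abs_le, h5]; constructor <;> linarith
  have hpiece : ∀ (P : Finset ℕ) (ω : ℝ), OC P → (∀ n ∈ P, n < N) → 1 / Y ^ 4 ≤ ω →
      ((∀ n ∈ P, ω ≤ w n ∧ w n ≤ 2 * ω) ∨ (∀ n ∈ P, -(2 * ω) ≤ w n ∧ w n ≤ -ω)) →
      ‖∑ n ∈ P, eC (f n)‖ ≤ 14 * (1 + A) * Y ^ 2 * L := by
    intro P ω hP hPN hω hs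
    have hω0 : 0 < ω := lt_of_lt_of_le PP hω
    obtain ⟨b, W, rfl⟩ := hP.Ico
    rcases Nat.eq_zero_or_pos W with h0 | hWpos
    · subst h0; simp; positivity
    have hmem : ∀ n, n < W → b + n ∈ Ico b (b + W) := fun n hn => by simp; omega
    have hωu : ω ≤ (1 + A) / (q * Y ^ 2) := by
      have h1 := hwb b (hPN b (hmem 0 hWpos))
      rcases hs with hs | hs
      · have := hs b (hmem 0 hWpos)
        exact this.1.trans ((le_abs_self _).trans h1)
      · have := hs b (hmem 0 hWpos)
        have := neg_le_abs (w b)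
        linarith
    have hqω : q * ω ≤ (1 + A) / Y ^ 2 := by
      calc q * ω ≤ q * ((1 + A) / (q * Y ^ 2)) := by gcongr
        _ = (1 + A) / Y ^ 2 := by field_simp
    have h4 : 4 * q * ω ≤ 1 := by
      have : (1 + A) / Y ^ 2 ≤ 1 / 4 := by rw [div_le_iff₀ PP]; linarith
      linarith
    have hWY : ~W ≤ Y ^ 3 := by
      have : W ≤ N := by have := hPN (b + (W - 1)) (hmem _ OO); omega
      exact le_trans (by exact_mod_cast this) hN
    have hWp : ~0 < W := by exact_mod_cast hWpos
    have hlW : log W ≤ 3 * log Y := by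
      have := log_le_log hWp hWY
      rwa [log_pow] at this
    have hlW0 : 0 ≤ log W := log_natCast_nonneg W
    have key := D3piece (fun n => f (b + n)) (fun n => w (b + n)) W q a ω hq hω0 h4
      (fun n hn => by simp only [hw, dd]; ring_nf) (fun n hn => hmono _ _ OO (by have := hPN _ (hmem _ hn); omega))
      (by
        rcases hs with hs | hs
        · exact Or.inl fun n hn => hs _ (hmem n hn)
        · exact Or.inr fun n hn => hs _ (hmem n hn))
    rw [sum_Ico_eq_sum_range, Nat.add_sub_cancel_left]
    refine sq_le_of PP (key.trans ?_)
    have e : (3 * q + 8 * q * ω * W) * (W + 4 * (1 + log W) / (q * ω)) =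
      3 * q * W + 12 * (1 + log W) * (1 / ω) + 8 * (q * ω) * W ^ 2 + 32 * (W * (1 + log W)) := by
      field_simp; ring
    rw [e]
    have hωi : 1 / ω ≤ Y ^ 4 := by
      rw [div_le_iff₀ hω0]; rw [div_le_iff₀ PP] at hω; linarith
    have hlW3 : 1 + log W ≤ 3 * L := by rw [hL]; linarith
    have b1 : ~q * W ≤ Y ^ 4 := by
      calc ~q * W ≤ Y * Y ^ 3 := by gcongr
        _ = Y ^ 4 := by ring
    have b2 : (1 + log W) * (1 / ω) ≤ 3 * L * Y ^ 4 := by gcongr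
    have b3 : q * ω * ~W ^ 2 ≤ (1 + A) * Y ^ 4 := by
      calc q * ω * ~W ^ 2 ≤ ((1 + A) / Y ^ 2) * (Y ^ 3) ^ 2 := by gcongr
        _ = (1 + A) * Y ^ 4 := by field_simp
    have b4 : W * (1 + log W) ≤ Y ^ 4 * (3 * L) := by
      have : Y ^ 3 ≤ Y ^ 4 := pow_le_pow_right₀ hY (by norm_num)
      exact mul_le_mul (hWY.trans this) hlW3 LL PP
    obtain ⟨t1, t2, t3⟩ := D3aux A L (Y ^ 4) hA hL1 PP
    have e2 : (14 * (1 + A) * Y ^ 2 * L) ^ 2 = 196 * ((1 + A) ^ 2 * L ^ 2 * Y ^ 4) := by ring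
    rw [e2]
    have hP0 : 0 ≤ (1 + A) ^ 2 * L ^ 2 * Y ^ 4 := by positivity
    linarith
  obtain ⟨R, hR1, hR2, hR3⟩ := exists_R ((1 + A) * Y ^ 2) (by nlinarith)
  have hind : ∀ t : ℕ, ‖∑ n ∈ (range N).filter (fun n => |w n| < 2 ^ t * (1 / Y ^ 4)), eC (f n)‖
      ≤ 3 * Y ^ 2 + t * (28 * (1 + A) * Y ^ 2 * L) := by
    intro t
    induction t with
    | zero =>
      refine (norm_sum_eC_le _ f).trans ?_
      have := card_sep ((range N).filter (fun n => |w n| < 2 ^ 0 * (1 / Y ^ 4))) w (1 / Y ^ 6) (-(1 / Y ^ 4)) (2 * (1 / Y ^ 4)) hlam PP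
        (fun i hi j hj => hsep i j (by simp at hi; omega) (by simp at hj; omega))
        (fun i hi => by
          have := abs_lt.1 (mem_filter.1 hi).2
          simp only [pow_zero, one_mul] at this
          constructor <;> linarith)
      have e : 2 * (1 / Y ^ 4) / (1 / Y ^ 6) = 2 * Y ^ 2 := by field_simp
      rw [e] at this
      have h2 : 1 ≤ Y ^ 2 := by nlinarith
      simp only [Nat.cast_zero, zero_mul, add_zero]
      linarith
    | succ t ih =>
      set ω := ~2 ^ t * (1 / Y ^ 4) with hω
      have hω0 : 0 < ω := by positivity
      have hω1 : 1 / Y ^ 4 ≤ ω := le_mul_of_one_le_left PP (one_le_pow₀ (by norm_num))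
      have e : ~2 ^ (t + 1) * (1 / Y ^ 4) = 2 * ω := by rw [hω, pow_succ]; ring
      rw [e]
      have hsplit : (range N).filter (fun n => |w n| < 2 * ω) = ((range N).filter (fun n => |w n| < ω)) ∪
        ((range N).filter (fun n => ω ≤ w n ∧ w n < 2 * ω) ∪ (range N).filter (fun n => -(2 * ω) < w n ∧ w n ≤ -ω)) := by
        ext n
        simp only [mem_filter, mem_union, abs_lt]
        constructor
        · rintro ⟨h1, h2, h3⟩
          by_cases h4 : ω ≤ w n
          · tauto
          by_cases h5 : w n ≤ -ω
          · tauto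
          push Not at h4 h5; tauto
        · rintro (⟨h1, h2⟩ | ⟨h1, h2⟩ | ⟨h1, h2⟩) <;> exact ⟨h1, by linarith, by linarith⟩
      rw [hsplit, sum_union, sum_union]
      · have p1 := hpiece ((range N).filter (fun n => ω ≤ w n ∧ w n < 2 * ω)) ω (by
          intro x hx y hy n h1 h2
          simp only [mem_filter, mem_range] at *
          have := hmono n x h1 OO; have := hmono y n h2 OO
          exact ⟨by omega, by linarith, by linarith⟩) (fun n hn => by simp at hn; exact hn.1) hω1
          (Or.inl fun n hn => by simp only [mem_filter] at hn; exact ⟨hn.2.1, hn.2.2.le⟩)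
        have p2 := hpiece ((range N).filter (fun n => -(2 * ω) < w n ∧ w n ≤ -ω)) ω (by
          intro x hx y hy n h1 h2
          simp only [mem_filter, mem_range] at *
          have := hmono n x h1 OO; have := hmono y n h2 OO
          exact ⟨by omega, by linarith, by linarith⟩) (fun n hn => by simp at hn; exact hn.1) hω1
          (Or.inr fun n hn => by simp only [mem_filter] at hn; exact ⟨hn.2.1.le, hn.2.2⟩)
        refine (norm_add_le _ _).trans ?_
        refine (add_le_add ih ((norm_add_le _ _).trans (add_le_add p1 p2))).trans ?_
        push_cast; linarith
      · rw [disjoint_left]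
        intro n hn hn'
        simp only [mem_filter] at *
        linarith
      · rw [disjoint_left]
        intro n hn hn'
        simp only [mem_filter, mem_union, abs_lt] at *
        rcases hn' with h | h <;> linarith
  have hfin := hind (R + 1)
  rw [filter_true_of_mem] at hfin
  · refine hfin.trans ?_
    have hl : log ((1 + A) * Y ^ 2) ≤ A + 2 * log Y := by
      rw [log_mul PP PP, log_pow]
      have := log_le_sub_one_of_pos (show 0 < 1 + A by linarith)
      push_cast; linarith
    have hRb : ~R + 1 ≤ 4 * (1 + A) * L := by
      have : 4 * log Y + 2 * A + 2 ≤ 4 * (1 + A) * L := by rw [hL]; nlinarith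
      linarith
    push_cast
    have h1 : (~R + 1) * (28 * (1 + A) * Y ^ 2 * L) ≤ 4 * (1 + A) * L * (28 * (1 + A) * Y ^ 2 * L) := by gcongr
    have h2 := (D3aux A L (Y ^ 2) hA hL1 PP).1
    linarith
  · intro n hn
    refine lt_of_le_of_lt (hwb n (mem_range.1 hn)) ?_
    have h1 : (1 + A) / (q * Y ^ 2) ≤ (1 + A) * Y ^ 2 * (1 / Y ^ 4) := by
      have : ~1 ≤ q := by exact_mod_cast hq
      calc (1 + A) / (q * Y ^ 2) ≤ (1 + A) / (1 * Y ^ 2) := by gcongr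
        _ = _ := by field_simp
    refine lt_of_le_of_lt h1 ?_
    have : ~0 < 1 / Y ^ 4 := by positivity
    rw [pow_succ (2 : ℝ) R]
    have h3 : (1 + A) * Y ^ 2 * (1 / Y ^ 4) ≤ 2 ^ R * (1 / Y ^ 4) := by gcongr
    have : ~0 < 2 ^ R * (1 / Y ^ 4) := by positivity
    linarith

lemma D3sep (β : ℝ) (q : ℕ) (a : ℤ) (hq : 1 ≤ q) (hcop : IsCoprime a (q : ℤ)) (h0 : |β - a / q| ≤ 1 / (q * ~q))
    (m : ℤ) (hm0 : m ≠ 0) (hm : 2 * |m| ≤ q) (z : ℤ) : 1 / (2 * ~q) ≤ |m * β - z| := by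
  have hq0 : ~0 < q := by exact_mod_cast hq
  have hne : m * a - z * q ≠ 0 := by
    intro h
    have h1 : (q : ℤ) ∣ m * a := ⟨z, by linarith⟩
    have h2 : (q : ℤ) ∣ m := hcop.symm.dvd_of_dvd_mul_right h1
    have h3 := Int.le_of_dvd (abs_pos.2 hm0) ((dvd_abs _ _).2 h2)
    have := abs_pos.2 hm0
    omega
  have h1 : ~1 ≤ |~m * a - z * q| := by
    have := Int.one_le_abs hne
    exact_mod_cast this
  have h2 : 1 / ~q ≤ |~m * (a / q) - z| := by
    rw [show ~m * (a / q) - z = (m * a - z * q) / q by field_simp, abs_div, abs_of_pos hq0]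
    gcongr
  have h3 : |~m * (β - a / q)| ≤ 1 / (2 * ~q) := by
    rw [abs_mul]
    have h4 : |~m| ≤ q / 2 := by
      have : 2 * |~m| ≤ q := by exact_mod_cast hm
      linarith
    calc |~m| * |β - a / q| ≤ q / 2 * (1 / (q * ~q)) := by gcongr
      _ = _ := by field_simp
  have h4 : |~m * (a / q) - z| ≤ |m * β - z| + |~m * (β - a / q)| := by
    rw [show ~m * (a / q) - z = (m * β - z) - m * (β - a / q) by ring]
    exact abs_sub _ _
  have e : 1 / ~q = 1 / (2 * ~q) + 1 / (2 * ~q) := by field_simp; ring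
  linarith

lemma D3count (β : ℝ) (q : ℕ) (a : ℤ) (hq : 1 ≤ q) (hcop : IsCoprime a (q : ℤ)) (h0 : |β - a / q| ≤ 1 / (q * ~q))
    (K : ℕ) (s : Finset ℕ) (hs : ∀ h ∈ s, K ≤ h ∧ h < 2 * K) (D : ℝ) (hD : 0 < D) :
    ((s.filter (fun h : ℕ => |~h * β - round (~h * β)| ≤ D)).card : ℝ) ≤ (8 * K + 4 * q) * D + (2 * K / q + 1) := by
  have hq0 : ~0 < q := by exact_mod_cast hq
  set l := q / 2 + 1 with hl
  have hl0 : 0 < l := by omega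
  set F := s.filter (fun h : ℕ => |~h * β - round (~h * β)| ≤ D) with hF
  have h1 : F.card = ∑ b ∈ range (K / l + 1), (F.filter (fun h => (h - K) / l = b)).card :=
    card_eq_sum_card_fiberwise (fun h hh => by
      have := hs h (mem_filter.1 hh).1
      simp only [coe_range, Set.mem_Iio, Nat.lt_add_one_iff]
      exact Nat.div_le_div_right OO)
  have h2 : ∀ b ∈ range (K / l + 1), ((F.filter (fun h => (h - K) / l = b)).card : ℝ) ≤ 4 * q * D + 1 := by
    intro b _
    have := card_sep (F.filter (fun h => (h - K) / l = b)) (fun h => ~h * β - round (h * β)) (1 / (2 * ~q)) (-D) (2 * D)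
      PP PP ?_ ?_
    · refine this.trans (le_of_eq ?_); field_simp; ring
    · intro i hi j hj hij
      rw [mem_filter] at hi hj
      have hi1 := hs i (mem_filter.1 hi.1).1
      have hj1 := hs j (mem_filter.1 hj.1).1
      have hi2 := (Nat.div_eq_iff hl0).1 hi.2
      have hj2 := (Nat.div_eq_iff hl0).1 hj.2
      have := D3sep β q a hq hcop h0 ((i : ℤ) - j) OO (by
        rcases abs_cases ((i : ℤ) - j) with h | h <;> omega) (round (~i * β) - round (~j * β))
      push_cast at this
      rwa [show (~i - j) * β - (round (~i * β) - round (~j * β)) = ~i * β - round (i * β) - (~j * β - round (j * β)) by ring] at this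
    · intro i hi
      have := abs_le.1 (mem_filter.1 (mem_filter.1 hi).1).2
      constructor <;> linarith
  have h3 : (F.card : ℝ) ≤ (K / l + 1 : ℕ) * (4 * q * D + 1) := by
    rw [h1]; push_cast
    refine (sum_le_sum h2).trans (le_of_eq ?_)
    rw [sum_const, card_range, nsmul_eq_mul]
    push_cast; rfl
  refine h3.trans ?_
  have h4 : ~(K / l + 1 : ℕ) ≤ 2 * K / q + 1 := by
    push_cast
    have : ~(K / l : ℕ) ≤ ~K / l := Nat.cast_div_le
    have h5 : ~q / 2 ≤ l := by
      have : q ≤ 2 * l := by omega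
      have : ~q ≤ 2 * l := by exact_mod_cast this
      linarith
    have h6 : ~K / l ≤ K / (q / 2) := by gcongr
    have h7 : ~K / (q / 2) = 2 * K / q := by field_simp
    linarith
  calc _ ≤ (2 * K / q + 1 : ℝ) * (4 * q * D + 1) := by gcongr
    _ = _ := by field_simp; ring

set_option maxHeartbeats 800000 in
lemma D3c2 (f : ℕ → ℝ) (N : ℕ) (A Y : ℝ) (q : ℕ) (a : ℤ) (hA : 1 ≤ A) (hY : 1 ≤ Y) (hN : ~N ≤ Y ^ 3)
    (hq : 1 ≤ q) (hcop : IsCoprime a (q : ℤ)) (hqY : Y ≤ q) (hqY2 : ~q ≤ Y ^ 2)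
    (h : ∀ n, n < N → 1 / Y ^ 6 ≤ dd f (n + 1) - dd f n ∧ dd f (n + 1) - dd f n ≤ A / Y ^ 6)
    (h0 : |dd f 0 - a / q| ≤ 1 / (q * ~q)) :
    ‖∑ n ∈ range N, eC (f n)‖ ≤ 700 * A * Y ^ 2 * (1 + log Y) := by
  have hY0 : 0 < Y := by linarith
  have hq0 : ~0 < q := by exact_mod_cast hq
  set L := 1 + log Y with hL
  have hlogY := log_nonneg hY
  have hL1 : 1 ≤ L := by linarith
  set β := dd f 0 with hβ
  have hlam : 0 < 1 / Y ^ 6 := by positivity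
  have hmono : ∀ m n, n ≤ m → m ≤ N → dd f n ≤ dd f m := fun m n h1 h2 => by
    have := step_mono hlam.le (fun n hn => (h n hn).1) m n h1 h2
    have h3 : 0 ≤ ~(m - n : ℕ) * (1 / Y ^ 6) := by positivity
    linarith
  have hub : ∀ n, n ≤ N → dd f n ≤ β + A / Y ^ 3 := fun n hn => by
    have h1 := step_upper (fun n hn => (h n hn).2) n hn
    have : ~n ≤ Y ^ 3 := le_trans (by exact_mod_cast hn) hN
    have : ~n * (A / Y ^ 6) ≤ A / Y ^ 3 := by
      calc ~n * (A / Y ^ 6) ≤ Y ^ 3 * (A / Y ^ 6) := by gcongr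
        _ = A / Y ^ 3 := by field_simp
    linarith
  have hY2 : 1 ≤ Y ^ 2 := by nlinarith
  set H := ⌊Y ^ 2⌋₊ with hH
  have hH1 : 1 ≤ H := Nat.le_floor (by simpa using hY2)
  have hHY : ~H ≤ Y ^ 2 := Nat.floor_le PP
  have hHY2 : Y ^ 2 ≤ 2 * H := by
    have := Nat.lt_floor_add_one (Y ^ 2)
    have : ~1 ≤ H := by exact_mod_cast hH1
    linarith
  set U : ℕ → ℝ := fun h => ‖∑ n ∈ range (N - 1 * h), eC (f (n + 1 * h) - f n)‖ with hU
  set y : ℕ → ℝ := fun h : ℕ => |~h * β - round (h * β)| with hy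
  have hU1 : ∀ h ∈ Ico 1 H, U h ≤ 20 * A * (Y ^ 3 / √h) := by
    intro k hk
    rw [mem_Ico] at hk
    have hk0 : ~0 < k := by exact_mod_cast hk.1
    have hkH : ~k ≤ Y ^ 2 := le_trans (by exact_mod_cast hk.2.le) hHY
    have hl : ~0 < k * (1 / Y ^ 6) := by positivity
    have key := D2 (fun n => f (n + 1 * k) - f n) (N - 1 * k) (k * (1 / Y ^ 6)) A hl hA (fun n hn => by
      have e : (f (n + 2 + 1 * k) - f (n + 2)) - 2 * (f (n + 1 + 1 * k) - f (n + 1)) + (f (n + 1 * k) - f n) = dd f (n + k) - dd f n := by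
        simp only [dd, one_mul, show n + 2 + k = n + k + 2 by ring, show n + 1 + k = n + k + 1 by ring]; ring
      rw [e]
      have l1 := step_mono hlam.le (fun n hn => (h n hn).1) (n + k) n OO OO
      have l2 := step_upper (x := fun i => dd f (n + i)) (N := k) (μ := A / Y ^ 6) (fun i hi => (h (n + i) OO).2) k le_rfl
      rw [Nat.add_sub_cancel_left] at l1
      simp only [add_zero] at l2
      refine ⟨l1, l2.trans (le_of_eq ?_)⟩
      ring)
    refine key.trans ?_
    have hs0 : 0 < √(k : ℝ) := sqrt_pos.2 hk0
    have hsq : √~k * √~k = k := mul_self_sqrt hk0.le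
    have e1 : √(~k * (1 / Y ^ 6)) = √k / Y ^ 3 := by
      rw [sqrt_mul hk0.le, show ~1 / Y ^ 6 = (1 / Y ^ 3) ^ 2 by ring, sqrt_sq PP]; ring
    rw [e1]
    have e2 : 1 / (√~k / Y ^ 3) = Y ^ 3 / √k := by field_simp
    rw [e2]
    have hNk : ~(N - 1 * k : ℕ) ≤ Y ^ 3 := le_trans (by exact_mod_cast Nat.sub_le _ _) hN
    have e3 : ~(N - 1 * k : ℕ) * (√k / Y ^ 3) ≤ Y ^ 3 / √k := by
      calc ~(N - 1 * k : ℕ) * (√k / Y ^ 3) ≤ Y ^ 3 * (√k / Y ^ 3) := by gcongr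
        _ = √k := by field_simp
        _ ≤ Y ^ 3 / √k := by
          rw [le_div_iff₀ hs0, hsq]
          exact hkH.trans (pow_le_pow_right₀ hY (by norm_num))
    have : 10 * A * (~(N - 1 * k : ℕ) * (√k / Y ^ 3) + Y ^ 3 / √k) ≤ 10 * A * (Y ^ 3 / √k + Y ^ 3 / √k) := by gcongr
    linarith
  have hU2 : ∀ h ∈ Ico 1 H, U h * y h ≤ 40 * A ^ 2 * √h := by
    intro k hk
    have hu1 := hU1 k hk
    rw [mem_Ico] at hk
    have hk1 : ~1 ≤ k := by exact_mod_cast hk.1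
    have hk0 : ~0 < k := by linarith
    have hs1 : 1 ≤ √(k : ℝ) := by rw [one_le_sqrt]; exact hk1
    have hsq : √~k * √~k = k := mul_self_sqrt hk0.le
    have hs0 : 0 < √(k : ℝ) := by linarith
    have hy0 : 0 ≤ y k := abs_nonneg _
    have hy12 : y k ≤ 1 / 2 := abs_sub_round _
    by_cases hc : y k ≤ 2 * k * (A / Y ^ 3)
    · calc U k * y k ≤ (20 * A * (Y ^ 3 / √k)) * (2 * k * (A / Y ^ 3)) := mul_le_mul hu1 hc hy0 PP
        _ = 40 * A ^ 2 * (k / √k) := by field_simp; ring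
        _ = 40 * A ^ 2 * √k := by congr 1; rw [div_eq_iff hs0.ne', hsq]
    push Not at hc
    have hyp : 0 < y k := lt_trans PP hc
    have hinc : ∀ n, n < N - 1 * k → k * β ≤ (f (n + 1 + 1 * k) - f (n + 1)) - (f (n + 1 * k) - f n) ∧
        (f (n + 1 + 1 * k) - f (n + 1)) - (f (n + 1 * k) - f n) ≤ k * β + y k / 2 := by
      intro n hn
      rw [one_mul, dd_sum]
      constructor
      · refine le_trans (le_of_eq ?_) (sum_le_sum fun i hi => hmono (n + i) 0 (Nat.zero_le _) (by have := mem_range.1 hi; omega))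
        simp [hβ]
      · refine (sum_le_sum fun i hi => hub (n + i) (by have := mem_range.1 hi; omega)).trans ?_
        simp only [sum_const, card_range, nsmul_eq_mul]
        linarith
    have hmn : ∀ n, n + 1 < N - 1 * k → (f (n + 1 + 1 * k) - f (n + 1)) - (f (n + 1 * k) - f n) ≤ (f (n + 2 + 1 * k) - f (n + 2)) - (f (n + 1 + 1 * k) - f (n + 1)) := by
      intro n hn
      have e := dd_sum f (n + 1) k
      rw [show n + 1 + 1 + k = n + 2 + k by ring, show n + 1 + 1 = n + 2 by ring] at e
      rw [one_mul, dd_sum, e]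
      exact sum_le_sum fun i hi => hmono _ _ OO (by have := mem_range.1 hi; omega)
    have hKL : U k ≤ 2 / (y k / 2) := by
      have hyk : y k = |~k * β - round (~k * β)| := rfl
      rcases le_total 0 (~k * β - round (~k * β)) with hp | hp
      · rw [abs_of_nonneg hp] at hyk
        refine KL (fun n => f (n + 1 * k) - f n) (N - 1 * k) _ PP (round (~k * β)) (fun n hn => ?_) hmn
        have := hinc n hn
        constructor <;> linarith
      · rw [abs_of_nonpos hp] at hyk
        refine KL (fun n => f (n + 1 * k) - f n) (N - 1 * k) _ PP (round (~k * β) - 1) (fun n hn => ?_) hmn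
        have := hinc n hn
        push_cast
        constructor <;> linarith
    have h5 : U k * y k ≤ 4 := by
      calc U k * y k ≤ 2 / (y k / 2) * y k := by gcongr
        _ = 4 := by field_simp; norm_num
    have : 1 ≤ A ^ 2 := by nlinarith
    nlinarith
  have hpiece : ∀ K : ℕ, 1 ≤ K → ∑ h ∈ (Ico 1 H).filter (fun h => K ≤ h ∧ h < 2 * K), U h ≤ 14000 * A ^ 2 * Y ^ 3 * L := by
    intro K hK
    by_cases hKH : H ≤ K
    · rw [sum_eq_zero]
      · positivity
      · intro i hi; simp at hi; omega
    push Not at hKH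
    have hK1 : ~1 ≤ K := by exact_mod_cast hK
    have hK0 : ~0 < K := by linarith
    have hKY : ~K ≤ Y ^ 2 := le_trans (by exact_mod_cast hKH.le) hHY
    have hV1 : 1 ≤ Y ^ 3 / K := by
      rw [le_div_iff₀ hK0]
      have : Y ^ 2 ≤ Y ^ 3 := pow_le_pow_right₀ hY (by norm_num)
      linarith
    obtain ⟨R, hR1, hR2, hR3⟩ := exists_R (Y ^ 3 / K) hV1
    set s := (Ico 1 H).filter (fun h => K ≤ h ∧ h < 2 * K) with hs
    have hsm : ∀ h ∈ s, h ∈ Ico 1 H ∧ K ≤ h ∧ h < 2 * K := fun h hh => by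
      have := mem_filter.1 hh; exact ⟨this.1, this.2⟩
    set S := √(K : ℝ) with hS
    have hS1 : 1 ≤ S := by rw [hS, one_le_sqrt]; exact hK1
    have hSS : S * S = K := mul_self_sqrt hK0.le
    have hSY : S ≤ Y := by rw [hS]; exact sqrt_le_iff.2 ⟨hY0.le, hKY⟩
    have hsqrt : ∀ h ∈ s, √~h ≤ 3 / 2 * S := by
      intro h hh
      have : ~h ≤ 2 * K := by exact_mod_cast (hsm h hh).2.2.le
      refine sqrt_le_iff.2 ⟨by positivity, ?_⟩
      nlinarith
    have hsqrt2 : ∀ h ∈ s, S ≤ √(h : ℝ) := fun h hh => sqrt_le_sqrt (by exact_mod_cast (hsm h hh).2.1)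
    have key := layer s (fun h => U h / (60 * A ^ 2 * S)) y (8 * K + 4 * q) (2 * K / q + 1) R ?_ ?_ ?_ PP ?_
    · rw [← sum_div, div_le_iff₀ PP] at key
      refine key.trans ?_
      have hlogV : log (Y ^ 3 / K) ≤ 3 * log Y := by
        rw [log_div PP PP, log_pow]
        have := log_nonneg hK1
        push_cast; linarith
      have hR4 : ~R + 1 ≤ 6 * L := by rw [hL]; linarith
      have g1 : 2 * (8 * K + 4 * q : ℝ) * (R + 1) ≤ 2 * (8 * Y ^ 2 + 4 * Y ^ 2) * (6 * L) := by gcongr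
      have g2 : S * (2 * (2 * K / q + 1 : ℝ) * 2 ^ R) ≤ 12 * Y ^ 3 := by
        calc S * (2 * (2 * K / q + 1 : ℝ) * 2 ^ R) ≤ S * (2 * (2 * K / q + 1 : ℝ) * (2 * (Y ^ 3 / K))) := by gcongr
          _ = 8 * (S / q) * Y ^ 3 + 4 * (S / K) * Y ^ 3 := by field_simp; ring
          _ ≤ 8 * 1 * Y ^ 3 + 4 * 1 * Y ^ 3 := by
            gcongr
            · rw [div_le_one hq0]; linarith
            · rw [div_le_one hK0]; nlinarith
          _ = 12 * Y ^ 3 := by ring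
      have g3 : S * (2 * (8 * K + 4 * q : ℝ) * (R + 1)) ≤ 144 * Y ^ 3 * L := by
        calc S * (2 * (8 * K + 4 * q : ℝ) * (R + 1)) ≤ Y * (2 * (8 * Y ^ 2 + 4 * Y ^ 2) * (6 * L)) := by gcongr
          _ = _ := by ring
      have g4 : S * (2 * (8 * K + 4 * q : ℝ) * (R + 1) + 2 * (2 * K / q + 1 : ℝ) * 2 ^ R) ≤ 156 * Y ^ 3 * L := by
        have : Y ^ 3 * 1 ≤ Y ^ 3 * L := by gcongr
        linarith
      calc _ = 60 * A ^ 2 * (S * (2 * (8 * K + 4 * q : ℝ) * (R + 1) + 2 * (2 * K / q + 1 : ℝ) * 2 ^ R)) := by ring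
        _ ≤ 60 * A ^ 2 * (156 * Y ^ 3 * L) := by gcongr
        _ ≤ _ := by
          have : 0 ≤ A ^ 2 * Y ^ 3 * L := by positivity
          linarith
    · intro i hi
      refine le_trans ?_ hR1
      rw [div_le_iff₀ PP]
      refine (hU1 i (hsm i hi).1).trans ?_
      have h1 : Y ^ 3 / √~i ≤ Y ^ 3 / S := by
        have := hsqrt2 i hi
        gcongr
      have h2 : Y ^ 3 / K * (60 * A ^ 2 * S) = 60 * A ^ 2 * (Y ^ 3 / S) := by rw [← hSS]; field_simp
      rw [h2]
      have h3 : 0 ≤ Y ^ 3 / S := by positivity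
      have : 20 * A ≤ 60 * A ^ 2 := by nlinarith
      exact mul_le_mul this h1 PP PP
    · intro i hi
      have h1 := hU2 i (hsm i hi).1
      have h2 := hsqrt i hi
      have h3 : U i / (60 * A ^ 2 * S) * y i = U i * y i / (60 * A ^ 2 * S) := by ring
      simp only [h3]
      rw [div_le_one PP]
      refine h1.trans ?_
      calc 40 * A ^ 2 * √~i ≤ 40 * A ^ 2 * (3 / 2 * S) := by gcongr
        _ = _ := by ring
    · intro i hi
      have := abs_sub_round (~i * β)
      simp only [hy]; linarith
    · intro D hD
      exact D3count β q a hq hcop h0 K s (fun h hh => (hsm h hh).2) D hD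
  have hind : ∀ t : ℕ, ∑ h ∈ (Ico 1 H).filter (fun h => h < 2 ^ t), U h ≤ t * (14000 * A ^ 2 * Y ^ 3 * L) := by
    intro t
    induction t with
    | zero =>
      rw [sum_eq_zero]
      · simp
      · intro i hi; simp at hi; omega
    | succ t ih =>
      have hsplit : (Ico 1 H).filter (fun h => h < 2 ^ (t + 1)) = (Ico 1 H).filter (fun h => h < 2 ^ t) ∪
        (Ico 1 H).filter (fun h => 2 ^ t ≤ h ∧ h < 2 * 2 ^ t) := by
        ext i
        have : 2 ^ (t + 1) = 2 * 2 ^ t := by ring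
        simp only [mem_filter, mem_union, this]
        generalize 2 ^ t = p
        constructor
        · rintro ⟨h1, h2⟩
          rcases lt_or_ge i p with h3 | h3
          · exact Or.inl ⟨h1, h3⟩
          · exact Or.inr ⟨h1, h3, h2⟩
        · rintro (⟨h1, h2⟩ | ⟨h1, h2, h3⟩)
          · exact ⟨h1, by omega⟩
          · exact ⟨h1, h3⟩
      rw [hsplit, sum_union]
      · have := hpiece (2 ^ t) Nat.one_le_two_pow
        push_cast; linarith
      · rw [disjoint_left]; intro i hi hi'; simp at hi hi'; omega
  obtain ⟨R, hR1, hR2, hR3⟩ := exists_R (Y ^ 2) hY2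
  have htot : ∑ h ∈ Ico 1 H, U h ≤ 56000 * A ^ 2 * Y ^ 3 * L ^ 2 := by
    have h1 := hind R
    rw [filter_true_of_mem] at h1
    · refine h1.trans ?_
      have : ~R ≤ 4 * L := by
        rw [log_pow] at hR3; push_cast at hR3; rw [hL]; linarith
      calc ~R * (14000 * A ^ 2 * Y ^ 3 * L) ≤ 4 * L * (14000 * A ^ 2 * Y ^ 3 * L) := by gcongr
        _ = _ := by ring
    · intro i hi
      rw [mem_Ico] at hi
      have h2 : ~i < 2 ^ R := lt_of_lt_of_le (lt_of_lt_of_le (by exact_mod_cast hi.2) hHY) hR1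
      exact_mod_cast h2
  refine sq_le_of PP ((vdc_eC f N 1 H hH1).trans ?_)
  have hfac : ~(N + 1 * H : ℕ) / H ≤ 4 * Y := by
    have hH0 : ~0 < H := by exact_mod_cast hH1
    rw [div_le_iff₀ hH0]
    push_cast
    have : Y ^ 2 ≤ Y ^ 3 := pow_le_pow_right₀ hY (by norm_num)
    have : Y * Y ^ 2 ≤ Y * (2 * H) := by gcongr
    have : Y * Y ^ 2 = Y ^ 3 := by ring
    linarith
  have hsec : ~N + 2 * ∑ h ∈ Ico 1 H, U h ≤ 112001 * A ^ 2 * Y ^ 3 * L ^ 2 := by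
    have h1 : 1 ≤ A ^ 2 * L ^ 2 := by
      have : 1 ≤ A * L := by nlinarith
      have e : A ^ 2 * L ^ 2 = (A * L) ^ 2 := by ring
      rw [e]; nlinarith
    have : Y ^ 3 * 1 ≤ Y ^ 3 * (A ^ 2 * L ^ 2) := by gcongr
    linarith
  have hnn : 0 ≤ ∑ h ∈ Ico 1 H, U h := sum_nonneg fun _ _ => norm_nonneg _
  refine (mul_le_mul hfac hsec PP PP).trans ?_
  have : 0 ≤ A ^ 2 * Y ^ 4 * L ^ 2 := by positivity
  linarith

lemma D3blk (f : ℕ → ℝ) (N : ℕ) (A Y : ℝ) (hA : 1 ≤ A) (hY : 1 ≤ Y) (hN : ~N ≤ Y ^ 3)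
    (h : ∀ n, n < N → 1 / Y ^ 6 ≤ dd f (n + 1) - dd f n ∧ dd f (n + 1) - dd f n ≤ A / Y ^ 6) :
    ‖∑ n ∈ range N, eC (f n)‖ ≤ 700 * (1 + A) ^ 2 * Y ^ 2 * (1 + log Y) ^ 2 := by
  have hY0 : 0 < Y := by linarith
  have hL1 : 1 ≤ 1 + log Y := by linarith [log_nonneg hY]
  set L := 1 + log Y
  have haux := D3aux A L (Y ^ 2) hA hL1 PP
  have hA2 : 0 ≤ (1 + A) ^ 2 * L ^ 2 * Y ^ 2 := by positivity
  have hY2 : 1 ≤ Y ^ 2 := by nlinarith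
  by_cases hbig : 4 * (1 + A) ≤ Y ^ 2
  swap
  · push Not at hbig
    have h1 := norm_sum_eC_le (range N) f
    rw [card_range] at h1
    have h2 : Y ^ 3 ≤ 4 * (1 + A) * Y ^ 2 := by
      have : Y ≤ 4 * (1 + A) := by nlinarith
      calc Y ^ 3 = Y * Y ^ 2 := by ring
        _ ≤ _ := by gcongr
    linarith [haux.2.2]
  set Q := ⌊Y ^ 2⌋₊ with hQ
  have hQ1 : 0 < Q := Nat.floor_pos.2 hY2
  have hQY : ~Q ≤ Y ^ 2 := Nat.floor_le PP
  have hQY2 : Y ^ 2 < Q + 1 := Nat.lt_floor_add_one _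
  obtain ⟨r, hr1, hr2⟩ := exists_rat_abs_sub_le_and_den_le (dd f 0) hQ1
  have hq1 : 1 ≤ r.den := r.den_pos
  have hq0 : ~0 < r.den := by exact_mod_cast hq1
  have hqQ : (r.den : ℝ) ≤ Q := by exact_mod_cast hr2
  rw [Rat.cast_def] at hr1
  rcases le_total (r.den : ℝ) Y with hc | hc
  · have h0 : |dd f 0 - r.num / r.den| ≤ 1 / (r.den * Y ^ 2) := by
      refine hr1.trans ?_
      rw [mul_comm]; gcongr
    have := D3c1 f N A Y r.den r.num hA hY hN hq1 hc hbig h h0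
    refine this.trans ?_
    linarith
  · have h0 : |dd f 0 - r.num / r.den| ≤ 1 / (r.den * (r.den : ℝ)) := by
      refine hr1.trans ?_
      gcongr; linarith
    have hcop : IsCoprime r.num (r.den : ℤ) := by
      rw [Int.isCoprime_iff_nat_coprime]; simpa using r.reduced
    have := D3c2 f N A Y r.den r.num hA hY hN hq1 hcop hc (hqQ.trans hQY) h h0
    refine this.trans ?_
    have h1 : A * L ≤ (1 + A) ^ 2 * L ^ 2 := by
      have : L ≤ L ^ 2 := by nlinarith
      have : A ≤ (1 + A) ^ 2 := by nlinarith
      exact mul_le_mul this ‹_› LL PP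
    have := mul_le_mul_of_nonneg_right h1 (show 0 ≤ Y ^ 2 by positivity)
    linarith

lemma block_sum (F : ℕ → ℂ) (N B : ℕ) (hB : 1 ≤ B) (E : ℝ)
    (h : ∀ a M, M ≤ B → a + M ≤ N → ‖∑ n ∈ range M, F (a + n)‖ ≤ E) :
    ‖∑ n ∈ range N, F n‖ ≤ ((N / B : ℕ) + 1) * E := by
  have hk : ∀ k, B * k ≤ N → ‖∑ n ∈ range (B * k), F n‖ ≤ k * E := by
    intro k hk
    induction k with
    | zero => simp
    | succ k ih =>
      have e : B * (k + 1) = B * k + B := by ring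
      rw [e] at hk ⊢
      rw [sum_range_add]
      have := ih OO; have := h (B * k) B le_rfl hk
      push_cast
      linarith [norm_add_le (∑ n ∈ range (B * k), F n) (∑ n ∈ range B, F (B * k + n))]
  have e := Nat.div_add_mod N B
  have hlt := Nat.mod_lt N hB
  have h1 := hk (N / B) OO
  have h2 := h (B * (N / B)) (N % B) hlt.le OO
  conv_lhs => rw [← e, sum_range_add]
  linarith [norm_add_le (∑ n ∈ range (B * (N / B)), F n) (∑ n ∈ range (N % B), F (B * (N / B) + n))]

/-- third derivative test -/
lemma D3 (f : ℕ → ℝ) (N : ℕ) (A Y : ℝ) (hA : 1 ≤ A) (hY : 1 ≤ Y)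
    (h : ∀ n, n < N → 1 / Y ^ 6 ≤ dd f (n + 1) - dd f n ∧ dd f (n + 1) - dd f n ≤ A / Y ^ 6) :
    ‖∑ n ∈ range N, eC (f n)‖ ≤ 1400 * (1 + A) ^ 2 * (1 + log Y) ^ 2 * (N / Y + Y ^ 2) := by
  have hY0 : 0 < Y := by linarith
  have hY3 : 1 ≤ Y ^ 3 := one_le_pow₀ hY
  set B := ⌊Y ^ 3⌋₊ with hB
  have hB1 : 1 ≤ B := Nat.floor_pos.2 hY3
  have hBY : ~B ≤ Y ^ 3 := Nat.floor_le PP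
  have hBY2 : Y ^ 3 ≤ 2 * B := by
    have := Nat.lt_floor_add_one (Y ^ 3)
    have : ~1 ≤ B := by exact_mod_cast hB1
    linarith
  have hB0 : ~0 < B := by exact_mod_cast hB1
  refine (block_sum (fun n => eC (f n)) N B hB1 (700 * (1 + A) ^ 2 * Y ^ 2 * (1 + log Y) ^ 2) ?_).trans ?_
  · intro a M hM haM
    exact D3blk (fun n => f (a + n)) M A Y hA hY (le_trans (by exact_mod_cast hM) hBY) (fun n hn => h (a + n) OO)
  · have h1 : ~(N / B : ℕ) ≤ 2 * N / Y ^ 3 := by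
      refine Nat.cast_div_le.trans ?_
      rw [div_le_div_iff₀ hB0 PP]
      have := mul_le_mul_of_nonneg_left hBY2 (Nat.cast_nonneg N : ~0 ≤ N)
      linarith
    calc _ ≤ (2 * N / Y ^ 3 + 1) * (700 * (1 + A) ^ 2 * Y ^ 2 * (1 + log Y) ^ 2) := by gcongr
      _ = 1400 * (1 + A) ^ 2 * (1 + log Y) ^ 2 * (N / Y) + 700 * (1 + A) ^ 2 * (1 + log Y) ^ 2 * Y ^ 2 := by field_simp; ring
      _ ≤ _ := by
        have : 0 ≤ (1 + A) ^ 2 * (1 + log Y) ^ 2 * Y ^ 2 := by positivity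
        linarith

def dk : ℕ → (ℕ → ℝ) → ℕ → ℝ
  | 0, f, n => f n
  | k + 1, f, n => dk k f (n + 1) - dk k f n

lemma dk_shift (k h : ℕ) (f : ℕ → ℝ) (n : ℕ) : dk k (fun n => f (n + h) - f n) n = dk k f (n + h) - dk k f n := by
  induction k generalizing n with
  | zero => rfl
  | succ k ih => simp only [dk, ih]; rw [show n + 1 + h = n + h + 1 by ring]; ring

lemma dk_sum (k h : ℕ) (f : ℕ → ℝ) (n : ℕ) :
    dk k (fun n => f (n + h) - f n) n = ∑ i ∈ range h, dk (k + 1) f (n + i) := by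
  rw [dk_shift]
  have := sum_range_sub (fun i => dk k f (n + i)) h
  simp only [add_zero] at this
  rw [← this]; rfl

lemma dk_add (k : ℕ) (f g : ℕ → ℝ) (n : ℕ) : dk k (fun n => f n + g n) n = dk k f n + dk k g n := by
  induction k generalizing n with
  | zero => rfl
  | succ k ih => simp only [dk, ih]; ring

lemma dk_smul (k : ℕ) (c : ℝ) (f : ℕ → ℝ) (n : ℕ) : dk k (fun n => c * f n) n = c * dk k f n := by
  induction k generalizing n with
  | zero => rfl
  | succ k ih => simp only [dk, ih]; ring

lemma dk_comp (k : ℕ) (f : ℕ → ℝ) (m n : ℕ) : dk k (fun n => f (m + n)) n = dk k f (m + n) := by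
  induction k generalizing n with
  | zero => rfl
  | succ k ih => simp only [dk, ih]; rfl

lemma dk_fwd (k : ℕ) (f : ℕ → ℝ) : dk k f = (fwdDiff 1)^[k] f := by
  induction k with
  | zero => rfl
  | succ k ih => rw [Function.iterate_succ_apply', ← ih]; rfl

lemma dk_pow (d : ℕ) (n : ℕ) : dk (d + 1) (fun n => ~n ^ d) n = 0 := by
  rw [dk_fwd]
  have h := fwdDiff_iter_pow_eq_zero_of_lt (R := ℝ) (Nat.lt_succ_self d)
  have h2 : ∀ (k : ℕ) (F : ℝ → ℝ) (n : ℕ), (fwdDiff 1)^[k] (fun n : ℕ => F n) n = (fwdDiff ~1)^[k] F n := by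
    intro k
    induction k with
    | zero => intro F n; rfl
    | succ k ih =>
      intro F n
      have h3 : (fwdDiff 1 fun n : ℕ => F n) = fun n : ℕ => fwdDiff 1 F n := by funext m; simp [fwdDiff]
      rw [Function.iterate_succ_apply, Function.iterate_succ_apply, ← ih, h3]
  rw [h2 (d + 1) (fun x => x ^ d), h]; rfl

lemma sum_sqrt_inv (N : ℕ) : ∑ h ∈ Ico 1 N, 1 / √~h ≤ 2 * √(N : ℝ) := by
  have key : ∀ N : ℕ, ∑ h ∈ range N, 1 / √~(h + 1 : ℕ) ≤ 2 * √(N : ℝ) := by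
    intro N
    induction N with
    | zero => simp
    | succ n ih =>
      rw [sum_range_succ]
      have h1 : 0 < √~(n + 1 : ℕ) := sqrt_pos.2 PP
      have h0 : 0 ≤ √(n : ℝ) := sqrt_nonneg _
      have h3 := mul_self_sqrt (show ~0 ≤ n by positivity)
      have h4 := mul_self_sqrt (show ~0 ≤ ~(n + 1 : ℕ) by positivity)
      have h5 : 1 / √~(n + 1 : ℕ) ≤ 2 * √~(n + 1 : ℕ) - 2 * √(n : ℝ) := by
        rw [div_le_iff₀ h1]
        have h6 : ~(n + 1 : ℕ) = n + 1 := by push_cast; ring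
        nlinarith [sq_nonneg (√~(n + 1 : ℕ) - √~n)]
      linarith
  rcases Nat.eq_zero_or_pos N with h0 | h0
  · subst h0; simp
  rw [sum_Ico_eq_sum_range]
  have h1 := key (N - 1)
  have h2 : √~(N - 1 : ℕ) ≤ √(N : ℝ) := sqrt_le_sqrt (by exact_mod_cast Nat.sub_le _ _)
  simp only [add_comm 1]
  linarith

lemma log_eps (ε : ℝ) (hε : 0 < ε) (X : ℝ) (hX : 1 ≤ X) : 1 + log X ≤ (1 + 1 / ε) * X ^ ε := by
  have h1 := log_le_rpow_div (by linarith : 0 ≤ X) hε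
  have h2 := one_le_rpow hX hε.le
  rw [add_mul, one_mul, one_div_mul_eq_div]; linarith

lemma V3 (A ε : ℝ) (hA : 1 ≤ A) (hε : 0 < ε) : ∃ C : ℝ, 1 ≤ C ∧ ∀ (f : ℕ → ℝ) (N X : ℕ) (T : ℝ), 1 ≤ X → N ≤ X → 0 < T →
    (∀ n, n < N → T / ~X ^ 2 ≤ dk 3 f n ∧ dk 3 f n ≤ A * (T / ~X ^ 2)) →
    ‖∑ n ∈ range N, eC (f n)‖ ≤ C * ~X ^ (~2 / 3 + ε) * (T ^ (~1 / 6) + T ^ (-~1 / 3)) := by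
  refine ⟨1400 * (1 + A) ^ 2 * (1 + 1 / (ε / 2)) ^ 2, ?_, ?_⟩
  · have : 1 ≤ (1 + 1 / (ε / 2)) ^ 2 := one_le_pow₀ (by have : 0 < 1 / (ε / 2) := by positivity
                                                        linarith)
    nlinarith
  intro f N X T hX hN hT h
  have hX1 : ~1 ≤ X := by exact_mod_cast hX
  have hX0 : ~0 < X := by linarith
  have hNX : ~N ≤ X := by exact_mod_cast hN
  set Y := ~X ^ (~1 / 3) * T ^ (-~1 / 6) with hY
  have hY0 : 0 < Y := by positivity
  have hY2 : Y ^ 2 = ~X ^ (~2 / 3) * T ^ (-~1 / 3) := by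
    rw [hY, mul_pow, ← rpow_mul_natCast hX0.le, ← rpow_mul_natCast hT.le]; norm_num
  have hYi : ~X / Y = ~X ^ (~2 / 3) * T ^ (~1 / 6) := by
    rw [div_eq_iff hY0.ne', hY]
    calc ~X = ~X ^ (~2 / 3 + 1 / 3) * T ^ (~1 / 6 + -~1 / 6) := by norm_num
      _ = _ := by rw [rpow_add hX0, rpow_add hT]; ring
  have hY6 : 1 / Y ^ 6 = T / ~X ^ 2 := by
    rw [hY, mul_pow, ← rpow_mul_natCast hX0.le, ← rpow_mul_natCast hT.le]
    norm_num
    rw [rpow_neg_one, ← rpow_natCast]; field_simp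
  have hsplit : ~X ^ (~2 / 3 + ε) * (T ^ (~1 / 6) + T ^ (-~1 / 3)) = ~X ^ ε * (X / Y + Y ^ 2) := by
    rw [hY2, hYi, rpow_add hX0]; ring
  rw [mul_assoc, hsplit]
  have hXe : 1 ≤ ~X ^ (ε / 2) := one_le_rpow hX1 LL
  have hXe2 : ~X ^ ε = (~X ^ (ε / 2)) ^ 2 := by rw [← rpow_mul_natCast hX0.le]; norm_num
  have hC1 : 1 ≤ 1400 * (1 + A) ^ 2 * (1 + 1 / (ε / 2)) ^ 2 := by
    have : 1 ≤ (1 + 1 / (ε / 2)) ^ 2 := one_le_pow₀ (by have : 0 < 1 / (ε / 2) := by positivity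
                                                        linarith)
    nlinarith
  have htriv : ~X ≤ X / Y + Y ^ 2 → ‖∑ n ∈ range N, eC (f n)‖ ≤ 1400 * (1 + A) ^ 2 * (1 + 1 / (ε / 2)) ^ 2 * (~X ^ ε * (X / Y + Y ^ 2)) := by
    intro hle
    have h1 := norm_sum_eC_le (range N) f
    rw [card_range] at h1
    have h2 : ~1 * (1 * X) ≤ 1400 * (1 + A) ^ 2 * (1 + 1 / (ε / 2)) ^ 2 * (~X ^ ε * (X / Y + Y ^ 2)) := by
      gcongr
      rw [hXe2]; exact one_le_pow₀ hXe
    linarith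
  by_cases hY1 : Y < 1
  · apply htriv
    have : ~X ≤ X / Y := by rw [le_div_iff₀ hY0]; nlinarith
    nlinarith
  push Not at hY1
  by_cases hYX : ~X ≤ Y
  · apply htriv
    have : 0 ≤ ~X / Y := by positivity
    nlinarith
  push Not at hYX
  have key := D3 f N A Y hA hY1 (fun n hn => by
    have := h n hn
    have e : dk 3 f n = dd f (n + 1) - dd f n := by simp only [dk, dd]; ring_nf
    rw [e] at this
    have e2 : A / Y ^ 6 = A * (1 / Y ^ 6) := by ring
    rw [e2, hY6]; exact this)
  refine key.trans ?_
  have hl : 1 + log Y ≤ (1 + 1 / (ε / 2)) * ~X ^ (ε / 2) := by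
    refine le_trans ?_ (log_eps (ε / 2) LL X hX1)
    have := log_le_log hY0 hYX.le
    linarith
  have hl0 := log_nonneg hY1
  calc _ ≤ 1400 * (1 + A) ^ 2 * ((1 + 1 / (ε / 2)) * ~X ^ (ε / 2)) ^ 2 * (X / Y + Y ^ 2) := by gcongr
    _ = _ := by rw [hXe2]; ring

lemma Vk (A ε : ℝ) (hA : 1 ≤ A) (hε : 0 < ε) (m : ℕ) : ∃ C : ℝ, 1 ≤ C ∧ ∀ (f : ℕ → ℝ) (N X : ℕ) (T : ℝ), 1 ≤ X → N ≤ X → 0 < T →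
    (∀ n, n < N → T / ~X ^ (m + 2) ≤ dk (m + 3) f n ∧ dk (m + 3) f n ≤ A * (T / ~X ^ (m + 2))) →
    ‖∑ n ∈ range N, eC (f n)‖ ≤ C * ~X ^ (1 - 1 / (3 * ~2 ^ m) + ε) * (T ^ (~1 / 6) + T ^ (-~1 / 3)) := by
  induction m with
  | zero =>
    obtain ⟨C, hC, h⟩ := V3 A ε hA hε
    refine ⟨C, hC, fun f N X T hX hN hT hf => ?_⟩
    have := h f N X T hX hN hT hf
    norm_num at this ⊢
    exact this
  | succ m ih =>
    obtain ⟨C, hC, ih⟩ := ih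
    refine ⟨2 + 8 * C, by linarith, fun f N X T hX hN hT hf => ?_⟩
    have hX1 : ~1 ≤ X := by exact_mod_cast hX
    have hX0 : ~0 < X := by linarith
    have hNX : ~N ≤ X := by exact_mod_cast hN
    set G := T ^ (~1 / 6) + T ^ (-~1 / 3) with hG
    have hp1 : 0 < T ^ (~1 / 6) := by positivity
    have hp2 : 0 < T ^ (-~1 / 3) := by positivity
    have hG1 : 1 ≤ G := by
      rcases le_total 1 T with h1 | h1
      · have := one_le_rpow h1 (show ~0 ≤ 1 / 6 by norm_num); linarith
      · have := one_le_rpow_of_pos_of_le_one_of_nonpos hT h1 (show (-~1 / 3) ≤ 0 by norm_num); linarith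
    rcases Nat.eq_zero_or_pos N with h0 | hNp
    · subst h0
      simp only [range_zero, sum_empty, norm_zero]; positivity
    set p := 1 - 1 / (3 * ~2 ^ m) with hp
    have hp' : 1 - 1 / (3 * ~2 ^ (m + 1)) = (1 + p) / 2 := by rw [hp, pow_succ]; field_simp; ring
    have hp0 : 0 ≤ p := by
      have : 1 / (3 * ~2 ^ m) ≤ 1 := by
        rw [div_le_one PP]
        have : ~1 ≤ 2 ^ m := one_le_pow₀ (by norm_num)
        linarith
      linarith
    rw [hp']
    set P := ~X ^ (p + ε) with hP
    have hP1 : 1 ≤ P := one_le_rpow hX1 LL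
    have hU : ∀ h ∈ Ico 1 N, ‖∑ n ∈ range (N - 1 * h), eC (f (n + 1 * h) - f n)‖ ≤
        C * P * (T ^ (~1 / 6) + T ^ (-~1 / 3) * (√X * (1 / √h))) := by
      intro h hh
      rw [mem_Ico] at hh
      have hh0 : ~0 < h := by exact_mod_cast hh.1
      have hhX : ~h ≤ X := le_trans (by exact_mod_cast hh.2.le) hNX
      rw [one_mul]
      have := ih (fun n => f (n + h) - f n) (N - h) X (h * T / X) hX OO PP (fun n hn => by
        rw [dk_sum]
        have hb : ∀ i ∈ range h, n + i < N := fun i hi => by have := mem_range.1 hi; omega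
        have l1 := sum_le_sum fun i hi => (hf (n + i) (hb i hi)).1
        have l2 := sum_le_sum fun i hi => (hf (n + i) (hb i hi)).2
        rw [sum_const, card_range, nsmul_eq_mul] at l1 l2
        have e : ~h * T / X / ~X ^ (m + 2) = h * (T / ~X ^ (m + 1 + 2)) := by
          rw [show m + 1 + 2 = m + 2 + 1 by ring, pow_succ _ (m + 2)]; field_simp
        rw [e]
        refine ⟨l1, l2.trans (le_of_eq ?_)⟩
        ring)
      refine this.trans ?_
      have e1 : (h * T / X) ^ (~1 / 6) ≤ T ^ (~1 / 6) := by
        apply rpow_le_rpow PP _ (by norm_num)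
        rw [div_le_iff₀ hX0]; nlinarith
      have e2 : (h * T / X) ^ (-~1 / 3) ≤ T ^ (-~1 / 3) * (√X * (1 / √h)) := by
        have : ~h * T / X = T * (~X / h)⁻¹ := by field_simp
        rw [this, mul_rpow hT.le PP, inv_rpow PP, ← rpow_neg PP]
        have h3 : √~X * (1 / √h) = (~X / h) ^ (~1 / 2) := by
          rw [← sqrt_eq_rpow, sqrt_div hX0.le]; ring
        rw [h3]
        gcongr
        · rw [one_le_div hh0]; exact hhX
        · norm_num
      gcongr
    have hsum : ∑ h ∈ Ico 1 N, ‖∑ n ∈ range (N - 1 * h), eC (f (n + 1 * h) - f n)‖ ≤ 2 * C * P * X * G := by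
      refine (sum_le_sum hU).trans ?_
      rw [← mul_sum, sum_add_distrib, sum_const, ← mul_sum, ← mul_sum, nsmul_eq_mul]
      have h1 := sum_sqrt_inv N
      have h2 : √~N ≤ √(X : ℝ) := sqrt_le_sqrt hNX
      have h3 := mul_self_sqrt hX0.le
      have h4 : √~X * ∑ i ∈ Ico 1 N, 1 / √~i ≤ 2 * X := by
        calc _ ≤ √~X * (2 * √~X) := mul_le_mul_of_nonneg_left LL (sqrt_nonneg _)
          _ = 2 * X := by linarith
      have h5 : (((Ico 1 N).card : ℕ) : ℝ) ≤ X := by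
        rw [Nat.card_Ico]; exact le_trans (by exact_mod_cast Nat.sub_le _ _) hNX
      calc _ ≤ C * P * (X * T ^ (~1 / 6) + T ^ (-~1 / 3) * (2 * X)) := by gcongr
        _ ≤ C * P * (2 * (X * T ^ (~1 / 6)) + T ^ (-~1 / 3) * (2 * X)) := by
          have : 0 < ~X * T ^ (~1 / 6) := by positivity
          exact mul_le_mul_of_nonneg_left LL PP
        _ = _ := by rw [hG]; ring
    refine sq_le_of PP ((vdc_eC f N 1 N hNp).trans ?_)
    have hN0 : ~0 < N := by exact_mod_cast hNp
    have e1 : ~(N + 1 * N : ℕ) / N = 2 := by push_cast; field_simp; norm_num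
    rw [e1]
    have e2 : ((2 + 8 * C) * ~X ^ ((1 + p) / 2 + ε) * G) ^ 2 = (2 + 8 * C) ^ 2 * (X * P * X ^ ε) * G ^ 2 := by
      rw [mul_pow, mul_pow, ← rpow_mul_natCast hX0.le, hP]
      congr 2
      conv_rhs => rw [← rpow_one_add' hX0.le LL, ← rpow_add hX0]
      congr 1; push_cast; ring
    rw [e2]
    have hXε : 1 ≤ ~X ^ ε := one_le_rpow hX1 hε.le
    have hXP : ~X * 1 * 1 ≤ X * P * G := by gcongr
    calc 2 * (~N + 2 * _) ≤ 2 * (X * P * G + 2 * (2 * C * P * X * G)) := by gcongr; linarith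
      _ = (2 + 8 * C) * (X * P * 1) * G := by ring
      _ ≤ (2 + 8 * C) ^ 2 * (X * P * X ^ ε) * G ^ 2 := by
        gcongr
        · nlinarith
        · nlinarith

lemma dk_mvt (k : ℕ) (F : ℕ → ℝ → ℝ) (hF : ∀ i x, 0 < x → HasDerivAt (F i) (F (i + 1) x) x) (L U a : ℝ) (ha : 0 < a) (n : ℕ)
    (hb : ∀ x, a + n ≤ x → x ≤ a + n + k → L ≤ F k x ∧ F k x ≤ U) :
    L ≤ dk k (fun n => F 0 (a + n)) n ∧ dk k (fun n => F 0 (a + n)) n ≤ U := by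
  induction k generalizing F with
  | zero => exact hb _ le_rfl (by simp)
  | succ k ih =>
    have h1 : dk (k + 1) (fun n => F 0 (a + n)) n = dk k (fun n => (fun i x => F i (x + 1) - F i x) 0 (a + n)) n := by
      simp only [dk]
      rw [← dk_shift]; congr 1; funext m; push_cast; rw [add_assoc]
    rw [h1]
    apply ih (fun i x => F i (x + 1) - F i x)
    · intro i x hx
      exact (HasDerivAt.comp_add_const x 1 (hF i (x + 1) LL)).sub (hF i x hx)
    · intro x hx1 hx2
      have hn : ~0 ≤ n := Nat.cast_nonneg n
      have hx0 : 0 < x := by linarith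
      obtain ⟨ξ, hξ, he⟩ := exists_hasDerivAt_eq_slope (F k) (F (k + 1)) (show x < x + 1 by linarith)
        (fun y hy => (hF k y (by linarith [hy.1])).continuousAt.continuousWithinAt) (fun y hy => hF k y (by linarith [hy.1]))
      have : F k (x + 1) - F k x = F (k + 1) ξ := by rw [he]; ring
      simp only [this]
      apply hb _ (by linarith [hξ.1])
      push_cast; linarith [hξ.2]

def pc (γ : ℝ) (i : ℕ) : ℝ := ∏ l ∈ range i, (γ - l)

lemma pc_deriv (γ : ℝ) (i : ℕ) (x : ℝ) (hx : 0 < x) :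
    HasDerivAt (fun x => pc γ i * x ^ (γ - i)) (pc γ (i + 1) * x ^ (γ - (i + 1 : ℕ))) x := by
  have := (hasDerivAt_rpow_const (p := γ - i) (Or.inl hx.ne')).const_mul (pc γ i)
  have e : pc γ (i + 1) * x ^ (γ - (i + 1 : ℕ)) = pc γ i * ((γ - i) * x ^ (γ - i - 1)) := by
    rw [show pc γ (i + 1) = pc γ i * (γ - i) from prod_range_succ _ _]; push_cast
    rw [show γ - i - 1 = γ - (i + 1) by ring]; ring
  rw [e]; exact this

lemma pc_pos (γ : ℝ) (h0 : 0 < γ) (h1 : γ < 1) (i : ℕ) : 0 < (-1) ^ i * pc γ (i + 1) := by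
  induction i with
  | zero => simp [pc, h0]
  | succ i ih =>
    rw [show pc γ (i + 1 + 1) = pc γ (i + 1) * (γ - (i + 1 : ℕ)) from prod_range_succ _ _, pow_succ]
    have : ~0 < (i + 1 : ℕ) - γ := by
      push_cast
      have : ~0 ≤ i := Nat.cast_nonneg i
      linarith
    nlinarith [mul_pos ih this]

lemma dk_rpow (γ : ℝ) (h0 : 0 < γ) (h1 : γ < 1) (k : ℕ) (a b : ℝ) (ha : 0 < a) (n : ℕ) (hb : a + n + (k + 1) ≤ b) :
    (-1) ^ k * pc γ (k + 1) * b ^ (γ - (k + 1)) ≤ (-1) ^ k * dk (k + 1) (fun n => (a + n) ^ γ) n ∧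
    (-1) ^ k * dk (k + 1) (fun n => (a + n) ^ γ) n ≤ (-1) ^ k * pc γ (k + 1) * (a + n) ^ (γ - (k + 1)) := by
  have hp := pc_pos γ h0 h1 k
  have hn : ~0 ≤ n := Nat.cast_nonneg n
  have hk : ~0 ≤ k := Nat.cast_nonneg k
  have := dk_mvt (k + 1) (fun i x => (-1) ^ k * (pc γ i * x ^ (γ - i))) (fun i x hx => (pc_deriv γ i x hx).const_mul _)
    ((-1) ^ k * pc γ (k + 1) * b ^ (γ - (k + 1))) ((-1) ^ k * pc γ (k + 1) * (a + n) ^ (γ - (k + 1))) a ha n (fun x hx1 hx2 => by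
      push_cast at hx2 ⊢
      rw [← mul_assoc]
      constructor
      · exact mul_le_mul_of_nonneg_left (rpow_le_rpow_of_nonpos LL LL LL) hp.le
      · exact mul_le_mul_of_nonneg_left (rpow_le_rpow_of_nonpos LL LL LL) hp.le)
  rw [dk_smul] at this
  simpa [pc] using this

lemma norm_neg_sum (f : ℕ → ℝ) (N k : ℕ) : ‖∑ n ∈ range N, eC ((-1) ^ k * f n)‖ = ‖∑ n ∈ range N, eC (f n)‖ := by
  rcases Nat.even_or_odd k with h | h
  · simp [h.neg_one_pow]
  · simp only [h.neg_one_pow, neg_mul, one_mul, eC_neg]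
    rw [← map_sum]; exact Complex.norm_conj _

lemma P2main (d : ℕ) (hd : 2 ≤ d) (γ : ℝ) (h0 : 0 < γ) (h1 : γ < 1) (ε : ℝ) (hε : 0 < ε) :
    ∃ C : ℝ, 1 ≤ C ∧ ∀ (X j κ N : ℕ) (θ : ℝ), 1 ≤ X → 1 ≤ j → κ ≤ 1 → N ≤ X →
    ‖∑ n ∈ range N, eC (j * ~(X + n + κ : ℕ) ^ γ + θ * ~(X + n : ℕ) ^ d)‖ ≤
      C * ~X ^ (1 - 1 / (3 * ~2 ^ (d - 2)) + ε) * ((j * ~X ^ (γ - 1)) ^ (~1 / 6) + (j * ~X ^ (γ - 1)) ^ (-~1 / 3)) := by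
  set Q := (-1) ^ d * pc γ (d + 1) with hQ
  have hQ0 : 0 < Q := pc_pos γ h0 h1 d
  set B : ℝ := ~d + 4 with hB
  have hB1 : 1 ≤ B := by have : ~0 ≤ d := Nat.cast_nonneg d
                         linarith
  have hB0 : 0 < B := by linarith
  set A := B ^ (~d + 1 - γ) with hA
  have hA1 : 1 ≤ A := one_le_rpow hB1 (by have : ~0 ≤ d := Nat.cast_nonneg d; linarith)
  have hA0 : 0 < A := by linarith
  set c1 := Q / A with hc1
  have hc0 : 0 < c1 := by positivity
  obtain ⟨C, hC, h⟩ := Vk A ε hA1 hε (d - 2)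
  refine ⟨C * (1 + c1 ^ (~1 / 6) + c1 ^ (-~1 / 3)), ?_, ?_⟩
  · have : 0 < c1 ^ (~1 / 6) := by positivity
    have : 0 < c1 ^ (-~1 / 3) := by positivity
    nlinarith
  intro X j κ N θ hX hj hκ hN
  have hX1 : ~1 ≤ X := by exact_mod_cast hX
  have hX0 : ~0 < X := by linarith
  have hj0 : ~0 < j := by exact_mod_cast hj
  set T := ~j * ~X ^ (γ - 1) with hT
  have hT0 : 0 < T := by positivity
  have hdX : ~X ^ (γ - (d + 1)) = ~X ^ (γ - 1) / ~X ^ d := by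
    rw [← rpow_natCast, ← rpow_sub hX0]; congr 1; ring
  have key := h (fun n => (-1) ^ d * (j * ~(X + n + κ : ℕ) ^ γ + θ * ~(X + n : ℕ) ^ d)) N X (c1 * T) hX hN PP (by
    intro n hn
    rw [show d - 2 + 2 = d by omega, show d - 2 + 3 = d + 1 by omega]
    rw [dk_smul, dk_add, dk_smul, dk_smul, dk_comp (d + 1) (fun n => ~n ^ d) X n, dk_pow, mul_zero, add_zero]
    have hn' : ~n + 1 ≤ X := by exact_mod_cast (show n + 1 ≤ X by omega)
    have hκ0 : ~0 ≤ κ := Nat.cast_nonneg κ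
    have hκ1 : ~κ ≤ 1 := by exact_mod_cast hκ
    have hn0 : ~0 ≤ n := Nat.cast_nonneg n
    have hd0 : ~0 ≤ d := Nat.cast_nonneg d
    obtain ⟨e1, e2⟩ := dk_rpow γ h0 h1 d (X + κ) (B * X) PP n (by rw [hB]; nlinarith)
    have e3 : (fun n : ℕ => (~X + κ + n) ^ γ) = fun n : ℕ => ~(X + n + κ : ℕ) ^ γ := by
      funext n; push_cast; congr 1; ring
    rw [e3] at e1 e2
    have e4 : (-1) ^ d * (~j * dk (d + 1) (fun n : ℕ => ~(X + n + κ : ℕ) ^ γ) n) =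
      j * ((-1) ^ d * dk (d + 1) (fun n : ℕ => ~(X + n + κ : ℕ) ^ γ) n) := by ring
    rw [e4]
    have e5 : c1 * T / ~X ^ d = j * (Q * (B * X) ^ (γ - (d + 1))) := by
      rw [mul_rpow hB0.le hX0.le, hdX, hc1, hT, hA, show γ - (~d + 1) = -(d + 1 - γ) by ring, rpow_neg hB0.le]
      field_simp
    have e6 : A * (c1 * T / ~X ^ d) = j * (Q * ~X ^ (γ - (d + 1))) := by
      rw [hdX, hc1, hT]; field_simp
    rw [e6, e5]
    refine ⟨mul_le_mul_of_nonneg_left e1 hj0.le, mul_le_mul_of_nonneg_left (e2.trans ?_) hj0.le⟩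
    exact mul_le_mul_of_nonneg_left (rpow_le_rpow_of_nonpos hX0 LL LL) hQ0.le)
  rw [norm_neg_sum] at key
  refine key.trans ?_
  rw [mul_rpow hc0.le hT0.le, mul_rpow hc0.le hT0.le]
  have p1 : 0 < c1 ^ (~1 / 6) := by positivity
  have p2 : 0 < c1 ^ (-~1 / 3) := by positivity
  have p3 : 0 < T ^ (~1 / 6) := by positivity
  have p4 : 0 < T ^ (-~1 / 3) := by positivity
  set W := ~X ^ (1 - 1 / (3 * ~2 ^ (d - 2)) + ε)
  rw [mul_right_comm C _ W, mul_assoc (C * W)]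
  apply mul_le_mul_of_nonneg_left _ PP
  nlinarith [mul_pos p1 p4, mul_pos p2 p3]

/-- exponential sum hypothesis -/
def EH (d : ℕ) (γ τ : ℝ) : Prop := ∀ ε : ℝ, 0 < ε → ∃ C : ℝ, 1 ≤ C ∧ ∀ (X j κ N : ℕ) (θ : ℝ), 1 ≤ X → 1 ≤ j → j ≤ X → κ ≤ 1 → N ≤ X →
    ‖∑ n ∈ range N, eC (j * ~(X + n + κ : ℕ) ^ γ + θ * ~(X + n : ℕ) ^ d)‖ ≤
      C * ~X ^ (τ + ε) * (1 + (j / ~X ^ (1 - τ)) ^ (~1 / 6) + (j * ~X ^ (γ - 1)) ^ (-~1 / 3))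

lemma P2EH (d : ℕ) (hd : 2 ≤ d) (γ τ : ℝ) (h0 : 0 < γ) (h1 : γ < 1) (hs : 1 - τ ≤ 1 / (3 * ~2 ^ (d - 2)))
    (hs2 : 7 * (1 - τ) ≤ 6 * (1 / (3 * ~2 ^ (d - 2))) + (1 - γ)) : EH d γ τ := by
  intro ε hε
  obtain ⟨C, hC, h⟩ := P2main d hd γ h0 h1 ε hε
  refine ⟨C, hC, fun X j κ N θ hX hj _ hκ hN => (h X j κ N θ hX hj hκ hN).trans ?_⟩
  have hX1 : ~1 ≤ X := by exact_mod_cast hX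
  have hX0 : ~0 < X := by linarith
  have hj0 : ~0 < j := by exact_mod_cast hj
  set s := 1 / (3 * ~2 ^ (d - 2))
  rw [mul_assoc, mul_assoc]
  apply mul_le_mul_of_nonneg_left _ LL
  have i1 : ~X ^ (1 - s + ε) ≤ ~X ^ (τ + ε) := rpow_le_rpow_of_exponent_le hX1 LL
  have i2 : ~X ^ (1 - s + ε) * (j * ~X ^ (γ - 1)) ^ (~1 / 6) ≤ ~X ^ (τ + ε) * (j / ~X ^ (1 - τ)) ^ (~1 / 6) := by
    rw [mul_rpow hj0.le PP, div_rpow hj0.le PP, ← rpow_mul hX0.le, ← rpow_mul hX0.le,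
      mul_left_comm, ← rpow_add hX0, div_eq_mul_inv (~j ^ _), mul_left_comm (_ ^ (τ + ε)), ← rpow_neg hX0.le, ← rpow_add hX0]
    exact mul_le_mul_of_nonneg_left (rpow_le_rpow_of_exponent_le hX1 LL) PP
  have i3 : ~X ^ (1 - s + ε) * (j * ~X ^ (γ - 1)) ^ (-~1 / 3) ≤ ~X ^ (τ + ε) * (j * ~X ^ (γ - 1)) ^ (-~1 / 3) :=
    mul_le_mul_of_nonneg_right i1 PP
  have : 0 < ~X ^ (τ + ε) := by positivity
  nlinarith

def gs (V : ℕ) (x : ℝ) : ℝ := ‖∑ v ∈ range V, eC (x * v)‖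

lemma gs_nonneg (V : ℕ) (x : ℝ) : 0 ≤ gs V x := norm_nonneg _
lemma gs_le (V : ℕ) (x : ℝ) : gs V x ≤ V := by
  have := norm_sum_eC_le (range V) (fun v => x * v)
  rwa [card_range] at this
lemma gs_neg (V : ℕ) (x : ℝ) : gs V (-x) = gs V x := by
  have := norm_neg_sum (fun v => x * v) V 1
  simpa [gs] using this
lemma gs_mul (V : ℕ) (x : ℝ) : gs V x * |x - round x| ≤ 2 := by
  rcases (abs_nonneg (x - round x)).eq_or_lt with h | h
  · rw [← h]; simp
  · rw [← le_div_iff₀ h]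
    have h1 : |x - round x| ≤ x - ⌊x⌋ := by
      have := round_le x ⌊x⌋
      rwa [abs_of_nonneg (sub_nonneg.2 (Int.floor_le x))] at this
    have h2 : |x - round x| ≤ ⌊x⌋ + 1 - x := by
      have := round_le x (⌊x⌋ + 1)
      have e : |x - ((⌊x⌋ + 1 : ℤ) : ℝ)| = ⌊x⌋ + 1 - x := by
        rw [abs_sub_comm, abs_of_nonneg] <;> push_cast <;> linarith [Int.lt_floor_add_one x]
      rwa [e] at this
    refine KL (fun v => x * v) V _ h ⌊x⌋ (fun n _ => ?_) (fun n _ => ?_)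
    · have e : x * ~(n + 1 : ℕ) - x * n = x := by push_cast; ring
      rw [e]; constructor <;> linarith
    · push_cast; linarith

lemma eC_sum {ι : Type*} (s : Finset ι) (f : ι → ℝ) : eC (∑ i ∈ s, f i) = ∏ i ∈ s, eC (f i) := by
  induction s using Finset.induction_on with
  | empty => simp [eC_zero]
  | insert a s ha ih => rw [sum_insert ha, prod_insert ha, eC_add, ih]

lemma LS_phi (K N : ℕ) (α : ℕ → Fin K → ℝ) (c : ℕ → ℂ) (hc : ∀ n, ‖c n‖ ≤ 1) (W : Fin K → ℕ) (i0 : Fin K) :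
    ∑ v ∈ Fintype.piFinset (fun i => range (W i)), ‖∑ n ∈ range N, c n * eC (∑ i, α n i * v i)‖ ^ 2 ≤
    (∏ i ∈ univ.erase i0, (W i : ℝ)) * ∑ n ∈ range N, ∑ n' ∈ range N, gs (W i0) (α n i0 - α n' i0) := by
  have h1 : ∀ v : Fin K → ℕ, ((‖∑ n ∈ range N, c n * eC (∑ i, α n i * v i)‖ ^ 2 : ℝ) : ℂ) =
      ∑ n ∈ range N, ∑ n' ∈ range N, c n * (starRingEnd ℂ) (c n') * ∏ i, eC ((α n i - α n' i) * v i) := by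
    intro v
    push_cast
    rw [← Complex.mul_conj', map_sum, sum_mul_sum]
    refine sum_congr rfl fun n _ => sum_congr rfl fun n' _ => ?_
    rw [map_mul, ← eC_sum]
    have : ∑ i, (α n i - α n' i) * v i = ∑ i, α n i * v i - ∑ i, α n' i * v i := by
      rw [← sum_sub_distrib]; exact sum_congr rfl fun i _ => by ring
    rw [this, eC_sub]; ring
  have h2 : ((∑ v ∈ Fintype.piFinset (fun i => range (W i)), ‖∑ n ∈ range N, c n * eC (∑ i, α n i * v i)‖ ^ 2 : ℝ) : ℂ) =
      ∑ n ∈ range N, ∑ n' ∈ range N, c n * (starRingEnd ℂ) (c n') * ∏ i, ∑ v ∈ range (W i), eC ((α n i - α n' i) * v) := by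
    rw [Complex.ofReal_sum, sum_congr rfl fun v _ => h1 v, sum_comm]
    refine sum_congr rfl fun n _ => ?_
    rw [sum_comm]
    refine sum_congr rfl fun n' _ => ?_
    rw [← mul_sum, prod_univ_sum]
  have h3 : ∑ v ∈ Fintype.piFinset (fun i => range (W i)), ‖∑ n ∈ range N, c n * eC (∑ i, α n i * v i)‖ ^ 2 =
      ‖((∑ v ∈ Fintype.piFinset (fun i => range (W i)), ‖∑ n ∈ range N, c n * eC (∑ i, α n i * v i)‖ ^ 2 : ℝ) : ℂ)‖ := by
    rw [Complex.norm_real, norm_of_nonneg]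
    exact sum_nonneg fun _ _ => by positivity
  rw [h3, h2, mul_sum]
  refine (norm_sum_le _ _).trans (sum_le_sum fun n _ => ?_)
  rw [mul_sum]
  refine (norm_sum_le _ _).trans (sum_le_sum fun n' _ => ?_)
  rw [norm_mul, norm_mul, RCLike.norm_conj, norm_prod, ← mul_prod_erase _ _ (mem_univ i0), mul_comm (∏ i ∈ _, (W i : ℝ))]
  have h4 : ∏ i ∈ univ.erase i0, ‖∑ v ∈ range (W i), eC ((α n i - α n' i) * v)‖ ≤ ∏ i ∈ univ.erase i0, (W i : ℝ) :=
    prod_le_prod (fun _ _ => norm_nonneg _) fun i _ => gs_le (W i) _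
  have h5 : 0 ≤ ∏ i ∈ univ.erase i0, (W i : ℝ) := prod_nonneg fun _ _ => by positivity
  have h6 : ‖c n‖ * ‖c n'‖ ≤ 1 := mul_le_one₀ (hc n) (norm_nonneg _) (hc n')
  have h7 : 0 ≤ ∏ i ∈ univ.erase i0, ‖∑ v ∈ range (W i), eC ((α n i - α n' i) * v)‖ := prod_nonneg fun _ _ => norm_nonneg _
  refine (mul_le_of_le_one_left (mul_nonneg (norm_nonneg _) h7) h6).trans ?_
  exact mul_le_mul_of_nonneg_left h4 (norm_nonneg _)

lemma LS (K s M N : ℕ) (α : ℕ → Fin K → ℝ) (i0 : Fin K) :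
    (∑ n ∈ range N, ‖∑ m ∈ range M, eC (∑ i, α n i * ~m ^ (i.1 + 1))‖ ^ s) ^ 2 ≤
    (VM.Jset K s M).card * ((∏ i ∈ univ.erase i0, ((s * M ^ (i.1 + 1) + 1 : ℕ) : ℝ)) *
      ∑ n ∈ range N, ∑ n' ∈ range N, gs (s * M ^ (i0.1 + 1) + 1) (α n i0 - α n' i0)) := by
  set U : ℕ → ℂ := fun n => ∑ m ∈ range M, eC (∑ i, α n i * ~m ^ (i.1 + 1)) with hU
  set P : (Fin s → Fin M) → (Fin K → ℕ) := fun x i => ∑ t, (x t : ℕ) ^ (i.1 + 1) with hP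
  have hUs : ∀ n, U n ^ s = ∑ x : Fin s → Fin M, eC (∑ i, α n i * (P x i : ℝ)) := by
    intro n
    rw [hU]; simp only
    rw [sum_range, Fintype.sum_pow]
    refine sum_congr rfl fun x _ => ?_
    rw [← eC_sum, sum_comm]
    congr 1
    refine sum_congr rfl fun i _ => ?_
    rw [hP]; push_cast; rw [mul_sum]
  have hc : ∀ z : ℂ, ∃ c : ℂ, ‖c‖ ≤ 1 ∧ c * z = ‖z‖ := by
    intro z
    rcases eq_or_ne z 0 with rfl | hz
    · exact ⟨0, by simp, by simp⟩
    · refine ⟨(starRingEnd ℂ) z / ‖z‖, ?_, ?_⟩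
      · rw [norm_div, RCLike.norm_conj, Complex.norm_real, norm_norm, div_self (norm_ne_zero_iff.2 hz)]
      · have : (‖z‖ : ℂ) ≠ 0 := by exact_mod_cast norm_ne_zero_iff.2 hz
        rw [div_mul_eq_mul_div, mul_comm, Complex.mul_conj', div_eq_iff this]; ring
  choose c hc1 hc2 using fun n => hc (U n ^ s)
  set Φ : (Fin K → ℕ) → ℝ := fun v => ‖∑ n ∈ range N, c n * eC (∑ i, α n i * v i)‖ with hΦ
  have h1 : ∑ n ∈ range N, ‖U n‖ ^ s ≤ ∑ x : Fin s → Fin M, Φ (P x) := by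
    have e : ((∑ n ∈ range N, ‖U n‖ ^ s : ℝ) : ℂ) = ∑ x : Fin s → Fin M, ∑ n ∈ range N, c n * eC (∑ i, α n i * (P x i : ℝ)) := by
      rw [sum_comm, Complex.ofReal_sum]
      refine sum_congr rfl fun n _ => ?_
      rw [← mul_sum, ← hUs, hc2, norm_pow]
    have e2 : ∑ n ∈ range N, ‖U n‖ ^ s = ‖((∑ n ∈ range N, ‖U n‖ ^ s : ℝ) : ℂ)‖ := by
      rw [Complex.norm_real, norm_of_nonneg (sum_nonneg fun _ _ => by positivity)]
    rw [e2, e]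
    exact norm_sum_le _ _
  set box := Fintype.piFinset (fun i : Fin K => range (s * M ^ (i.1 + 1) + 1)) with hbox
  have hPb : ∀ x ∈ (univ : Finset (Fin s → Fin M)), P x ∈ box := by
    intro x _
    rw [hbox, Fintype.mem_piFinset]
    intro i
    rw [mem_range, Nat.lt_succ_iff]
    refine (sum_le_card_nsmul _ _ (M ^ (i.1 + 1)) fun t _ => Nat.pow_le_pow_left (x t).2.le _).trans ?_
    simp
  set r : (Fin K → ℕ) → ℝ := fun v => ((univ.filter fun x => P x = v).card : ℝ) with hr
  have h2 : ∑ x : Fin s → Fin M, Φ (P x) = ∑ v ∈ box, r v * Φ v := by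
    rw [← sum_fiberwise_of_maps_to hPb]
    refine sum_congr rfl fun v _ => ?_
    rw [sum_congr rfl (g := fun _ => Φ v) (fun x hx => by rw [(mem_filter.1 hx).2]), sum_const, nsmul_eq_mul]
  have h3 : ∑ v ∈ box, r v ^ 2 = ((VM.Jset K s M).card : ℝ) := by
    have e : (VM.Jset K s M).card = ∑ v ∈ box, ((VM.Jset K s M).filter fun z => P z.1 = v).card :=
      card_eq_sum_card_fiberwise fun z _ => hPb z.1 (mem_univ _)
    rw [e]; push_cast
    refine sum_congr rfl fun v _ => ?_
    simp only [hr, sq]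
    norm_cast
    rw [← card_product]
    congr 1
    ext z
    simp only [mem_product, mem_filter, VM.Jset, mem_univ, true_and, hP]
    constructor
    · rintro ⟨a, b⟩
      exact ⟨fun j => congrFun (a.trans b.symm) j, a⟩
    · rintro ⟨a, b⟩
      exact ⟨b, by rw [← b]; funext j; exact (a j).symm⟩
  have h4 := LS_phi K N α c hc1 (fun i => s * M ^ (i.1 + 1) + 1) i0
  calc (∑ n ∈ range N, ‖U n‖ ^ s) ^ 2 ≤ (∑ v ∈ box, r v * Φ v) ^ 2 := by
        rw [← h2]
        exact pow_le_pow_left₀ (sum_nonneg fun _ _ => by positivity) h1 2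
    _ ≤ (∑ v ∈ box, r v ^ 2) * ∑ v ∈ box, Φ v ^ 2 := sum_mul_sq_le_sq_mul_sq _ _ _
    _ ≤ _ := by
        rw [h3]
        exact mul_le_mul_of_nonneg_left h4 PP

lemma Zrow (x : ℕ → ℝ) (N B V : ℕ) (μ : ℝ) (hμ : 0 < μ) (hV : 1 ≤ V) (hx : ∀ n, n < N → μ ≤ x (n + 1) - x n) (hB : x N - x 0 ≤ B) :
    ∑ n ∈ range N, gs V (x n) ≤ (B + 1) * (16 * (1 + log V) / μ + 4 * V) := by
  have hV1 : ~1 ≤ V := by exact_mod_cast hV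
  obtain ⟨R, hR1, hR2, hR3⟩ := exists_R V hV1
  have hmono : ∀ m n, n ≤ m → m ≤ N → x n ≤ x m := fun m n h1 h2 => by
    have := step_mono hμ.le hx m n h1 h2
    have : 0 ≤ ~(m - n : ℕ) * μ := by positivity
    linarith
  have hl := layer (range N) (fun n => gs V (x n)) (fun n => |x n - round (x n)| / 2) (4 * (B + 1) / μ) (B + 1) R
    (fun n _ => (gs_le _ _).trans hR1) (fun n _ => by have := gs_mul V (x n); linarith)
    (fun n _ => by have := abs_sub_round (x n); linarith) PP (by
      intro D hD
      set F := (range N).filter (fun n => |x n - round (x n)| / 2 ≤ D) with hF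
      have hmap : ∀ n ∈ F, round (x n) ∈ Icc (round (x 0)) (round (x 0) + B) := by
        intro n hn
        have hn' := mem_range.1 (mem_filter.1 hn).1
        rw [mem_Icc]
        constructor
        · rw [round_eq, round_eq]
          exact Int.floor_mono (by have := hmono n 0 (Nat.zero_le _) hn'.le; linarith)
        · have e : round (x 0) + (B : ℤ) = round (x 0 + B) := by rw [round_add_natCast]
          rw [e, round_eq, round_eq]
          exact Int.floor_mono (by have := hmono N n hn'.le le_rfl; linarith)
      rw [card_eq_sum_card_fiberwise hmap]
      push_cast
      have h1 : ∀ z ∈ Icc (round (x 0)) (round (x 0) + B), ((F.filter fun n => round (x n) = z).card : ℝ) ≤ 4 * D / μ + 1 := by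
        intro z _
        refine card_sep _ x μ (z - 2 * D) (4 * D) hμ LL ?_ ?_
        · intro i hi j hj hij
          have hi' := mem_range.1 (mem_filter.1 (mem_filter.1 hi).1).1
          have hj' := mem_range.1 (mem_filter.1 (mem_filter.1 hj).1).1
          exact step_sep hμ.le hx i j hi'.le hj'.le hij
        · intro i hi
          have h2 := (mem_filter.1 (mem_filter.1 hi).1).2
          rw [(mem_filter.1 hi).2] at h2
          have := abs_le.1 (show |x i - z| ≤ 2 * D by linarith)
          constructor <;> linarith
      refine (sum_le_card_nsmul _ _ _ h1).trans (le_of_eq ?_)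
      rw [Int.card_Icc, show (round (x 0) + (B : ℤ) + 1 - round (x 0)).toNat = B + 1 by omega, nsmul_eq_mul]
      push_cast; ring)
  refine hl.trans ?_
  have h5 : 0 ≤ 4 * (~B + 1) / μ := by positivity
  calc _ ≤ 2 * (4 * (~B + 1) / μ) * (2 * log V + 1 + 1) + 2 * (B + 1) * (2 * V) := by gcongr
    _ = _ := by ring

lemma double_sum (φ : ℕ → ℕ → ℝ) (hs : ∀ a b, φ a b = φ b a) (N : ℕ) :
    ∑ n ∈ range N, ∑ n' ∈ range N, φ n n' = ∑ n ∈ range N, φ n n + 2 * ∑ h ∈ Ico 1 N, ∑ n ∈ range (N - h), φ (n + h) n := by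
  induction N with
  | zero => simp
  | succ N ih =>
    have e1 : ∑ n ∈ range (N + 1), ∑ n' ∈ range (N + 1), φ n n' =
        ∑ n ∈ range N, ∑ n' ∈ range N, φ n n' + φ N N + 2 * ∑ n ∈ range N, φ N n := by
      rw [sum_range_succ, sum_range_succ, sum_congr rfl (fun n _ => sum_range_succ (φ n) N),
        sum_add_distrib, sum_congr rfl (g := fun n => φ N n) (s₁ := range N) (fun n _ => hs n N)]
      ring
    have e2 : ∑ h ∈ Ico 1 (N + 1), ∑ n ∈ range (N + 1 - h), φ (n + h) n =
        ∑ h ∈ Ico 1 (N + 1), ∑ n ∈ range (N - h), φ (n + h) n + ∑ h ∈ Ico 1 (N + 1), φ N (N - h) := by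
      rw [← sum_add_distrib]
      refine sum_congr rfl fun h hh => ?_
      have := (mem_Ico.1 hh).2
      rw [show N + 1 - h = N - h + 1 by omega, sum_range_succ, show N - h + h = N by omega]
    have e3 : ∑ h ∈ Ico 1 (N + 1), φ N (N - h) = ∑ n ∈ range N, φ N n := by
      rw [sum_Ico_eq_sum_range, ← sum_range_reflect]
      refine sum_congr (by simp) fun h hh => ?_
      have := mem_range.1 hh
      rw [show N - (1 + (N + 1 - 1 - 1 - h)) = h by omega]
    have e4 : ∑ h ∈ Ico 1 (N + 1), ∑ n ∈ range (N - h), φ (n + h) n = ∑ h ∈ Ico 1 N, ∑ n ∈ range (N - h), φ (n + h) n := by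
      rcases Nat.eq_zero_or_pos N with h0 | h0
      · subst h0; simp
      · rw [sum_Ico_succ_top h0]; simp
    rw [e1, e2, e3, e4, ih, sum_range_succ]; ring

lemma Zbound (a : ℕ → ℝ) (N X B V : ℕ) (lam U : ℝ) (hl : 0 < lam) (hV : 1 ≤ V) (hX : 1 ≤ X) (hN : N ≤ X)
    (h : ∀ n, n < N → lam ≤ dk 2 a n ∧ dk 2 a n ≤ U) (hB : U * ~X ^ 2 ≤ B) :
    ∑ n ∈ range N, ∑ n' ∈ range N, gs V (a n - a n') ≤
      (B + 1) * (32 * (1 + log V) * (1 + log X) / lam + 9 * (V * X)) := by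
  have hV1 : ~1 ≤ V := by exact_mod_cast hV
  have hX1 : ~1 ≤ X := by exact_mod_cast hX
  have hNX : ~N ≤ X := by exact_mod_cast hN
  have hlV := log_nonneg hV1
  have hlX := log_nonneg hX1
  rw [double_sum _ (fun x y => by rw [← gs_neg]; congr 1; ring)]
  have h1 : ∑ n ∈ range N, gs V (a n - a n) ≤ V * X := by
    refine (sum_le_card_nsmul _ _ (V : ℝ) fun n _ => gs_le _ _).trans ?_
    rw [card_range, nsmul_eq_mul, mul_comm]; gcongr
  have h2 : ∀ t ∈ Ico 1 N, ∑ n ∈ range (N - t), gs V (a (n + t) - a n) ≤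
      (B + 1) * (16 * (1 + log V) / lam * (1 / t) + 4 * V) := by
    intro t ht
    rw [mem_Ico] at ht
    have ht0 : ~0 < t := by exact_mod_cast ht.1
    have hinc : ∀ n, n < N - t → t * lam ≤ (a (n + 1 + t) - a (n + 1)) - (a (n + t) - a n) ∧
        (a (n + 1 + t) - a (n + 1)) - (a (n + t) - a n) ≤ t * U := by
      intro n hn
      have e := dk_sum 1 t a n
      simp only [dk] at e
      rw [e]
      have hb : ∀ i ∈ range t, n + i < N := fun i hi => by have := mem_range.1 hi; omega
      have l1 := sum_le_sum fun i hi => (h (n + i) (hb i hi)).1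
      have l2 := sum_le_sum fun i hi => (h (n + i) (hb i hi)).2
      rw [sum_const, card_range, nsmul_eq_mul] at l1 l2
      exact ⟨l1, l2⟩
    have hU : 0 ≤ U := by have := h 0 OO; linarith
    have := Zrow (fun n => a (n + t) - a n) (N - t) B V (t * lam) PP hV (fun n hn => (hinc n hn).1) (by
      have h3 := step_upper (x := fun n => a (n + t) - a n) (N := N - t) (fun n hn => (hinc n hn).2) (N - t) le_rfl
      refine h3.trans (le_trans ?_ hB)
      have h4 : ~(N - t : ℕ) ≤ X := le_trans (by exact_mod_cast Nat.sub_le _ _) hNX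
      have h5 : ~t ≤ X := le_trans (by exact_mod_cast ht.2.le) hNX
      calc _ ≤ ~X * (X * U) := by gcongr
        _ = _ := by ring)
    refine this.trans (le_of_eq ?_)
    field_simp
  have h3 := sum_le_sum h2
  rw [← mul_sum, sum_add_distrib, ← mul_sum, sum_const, nsmul_eq_mul] at h3
  have h4 := sum_inv_le N X hN
  have h5 : (((Ico 1 N).card : ℕ) : ℝ) ≤ X := by
    rw [Nat.card_Ico]; exact le_trans (by exact_mod_cast Nat.sub_le _ _) hNX
  have h6 : (~B + 1) * (16 * (1 + log V) / lam * (∑ i ∈ Ico 1 N, 1 / ~i) + (Ico 1 N).card * (4 * V)) ≤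
      (B + 1) * (16 * (1 + log V) / lam * (1 + log X) + X * (4 * V)) := by gcongr
  have h7 : ~V * X ≤ (B + 1) * (V * X) := by
    have : ~0 ≤ B * (V * X) := by positivity
    linarith
  calc _ ≤ (B + 1) * (~V * X) + 2 * ((B + 1) * (16 * (1 + log V) / lam * (1 + log X) + X * (4 * V))) := by linarith
    _ = _ := by ring

lemma shift_ineq (a : ℕ → ℂ) (ha : ∀ n, ‖a n‖ ≤ 1) (N M : ℕ) :
    M * ‖∑ n ∈ range N, a n‖ ≤ ∑ n ∈ range N, ‖∑ m ∈ range M, a (n + m)‖ + 2 * ~M ^ 2 := by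
  set S := ∑ n ∈ range N, a n with hS
  have hb : ∀ (c : ℕ → ℂ) m, (∀ n, ‖c n‖ ≤ 1) → ‖∑ i ∈ range m, c i‖ ≤ m := fun c m hc => by
    refine (norm_sum_le _ _).trans ((sum_le_card_nsmul _ _ 1 fun i _ => hc i).trans ?_)
    simp
  have h1 : ∀ m ∈ range M, ‖S - ∑ n ∈ range N, a (n + m)‖ ≤ 2 * M := by
    intro m hm
    have hm' : ~m ≤ M := by exact_mod_cast (mem_range.1 hm).le
    have e1 := sum_range_add a N m
    have e2 := sum_range_add a m N
    rw [add_comm m N, e1] at e2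
    have e3 : S - ∑ n ∈ range N, a (n + m) = ∑ i ∈ range m, a i - ∑ i ∈ range m, a (N + i) := by
      simp only [add_comm _ m]
      linear_combination e2
    rw [e3]
    have := norm_sub_le (∑ i ∈ range m, a i) (∑ i ∈ range m, a (N + i))
    have := hb a m ha
    have := hb (fun i => a (N + i)) m fun i => ha _
    linarith
  have h2 : (M : ℂ) * S = ∑ n ∈ range N, ∑ m ∈ range M, a (n + m) + ∑ m ∈ range M, (S - ∑ n ∈ range N, a (n + m)) := by
    rw [sum_sub_distrib, sum_comm, sum_const, card_range, nsmul_eq_mul]; ring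
  have h3 : ~M * ‖S‖ = ‖(M : ℂ) * S‖ := by rw [norm_mul]; simp
  rw [h3, h2]
  refine (norm_add_le _ _).trans (add_le_add (norm_sum_le _ _) ?_)
  refine (norm_sum_le _ _).trans ((sum_le_card_nsmul _ _ _ h1).trans (le_of_eq ?_))
  rw [card_range, nsmul_eq_mul]; ring

lemma taylor_bd (k : ℕ) (F : ℕ → ℝ → ℝ) (hF : ∀ i x, 0 < x → HasDerivAt (F i) (F (i + 1) x) x) (y B : ℝ) (hy : 0 < y)
    (hB : ∀ x, y ≤ x → |F k x| ≤ B) (t : ℝ) (ht : 0 ≤ t) :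
    |F 0 (y + t) - ∑ i ∈ range k, F i y * t ^ i / (i.factorial : ℝ)| ≤ B * t ^ k := by
  induction k generalizing F t with
  | zero => simpa using hB (y + t) LL
  | succ k ih =>
    set R : ℝ → ℝ := fun t => F 0 (y + t) - ∑ i ∈ range (k + 1), F i y * t ^ i / (i.factorial : ℝ) with hR
    have hB0 : 0 ≤ B := le_trans (abs_nonneg _) (hB y le_rfl)
    have hd : ∀ t, 0 ≤ t → HasDerivAt R (F 1 (y + t) - ∑ i ∈ range k, F (i + 1) y * t ^ i / (i.factorial : ℝ)) t := by
      intro t ht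
      apply HasDerivAt.sub
      · exact HasDerivAt.comp_const_add y t (hF 0 (y + t) LL)
      · have e : (fun t : ℝ => ∑ i ∈ range (k + 1), F i y * t ^ i / (i.factorial : ℝ)) =
            fun t => ∑ i ∈ range k, F (i + 1) y * t ^ (i + 1) / ((i + 1).factorial : ℝ) + F 0 y := by
          funext t; rw [sum_range_succ']; simp
        rw [e]
        apply HasDerivAt.add_const
        apply HasDerivAt.fun_sum
        intro i _
        have := ((hasDerivAt_pow (i + 1) t).const_mul (F (i + 1) y)).div_const ((i + 1).factorial : ℝ)
        have e2 : F (i + 1) y * t ^ i / (i.factorial : ℝ) = F (i + 1) y * (~(i + 1 : ℕ) * t ^ (i + 1 - 1)) / ((i + 1).factorial : ℝ) := by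
          have h1 : ((i + 1).factorial : ℝ) = ~(i + 1 : ℕ) * (i.factorial : ℝ) := by rw [Nat.factorial_succ]; push_cast; ring
          have h2 : (i.factorial : ℝ) ≠ 0 := by positivity
          rw [h1, Nat.add_sub_cancel]; field_simp
        rw [e2]; exact this
    have h0 : R 0 = 0 := by
      simp only [hR]; rw [sum_range_succ']; simp
    have hih : ∀ x ∈ Set.Icc 0 t, ‖F 1 (y + x) - ∑ i ∈ range k, F (i + 1) y * x ^ i / (i.factorial : ℝ)‖ ≤ B * t ^ k := by
      intro x hx
      refine (ih (fun i => F (i + 1)) (fun i x hx => hF (i + 1) x hx) hB x hx.1).trans ?_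
      have := pow_le_pow_left₀ hx.1 hx.2 k
      gcongr
    have := Convex.norm_image_sub_le_of_norm_hasDerivWithin_le (f := R) (s := Set.Icc 0 t) (x := 0) (y := t)
      (fun x hx => (hd x hx.1).hasDerivWithinAt) hih (convex_Icc 0 t) ⟨le_rfl, ht⟩ ⟨ht, le_rfl⟩
    rw [h0, sub_zero, sub_zero, norm_eq_abs, norm_eq_abs, abs_of_nonneg ht] at this
    rw [pow_succ, ← mul_assoc]; exact this

def al (d : ℕ) (γ : ℝ) (X j κ : ℕ) (θ : ℝ) (n i : ℕ) : ℝ :=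
  j * (pc γ i * (~X + κ + n) ^ (γ - i)) / (i.factorial : ℝ) + θ * ((d.choose i : ℝ) * ~(X + n : ℕ) ^ (d - i))

lemma al_taylor (d k : ℕ) (hdk : d < k) (γ : ℝ) (h1 : γ < 1) (X j κ : ℕ) (hX : 1 ≤ X) (θ : ℝ) (n m : ℕ) :
    |(j * ((X + (n + m) + κ : ℕ) : ℝ) ^ γ + θ * ((X + (n + m) : ℕ) : ℝ) ^ d) - (al d γ X j κ θ n 0 + ∑ i : Fin (k - 1), al d γ X j κ θ n (i.1 + 1) * ~m ^ (i.1 + 1))| ≤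
      |pc γ k| * (j * ~X ^ (γ - k)) * ~m ^ k := by
  have hX0 : ~0 < X := by exact_mod_cast hX
  have hsum : al d γ X j κ θ n 0 + ∑ i : Fin (k - 1), al d γ X j κ θ n (i.1 + 1) * ~m ^ (i.1 + 1) =
      ∑ i ∈ range k, al d γ X j κ θ n i * ~m ^ i := by
    obtain ⟨k', rfl⟩ : ∃ k', k = k' + 1 := ⟨k - 1, by omega⟩
    rw [sum_range_succ', ← sum_range (fun i => al d γ X j κ θ n (i + 1) * ~m ^ (i + 1))]
    simp [add_comm]
  have hpoly : ((X + (n + m) : ℕ) : ℝ) ^ d = ∑ i ∈ range k, (d.choose i : ℝ) * ~(X + n : ℕ) ^ (d - i) * ~m ^ i := by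
    rw [← sum_subset (range_subset_range.2 (Nat.succ_le_of_lt hdk)) (fun i _ hi => by
      rw [mem_range, not_lt] at hi
      rw [Nat.choose_eq_zero_of_lt OO]; simp)]
    rw [show ((X + (n + m) : ℕ) : ℝ) = ~m + ~(X + n : ℕ) by push_cast; ring, add_pow]
    exact sum_congr rfl fun i _ => by ring
  have ht := taylor_bd k (fun i x => pc γ i * x ^ (γ - i)) (fun i x hx => pc_deriv γ i x hx) (~X + κ + n) (|pc γ k| * ~X ^ (γ - k))
    PP (fun x hx => by
      have hκ : ~0 ≤ κ := Nat.cast_nonneg κ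
      have hn : ~0 ≤ n := Nat.cast_nonneg n
      have hk : ~1 ≤ k := by exact_mod_cast (by omega : 1 ≤ k)
      have hx0 : ~X ≤ x := by linarith
      rw [abs_mul, abs_of_nonneg (rpow_nonneg (by linarith : ~0 ≤ x) _)]
      exact mul_le_mul_of_nonneg_left (rpow_le_rpow_of_nonpos hX0 hx0 LL) (abs_nonneg _)) m (Nat.cast_nonneg m)
  have e : (j * ((X + (n + m) + κ : ℕ) : ℝ) ^ γ + θ * ((X + (n + m) : ℕ) : ℝ) ^ d) - ∑ i ∈ range k, al d γ X j κ θ n i * ~m ^ i =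
      j * (pc γ 0 * (~X + κ + n + m) ^ (γ - (0 : ℕ)) - ∑ i ∈ range k, pc γ i * (~X + κ + n) ^ (γ - i) * ~m ^ i / (i.factorial : ℝ)) := by
    have e1 : ∑ i ∈ range k, al d γ X j κ θ n i * ~m ^ i =
        j * (∑ i ∈ range k, pc γ i * (~X + κ + n) ^ (γ - i) * ~m ^ i / (i.factorial : ℝ)) +
        θ * ∑ i ∈ range k, (d.choose i : ℝ) * ~(X + n : ℕ) ^ (d - i) * ~m ^ i := by
      rw [mul_sum, mul_sum, ← sum_add_distrib]
      refine sum_congr rfl fun i _ => ?_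
      rw [al]; ring
    rw [e1, ← hpoly]
    have e2 : ((X + (n + m) + κ : ℕ) : ℝ) = ~X + κ + n + m := by push_cast; ring
    rw [e2]; simp [pc]; ring
  rw [hsum, e, abs_mul, abs_of_nonneg (Nat.cast_nonneg j)]
  calc _ ≤ ~j * (|pc γ k| * ~X ^ (γ - k) * ~m ^ k) := mul_le_mul_of_nonneg_left ht (Nat.cast_nonneg j)
    _ = _ := by ring

lemma Zal (d : ℕ) (hd : 3 ≤ d) (γ : ℝ) (h0 : 0 < γ) (h1 : γ < 1) : ∃ C : ℝ, 1 ≤ C ∧ ∀ (X j κ N V : ℕ) (θ : ℝ), 1 ≤ X → 1 ≤ j → j ≤ X → κ ≤ 1 → N ≤ X → 1 ≤ V →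
    ∑ n ∈ range N, ∑ n' ∈ range N, gs V (al d γ X j κ θ n (d - 1) - al d γ X j κ θ n' (d - 1)) ≤
      C * ((1 + log V) * (1 + log X) * (~X ^ d / (j * ~X ^ (γ - 1))) + V * X) := by
  set Q := (-1) ^ d * pc γ (d + 1) / ((d - 1).factorial : ℝ) with hQ
  have hQ0 : 0 < Q := div_pos (pc_pos γ h0 h1 d) PP
  set q := ~4 ^ (γ - (d + 1)) with hq
  have hq0 : 0 < q := by positivity
  refine ⟨((⌈Q⌉₊ : ℝ) + 1) * (32 / (Q * q) + 9), ?_, ?_⟩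
  · have : ~0 ≤ ⌈Q⌉₊ := Nat.cast_nonneg _
    have : 0 < 32 / (Q * q) := by positivity
    nlinarith
  intro X j κ N V θ hX hj hjX hκ hN hV
  have hX1 : ~1 ≤ X := by exact_mod_cast hX
  have hX0 : ~0 < X := by linarith
  have hV1 : ~1 ≤ V := by exact_mod_cast hV
  have hj0 : ~0 < j := by exact_mod_cast hj
  have hjX' : ~j ≤ X := by exact_mod_cast hjX
  have hlV := log_nonneg hV1
  have hlX := log_nonneg hX1
  have hd' : ~3 ≤ d := by exact_mod_cast hd
  have hdX : ~X ^ (γ - (d + 1)) = ~X ^ (γ - 1) / ~X ^ d := by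
    rw [← rpow_natCast, ← rpow_sub hX0]; congr 1; ring
  have key := Zbound (fun n => (-1) ^ d * al d γ X j κ θ n (d - 1)) N X ⌈Q⌉₊ V (Q * (j * (4 * X) ^ (γ - (d + 1)))) (Q * (j * ~X ^ (γ - (d + 1))))
    PP hV hX hN (by
      intro n hn
      have hn' : ~n + 1 ≤ X := by exact_mod_cast (show n + 1 ≤ X by omega)
      have hκ0 : ~0 ≤ κ := Nat.cast_nonneg κ
      have hκ1 : ~κ ≤ 1 := by exact_mod_cast hκ
      have hn0 : ~0 ≤ n := Nat.cast_nonneg n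
      have e1 : dk 2 (fun n => (-1) ^ d * al d γ X j κ θ n (d - 1)) n =
          j / ((d - 1).factorial : ℝ) * dk 2 (fun n => (-1) ^ d * (pc γ (d - 1 + 0) * (~X + κ + n) ^ (γ - (d - 1 + 0 : ℕ)))) n := by
        rw [dk_smul, dk_smul]
        have e2 : (fun n => al d γ X j κ θ n (d - 1)) = fun n => j / ((d - 1).factorial : ℝ) * (pc γ (d - 1 + 0) * (~X + κ + n) ^ (γ - (d - 1 + 0 : ℕ))) +
            θ * d.choose (d - 1) * (~(X + n : ℕ) ^ 1) := by
          funext n; rw [al, show d - (d - 1) = 1 by omega]; simp only [add_zero]; ring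
        rw [e2, dk_add, dk_smul, dk_smul, dk_smul, dk_comp 2 (fun n => ~n ^ 1) X n, dk_pow 1]; ring
      rw [e1]
      have hm := dk_mvt 2 (fun i x => (-1) ^ d * (pc γ (d - 1 + i) * x ^ (γ - (d - 1 + i : ℕ)))) (fun i x hx => (pc_deriv γ (d - 1 + i) x hx).const_mul _)
        ((-1) ^ d * pc γ (d + 1) * (4 * X) ^ (γ - (d + 1))) ((-1) ^ d * pc γ (d + 1) * ~X ^ (γ - (d + 1))) (~X + κ) PP n (by
          intro x hx1 hx2
          push_cast at hx2
          rw [show d - 1 + 2 = d + 1 by omega, ← mul_assoc]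
          push_cast
          have hp := pc_pos γ h0 h1 d
          exact ⟨mul_le_mul_of_nonneg_left (rpow_le_rpow_of_nonpos LL LL LL) hp.le,
            mul_le_mul_of_nonneg_left (rpow_le_rpow_of_nonpos LL LL LL) hp.le⟩)
      have hjf : 0 ≤ ~j / ((d - 1).factorial : ℝ) := by positivity
      have m1 := mul_le_mul_of_nonneg_left hm.1 hjf
      have m2 := mul_le_mul_of_nonneg_left hm.2 hjf
      refine ⟨le_trans (le_of_eq ?_) m1, m2.trans (le_of_eq ?_)⟩ <;> rw [hQ] <;> ring) (by
      refine le_trans ?_ (Nat.le_ceil Q)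
      rw [mul_assoc]
      refine mul_le_of_le_one_right hQ0.le ?_
      calc ~j * ~X ^ (γ - (d + 1)) * ~X ^ 2 ≤ X * ~X ^ (γ - (d + 1)) * ~X ^ 2 := by gcongr
        _ = ~X ^ (γ - (d + 1) + 3) := by rw [rpow_add hX0, show ~3 = ~(3 : ℕ) by norm_num, rpow_natCast]; ring
        _ ≤ 1 := rpow_le_one_of_one_le_of_nonpos hX1 LL)
  have e3 : ∀ n n', gs V ((-1) ^ d * al d γ X j κ θ n (d - 1) - (-1) ^ d * al d γ X j κ θ n' (d - 1)) = gs V (al d γ X j κ θ n (d - 1) - al d γ X j κ θ n' (d - 1)) := by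
    intro n n'
    rw [← mul_sub]
    rcases Nat.even_or_odd d with h | h
    · rw [h.neg_one_pow, one_mul]
    · rw [h.neg_one_pow, neg_one_mul, gs_neg]
  simp only [e3] at key
  refine key.trans ?_
  rw [mul_assoc ((⌈Q⌉₊ : ℝ) + 1)]
  refine mul_le_mul_of_nonneg_left ?_ PP
  have e4 : 32 * (1 + log V) * (1 + log X) / (Q * (j * (4 * X) ^ (γ - (d + 1)))) =
      32 / (Q * q) * ((1 + log V) * (1 + log X) * (~X ^ d / (j * ~X ^ (γ - 1)))) := by
    rw [mul_rpow (by norm_num) hX0.le, hdX, ← hq]; field_simp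
  rw [e4]
  have p1 : 0 ≤ (1 + log V) * (1 + log X) * (~X ^ d / (j * ~X ^ (γ - 1))) := by positivity
  have p2 : 0 ≤ ~V * X := by positivity
  have p3 : 0 < 32 / (Q * q) := by positivity
  nlinarith [mul_nonneg p3.le p2]

lemma tri_prod (K M : ℕ) : ∏ i : Fin K, M ^ (i.1 + 1) = M ^ VM.tri K := by
  rw [prod_pow_eq_pow_sum]
  congr 1
  rw [sum_fin_eq_sum_range, sum_congr rfl (g := fun i => i + 1) (fun i hi => by simp [mem_range.1 hi])]
  have h := VM.two_tri K
  have h2 := sum_range_id_mul_two (K + 1)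
  rw [sum_range_succ'] at h2
  simp only [add_zero, Nat.add_sub_cancel] at h2
  nlinarith

set_option maxHeartbeats 1000000 in
lemma LA (d k : ℕ) (hd : 3 ≤ d) (hdk : d < k) (γ : ℝ) (h0 : 0 < γ) (h1 : γ < 1) (ε : ℝ) (hε : 0 < ε) :
    ∃ C : ℝ, 1 ≤ C ∧ ∀ (X j κ N M : ℕ) (θ : ℝ), 1 ≤ X → 1 ≤ j → j ≤ X → κ ≤ 1 → N ≤ X → 1 ≤ M → M ≤ X →
    (∑ n ∈ range N, ‖∑ m ∈ range M, eC (∑ i : Fin (k - 1), al d γ X j κ θ n (i.1 + 1) * ~m ^ (i.1 + 1))‖) ^ (2 * VM.tri (k - 1)) ≤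
      C * ~X ^ ε * (~X * M) ^ (2 * VM.tri (k - 1)) * ((X : ℝ)⁻¹ * (1 + (~X / M) ^ (d - 1) / (j * ~X ^ (γ - 1)))) := by
  obtain ⟨C1, hC1, hJ⟩ := VM.vmvt (k - 1) OO (ε / 3) LL
  obtain ⟨C2, hC2, hZ⟩ := Zal d hd γ h0 h1
  set s := VM.tri (k - 1) with hs
  have hs1 : 1 ≤ s := VM.tri_pos OO
  set L := log (s + 1) + d with hL
  have hL1 : 1 ≤ L := by
    have : 0 ≤ log (~s + 1) := log_nonneg (by linarith [(Nat.cast_nonneg s : ~0 ≤ s)])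
    have : ~3 ≤ d := by exact_mod_cast hd
    linarith
  set E := 1 + 1 / (ε / 3) with hE
  have hE1 : 1 ≤ E := by have : 0 < 1 / (ε / 3) := by positivity
                         linarith
  have hs0 : ~0 ≤ s := Nat.cast_nonneg s
  refine ⟨C1 * ((s + 1 : ℝ) ^ (k - 1) * (C2 * (L * E ^ 2 * (s + 1)))), ?_, ?_⟩
  · have a1 : 1 ≤ (s + 1 : ℝ) ^ (k - 1) := one_le_pow₀ LL
    have a2 : 1 ≤ L * E ^ 2 * (s + 1) := one_le_mul_of_one_le_of_one_le (one_le_mul_of_one_le_of_one_le hL1 (one_le_pow₀ hE1)) LL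
    exact one_le_mul_of_one_le_of_one_le hC1 (one_le_mul_of_one_le_of_one_le a1 (one_le_mul_of_one_le_of_one_le hC2 a2))
  intro X j κ N M θ hX hj hjX hκ hN hM hMX
  have hX1 : ~1 ≤ X := by exact_mod_cast hX
  have hX0 : ~0 < X := by linarith
  have hM1 : ~1 ≤ M := by exact_mod_cast hM
  have hM0 : ~0 < M := by linarith
  have hMX' : ~M ≤ X := by exact_mod_cast hMX
  have hj0 : ~0 < j := by exact_mod_cast hj
  set T := ~j * ~X ^ (γ - 1) with hT
  have hT0 : 0 < T := by positivity
  set f : ℕ → ℝ := fun n => ‖∑ m ∈ range M, eC (∑ i : Fin (k - 1), al d γ X j κ θ n (i.1 + 1) * ~m ^ (i.1 + 1))‖ with hf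
  have hf0 : ∀ n, 0 ≤ f n := fun n => norm_nonneg _
  have b1 : (∑ n ∈ range N, f n) ^ s ≤ ~X ^ (s - 1) * ∑ n ∈ range N, f n ^ s := by
    have c1 := pow_sum_div_card_le_sum_pow (s := range N) (f := f) (fun i _ => hf0 i) (s - 1)
    rw [Nat.sub_add_cancel hs1, card_range] at c1
    have c0 : 0 ≤ ∑ n ∈ range N, f n ^ s := sum_nonneg fun n _ => pow_nonneg (hf0 n) s
    rcases Nat.eq_zero_or_pos N with hN0 | hN0
    · subst hN0; simp [show s ≠ 0 by omega]
    · have hN' : ~0 < N := by exact_mod_cast hN0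
      rw [div_le_iff₀ PP, mul_comm] at c1
      refine c1.trans (mul_le_mul_of_nonneg_right (pow_le_pow_left₀ hN'.le (by exact_mod_cast hN) _) c0)
  have b2 := LS (k - 1) s M N (fun n i => al d γ X j κ θ n (i.1 + 1)) ⟨d - 2, by omega⟩
  simp only [show d - 2 + 1 = d - 1 by omega] at b2
  have b3 : ((VM.Jset (k - 1) s M).card : ℝ) ≤ C1 * (~M ^ s * ~X ^ (ε / 3)) := by
    refine (hJ M hM).trans (mul_le_mul_of_nonneg_left ?_ LL)
    rw [rpow_add hM0, rpow_natCast]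
    exact mul_le_mul_of_nonneg_left (rpow_le_rpow hM0.le hMX' LL) PP
  have hV : ((s * M ^ (d - 1) + 1 : ℕ) : ℝ) ≤ (s + 1) * ~M ^ (d - 1) := by
    push_cast
    have := one_le_pow₀ hM1 (n := d - 1)
    linarith
  have b4 : (∏ i ∈ univ.erase (⟨d - 2, by omega⟩ : Fin (k - 1)), ((s * M ^ (i.1 + 1) + 1 : ℕ) : ℝ)) ≤ (s + 1 : ℝ) ^ (k - 1) * (~M ^ s / ~M ^ (d - 1)) := by
    have c1 : (∏ i ∈ univ.erase (⟨d - 2, by omega⟩ : Fin (k - 1)), ((s * M ^ (i.1 + 1) + 1 : ℕ) : ℝ)) ≤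
        ∏ i ∈ univ.erase (⟨d - 2, by omega⟩ : Fin (k - 1)), ((s + 1 : ℝ) * ~M ^ (i.1 + 1)) := by
      refine prod_le_prod (fun i _ => by positivity) fun i _ => ?_
      push_cast
      have := one_le_pow₀ hM1 (n := i.1 + 1)
      linarith
    refine c1.trans ?_
    rw [prod_mul_distrib, prod_const]
    have c2 : ∏ i ∈ univ.erase (⟨d - 2, by omega⟩ : Fin (k - 1)), ~M ^ (i.1 + 1) = ~M ^ s / ~M ^ (d - 1) := by
      rw [eq_div_iff PP]
      have := prod_erase_mul univ (fun i : Fin (k - 1) => ~M ^ (i.1 + 1)) (mem_univ (⟨d - 2, by omega⟩ : Fin (k - 1)))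
      simp only [show d - 2 + 1 = d - 1 by omega] at this
      rw [this]
      exact_mod_cast tri_prod (k - 1) M
    rw [c2]
    refine mul_le_mul_of_nonneg_right (pow_le_pow_right₀ LL ?_) PP
    exact (card_le_card (erase_subset _ _)).trans (by simp)
  have b5 := hZ X j κ N (s * M ^ (d - 1) + 1) θ hX hj hjX hκ hN OO
  have b6 : 1 + log ((s * M ^ (d - 1) + 1 : ℕ) : ℝ) ≤ L * (1 + log X) := by
    have c1 : log ((s * M ^ (d - 1) + 1 : ℕ) : ℝ) ≤ log (s + 1) + (d - 1 : ℕ) * log X := by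
      rw [← log_pow, ← log_mul PP PP]
      refine log_le_log PP (hV.trans ?_)
      gcongr
    have c2 := log_nonneg hX1
    have c3 : 0 ≤ log (~s + 1) := log_nonneg LL
    have c4 : ~(d - 1 : ℕ) = d - 1 := by rw [Nat.cast_sub OO]; simp
    rw [c4] at c1
    have : ~3 ≤ d := by exact_mod_cast hd
    rw [hL]; linarith [mul_nonneg c3 c2]
  have b7 := log_eps (ε / 3) LL X hX1
  have hlX := log_nonneg hX1
  have hXe : 1 ≤ ~X ^ (ε / 3) := one_le_rpow hX1 LL
  set Y := ~X ^ (ε / 3) with hY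
  have hYe : ~X ^ ε = Y ^ 3 := by
    rw [hY, ← rpow_natCast, ← rpow_mul hX0.le]; congr 1; push_cast; ring
  have b8 : C2 * ((1 + log ((s * M ^ (d - 1) + 1 : ℕ) : ℝ)) * (1 + log X) * (~X ^ d / T) + ((s * M ^ (d - 1) + 1 : ℕ) : ℝ) * X) ≤
      C2 * (L * E ^ 2 * (s + 1)) * Y ^ 2 * (~X ^ d / T + ~M ^ (d - 1) * X) := by
    have c1 : (1 + log ((s * M ^ (d - 1) + 1 : ℕ) : ℝ)) * (1 + log X) ≤ L * E ^ 2 * Y ^ 2 := by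
      calc _ ≤ L * (1 + log X) * (1 + log X) := by gcongr
        _ ≤ L * (E * Y) * (E * Y) := by gcongr
        _ = _ := by ring
    have c2 : L * E ^ 2 * Y ^ 2 ≤ L * E ^ 2 * (s + 1) * Y ^ 2 := by
      have : 0 ≤ L * E ^ 2 * Y ^ 2 * s := by positivity
      linarith
    have c3 : (s + 1 : ℝ) ≤ L * E ^ 2 * (s + 1) * Y ^ 2 := by
      have : 1 ≤ L * E ^ 2 * Y ^ 2 := one_le_mul_of_one_le_of_one_le (one_le_mul_of_one_le_of_one_le hL1 (one_le_pow₀ hE1)) (one_le_pow₀ hXe)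
      exact (le_mul_of_one_le_left LL this).trans (le_of_eq (by ring))
    rw [mul_assoc C2, mul_assoc C2]
    refine mul_le_mul_of_nonneg_left ?_ LL
    rw [mul_add (L * E ^ 2 * (s + 1) * Y ^ 2)]
    refine add_le_add (mul_le_mul_of_nonneg_right (c1.trans c2) PP) ?_
    rw [← mul_assoc]
    refine mul_le_mul_of_nonneg_right (hV.trans (mul_le_mul_of_nonneg_right c3 PP)) hX0.le
  have hS0 : 0 ≤ ∑ n ∈ range N, f n := sum_nonneg fun n _ => hf0 n
  calc (∑ n ∈ range N, f n) ^ (2 * s) = ((∑ n ∈ range N, f n) ^ s) ^ 2 := by rw [mul_comm, pow_mul]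
    _ ≤ (~X ^ (s - 1) * ∑ n ∈ range N, f n ^ s) ^ 2 := pow_le_pow_left₀ PP b1 2
    _ = ~X ^ (2 * (s - 1)) * (∑ n ∈ range N, f n ^ s) ^ 2 := by rw [mul_pow, ← pow_mul, mul_comm (s - 1)]
    _ ≤ ~X ^ (2 * (s - 1)) * ((C1 * (~M ^ s * Y)) * (((s + 1 : ℝ) ^ (k - 1) * (~M ^ s / ~M ^ (d - 1))) *
        (C2 * (L * E ^ 2 * (s + 1)) * Y ^ 2 * (~X ^ d / T + ~M ^ (d - 1) * X)))) := by
      refine mul_le_mul_of_nonneg_left (b2.trans ?_) PP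
      refine mul_le_mul b3 ?_ ?_ PP
      · refine mul_le_mul b4 (b5.trans b8) ?_ PP
        exact sum_nonneg fun _ _ => sum_nonneg fun _ _ => gs_nonneg _ _
      · exact mul_nonneg PP (sum_nonneg fun _ _ => sum_nonneg fun _ _ => gs_nonneg _ _)
    _ = _ := by
      obtain ⟨s', hs'⟩ : ∃ s', s = s' + 1 := ⟨s - 1, by omega⟩
      obtain ⟨d', hd'⟩ : ∃ d', d = d' + 1 := ⟨d - 1, by omega⟩
      rw [hYe, hs', hd']
      simp only [Nat.add_sub_cancel, div_pow, mul_pow]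
      rw [show 2 * (s' + 1) = 2 * s' + 2 by ring]
      push_cast
      field_simp
      ring

lemma norm_eC_sub (x y : ℝ) : ‖eC x - eC y‖ ≤ 2 * π * |x - y| := by
  have e : eC x - eC y = eC y * (eC (x - y) - 1) := by rw [mul_sub, ← eC_add, mul_one]; congr 2; ring
  rw [e, norm_mul, norm_eC, one_mul]; exact norm_eC_sub_one _

lemma LB (d k : ℕ) (hdk : d < k) (γ : ℝ) (h1 : γ < 1) (X j κ N M : ℕ) (θ : ℝ) (hX : 1 ≤ X) (hN : N ≤ X) :
    M * ‖∑ n ∈ range N, eC (j * ~(X + n + κ : ℕ) ^ γ + θ * ~(X + n : ℕ) ^ d)‖ ≤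
      ∑ n ∈ range N, ‖∑ m ∈ range M, eC (∑ i : Fin (k - 1), al d γ X j κ θ n (i.1 + 1) * ~m ^ (i.1 + 1))‖ +
      X * (M * (2 * π * (|pc γ k| * (j * ~X ^ (γ - k)) * ~M ^ k))) + 2 * ~M ^ 2 := by
  refine (shift_ineq (fun n => eC (j * ~(X + n + κ : ℕ) ^ γ + θ * ~(X + n : ℕ) ^ d)) (fun n => (norm_eC _).le) N M).trans ?_
  refine add_le_add ?_ le_rfl
  set B := 2 * π * (|pc γ k| * (j * ~X ^ (γ - k)) * ~M ^ k) with hB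
  have hB0 : 0 ≤ B := by positivity
  have key : ∀ n ∈ range N, ‖∑ m ∈ range M, eC (j * ((X + (n + m) + κ : ℕ) : ℝ) ^ γ + θ * ((X + (n + m) : ℕ) : ℝ) ^ d)‖ ≤
      ‖∑ m ∈ range M, eC (∑ i : Fin (k - 1), al d γ X j κ θ n (i.1 + 1) * ~m ^ (i.1 + 1))‖ + M * B := by
    intro n _
    have e1 : ‖∑ m ∈ range M, eC (∑ i : Fin (k - 1), al d γ X j κ θ n (i.1 + 1) * ~m ^ (i.1 + 1))‖ =
        ‖∑ m ∈ range M, eC (al d γ X j κ θ n 0 + ∑ i : Fin (k - 1), al d γ X j κ θ n (i.1 + 1) * ~m ^ (i.1 + 1))‖ := by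
      simp only [eC_add (al d γ X j κ θ n 0)]
      rw [← mul_sum, norm_mul, norm_eC, one_mul]
    rw [e1]
    refine (norm_le_norm_add_norm_sub' _ _).trans (add_le_add le_rfl ?_)
    rw [← sum_sub_distrib]
    refine (norm_sum_le _ _).trans ((sum_le_card_nsmul _ _ B fun m hm => ?_).trans (by simp))
    refine (norm_eC_sub _ _).trans ?_
    have hm' : ~m ≤ M := by exact_mod_cast (mem_range.1 hm).le
    refine mul_le_mul_of_nonneg_left ((al_taylor d k hdk γ h1 X j κ hX θ n m).trans ?_) PP
    gcongr
  refine (sum_le_sum key).trans ?_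
  rw [sum_add_distrib, sum_const, card_range, nsmul_eq_mul]
  have : ~N ≤ X := by exact_mod_cast hN
  gcongr

set_option maxHeartbeats 1000000 in
lemma P4EH (d k : ℕ) (hd : 3 ≤ d) (hdk : d < k) (γ τ : ℝ) (h0 : 0 < γ) (h1 : γ < 1) (hs0 : 0 ≤ 1 - τ)
    (hA : (k - 1) * (1 - τ) + (1 - γ) ≤ 1) (hB : ~k ^ 2 * (k - 1) * (1 - τ) + (1 - τ) * (d - 1) ≤ (k - d + 1) * γ) : EH d γ τ := by
  intro ε hε
  have h2s : 2 * VM.tri (k - 1) = (k - 1) * k := by rw [VM.two_tri, Nat.sub_add_cancel OO]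
  have h2s' : ((2 * VM.tri (k - 1) : ℕ) : ℝ) = (k - 1) * k := by
    rw [h2s, Nat.cast_mul, Nat.cast_sub OO]; simp
  have hs1 : 1 ≤ VM.tri (k - 1) := VM.tri_pos OO
  set s2 := 2 * VM.tri (k - 1) with hs2
  have hs20 : s2 ≠ 0 := by omega
  obtain ⟨C, hC, h⟩ := LA d k hd hdk γ h0 h1 (s2 * ε) PP
  set D := C * (1 + 2 ^ (d - 1)) with hD
  have hD1 : 1 ≤ D := one_le_mul_of_one_le_of_one_le hC (by linarith [(by positivity : ~0 ≤ 2 ^ (d - 1))])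
  have hp0 : 0 ≤ 2 * π * |pc γ k| := by positivity
  refine ⟨D + 2 * π * |pc γ k| + 2, by linarith, ?_⟩
  intro X j κ N θ hX hj hjX hκ hN
  have hX1 : ~1 ≤ X := by exact_mod_cast hX
  have hX0 : ~0 < X := by linarith
  have hj1 : ~1 ≤ j := by exact_mod_cast hj
  have hj0 : ~0 < j := by linarith
  have hjX' : ~j ≤ X := by exact_mod_cast hjX
  have hk4 : ~4 ≤ k := by exact_mod_cast (by omega : 4 ≤ k)
  have hk0 : ~0 < k := by linarith
  have hd3 : ~3 ≤ d := by exact_mod_cast hd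
  have hdk' : ~d + 1 ≤ k := by exact_mod_cast hdk
  set σ := 1 - τ with hσ
  have hσ1 : σ ≤ 1 := by linarith [mul_nonneg hs0 (by linarith : ~0 ≤ k - 4)]
  set T := ~j * ~X ^ (γ - 1) with hT
  have hT0 : 0 < T := by positivity
  have hTl : ~X ^ (γ - 1) ≤ T := le_mul_of_one_le_left PP hj1
  have hTu : T ≤ ~X ^ γ := by
    calc T ≤ X * ~X ^ (γ - 1) := by rw [hT]; gcongr
      _ = _ := by rw [rpow_sub_one hX0.ne']; field_simp
  have hTb : ∀ b : ℝ, b ≤ 0 → T ^ b ≤ ~X ^ ((γ - 1) * b) := fun b hb => by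
    rw [rpow_mul hX0.le]; exact rpow_le_rpow_of_nonpos PP hTl hb
  have hTb' : ∀ b : ℝ, b ≤ 0 → ~X ^ (γ * b) ≤ T ^ b := fun b hb => by
    rw [rpow_mul hX0.le]; exact rpow_le_rpow_of_nonpos hT0 hTu hb
  set a := (k - 1 - σ) / ~k with ha
  have hak : a * k = k - 1 - σ := by rw [ha]; field_simp
  set b := -(1 / ~k) with hb
  have hbk : b * k = -1 := by rw [hb]; field_simp
  have hb0 : b ≤ 0 := by rw [hb]; have : 0 < 1 / ~k := by positivity
                         linarith
  set M0 := ~X ^ a * T ^ b with hM0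
  have hM00 : 0 < M0 := by positivity
  have hM1 : 1 ≤ M0 := by
    have : 1 ≤ ~X ^ (a + γ * b) := one_le_rpow hX1 (by
      refine nonneg_of_mul_nonneg_left ?_ hk0
      rw [add_mul, hak, mul_assoc, hbk]; linarith)
    refine this.trans ?_
    rw [rpow_add hX0]
    exact mul_le_mul_of_nonneg_left (hTb' b hb0) PP
  have hMu : M0 ≤ ~X ^ τ := by
    have : ~X ^ (a + (γ - 1) * b) ≤ ~X ^ τ := rpow_le_rpow_of_exponent_le hX1 (by
      refine le_of_mul_le_mul_right ?_ hk0
      rw [add_mul, hak, mul_assoc, hbk]; linarith)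
    refine le_trans ?_ this
    rw [rpow_add hX0]
    exact mul_le_mul_of_nonneg_left (hTb b hb0) PP
  set M := ⌊M0⌋₊ with hM
  have hM1' : 1 ≤ M := Nat.le_floor (by simpa using hM1)
  have hMM : ~M ≤ M0 := Nat.floor_le hM00.le
  have hM1r : ~1 ≤ M := by exact_mod_cast hM1'
  have hMp : ~0 < M := by linarith
  have hMM2 : M0 ≤ 2 * M := by have := Nat.lt_floor_add_one M0
                               linarith
  have hMX : M ≤ X := by
    have : ~M ≤ X := (hMM.trans hMu).trans (by
      simpa using rpow_le_rpow_of_exponent_le hX1 (show τ ≤ 1 by linarith))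
    exact_mod_cast this
  have hMk : T * ~M ^ k ≤ ~X ^ (k - 1 - σ) := by
    calc T * ~M ^ k ≤ T * M0 ^ k := by gcongr
      _ = _ := by
        rw [hM0, mul_pow, ← rpow_natCast, ← rpow_natCast, ← rpow_mul hX0.le, ← rpow_mul hT0.le, hak, hbk, rpow_neg_one]
        field_simp
  have hXM : (~X / M) ^ (d - 1) / T ≤ 2 ^ (d - 1) * ~X ^ (1 - s2 * σ) := by
    have c1 : ~X / M ≤ 2 * (~X ^ (1 - a) * T ^ (-b)) := by
      rw [rpow_sub hX0, rpow_neg hT0.le, rpow_one, div_mul_eq_mul_div, ← div_eq_mul_inv, div_div, mul_comm (T ^ b), ← hM0, ← mul_div_assoc,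
        div_le_div_iff₀ hMp hM00]
      linarith [mul_le_mul_of_nonneg_left hMM2 hX0.le]
    have c4 : ~(d - 1 : ℕ) = d - 1 := by rw [Nat.cast_sub OO]; simp
    calc (~X / M) ^ (d - 1) / T ≤ (2 * (~X ^ (1 - a) * T ^ (-b))) ^ (d - 1) / T := by gcongr
      _ = 2 ^ (d - 1) * (~X ^ ((1 - a) * (d - 1)) * T ^ (-b * (d - 1) - 1)) := by
        rw [mul_pow, mul_pow, ← rpow_natCast (_ ^ (1 - a)), ← rpow_natCast (T ^ (-b)), ← rpow_mul hX0.le, ← rpow_mul hT0.le, c4,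
          rpow_sub_one hT0.ne']
        ring
      _ ≤ 2 ^ (d - 1) * (~X ^ ((1 - a) * (d - 1)) * ~X ^ ((γ - 1) * (-b * (d - 1) - 1))) := by
        refine mul_le_mul_of_nonneg_left (mul_le_mul_of_nonneg_left (hTb _ ?_) PP) PP
        refine nonpos_of_mul_nonpos_left (b := ~k) ?_ hk0
        have : (-b * (d - 1) - 1) * k = -(b * k) * (d - 1) - k := by ring
        rw [this, hbk]; linarith
      _ ≤ _ := by
        rw [← rpow_add hX0]
        refine mul_le_mul_of_nonneg_left (rpow_le_rpow_of_exponent_le hX1 ?_) PP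
        refine le_of_mul_le_mul_right ?_ hk0
        have : ((1 - a) * (d - 1) + (γ - 1) * (-b * (d - 1) - 1)) * k = (k - a * k) * (d - 1) + (γ - 1) * (-(b * k) * (d - 1) - k) := by ring
        rw [this, hak, hbk, h2s']
        linarith
  have hLA := h X j κ N M θ hX hj hjX hκ hN hM1' hMX
  have hLB := LB d k hdk γ h1 X j κ N M θ hX hN
  set S := ‖∑ n ∈ range N, eC (j * ~(X + n + κ : ℕ) ^ γ + θ * ~(X + n : ℕ) ^ d)‖ with hS
  set G := ∑ n ∈ range N, ‖∑ m ∈ range M, eC (∑ i : Fin (k - 1), al d γ X j κ θ n (i.1 + 1) * ~m ^ (i.1 + 1))‖ with hG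
  have hG0 : 0 ≤ G := sum_nonneg fun _ _ => norm_nonneg _
  have hGb : G ≤ D * (M * ~X ^ (τ + ε)) := by
    rw [← pow_le_pow_iff_left₀ hG0 PP hs20]
    refine hLA.trans ?_
    have c1 : (X : ℝ)⁻¹ * (1 + (~X / M) ^ (d - 1) / T) ≤ (1 + 2 ^ (d - 1)) * ~X ^ (-(s2 * σ)) := by
      have c2 : 1 ≤ ~X ^ (1 - s2 * σ) := one_le_rpow hX1 (by
        rw [h2s']
        refine nonneg_of_mul_nonneg_left (b := ~k) ?_ hk0
        linarith [mul_nonneg hs0 (by linarith : ~0 ≤ d - 1), mul_le_mul_of_nonneg_left h1.le (by linarith : ~0 ≤ k - d + 1)])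
      have c3 : ~X ^ (-(s2 * σ)) = ~X⁻¹ * ~X ^ (1 - s2 * σ) := by
        rw [rpow_sub hX0, rpow_one, rpow_neg hX0.le]; field_simp
      rw [c3, mul_left_comm]
      refine mul_le_mul_of_nonneg_left ?_ PP
      linarith
    calc C * ~X ^ (s2 * ε) * (~X * M) ^ s2 * ((X : ℝ)⁻¹ * (1 + (~X / M) ^ (d - 1) / T)) ≤
        C * ~X ^ (s2 * ε) * (~X * M) ^ s2 * ((1 + 2 ^ (d - 1)) * ~X ^ (-(s2 * σ))) := by gcongr
      _ = D * (M * ~X ^ (τ + ε)) ^ s2 := by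
        have : ~X ^ (τ + ε) = X * ~X ^ ε * ~X ^ (-σ) := by
          rw [show τ + ε = 1 + ε + -σ by rw [hσ]; ring, rpow_add hX0, rpow_add hX0, rpow_one]
        rw [this, mul_comm (s2 : ℝ) ε, rpow_mul hX0.le, show -(~s2 * σ) = -σ * s2 by ring, rpow_mul hX0.le, rpow_natCast, rpow_natCast,
          mul_pow, mul_pow, mul_pow, mul_pow, hD]
        ring
      _ ≤ D ^ s2 * (M * ~X ^ (τ + ε)) ^ s2 := by
        refine mul_le_mul_of_nonneg_right (le_self_pow₀ hD1 hs20) PP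
      _ = _ := by rw [mul_pow D]
  have hXe : ~X ^ τ ≤ ~X ^ (τ + ε) := rpow_le_rpow_of_exponent_le hX1 LL
  have e2 : X * (M * (2 * π * (|pc γ k| * (j * ~X ^ (γ - k)) * ~M ^ k))) ≤ M * (2 * π * |pc γ k| * ~X ^ (τ + ε)) := by
    have c1 : ~j * ~X ^ (γ - k) = T * ~X ^ (1 - k : ℝ) := by
      rw [hT, mul_assoc, ← rpow_add hX0]; congr 2; ring
    have c2 : ~X * ~X ^ (1 - k : ℝ) * ~X ^ (k - 1 - σ) = ~X ^ τ := by
      nth_rewrite 1 [← rpow_one ~X]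
      rw [← rpow_add hX0, ← rpow_add hX0]; congr 1; rw [hσ]; ring
    calc X * (M * (2 * π * (|pc γ k| * (j * ~X ^ (γ - k)) * ~M ^ k)))
        = M * (2 * π * |pc γ k| * (X * ~X ^ (1 - k : ℝ) * (T * ~M ^ k))) := by rw [c1]; ring
      _ ≤ M * (2 * π * |pc γ k| * (X * ~X ^ (1 - k : ℝ) * ~X ^ (k - 1 - σ))) := by gcongr
      _ ≤ _ := by rw [c2]; gcongr
  have e3 : 2 * ~M ^ 2 ≤ M * (2 * ~X ^ (τ + ε)) := by
    have := mul_le_mul_of_nonneg_left ((hMM.trans hMu).trans hXe) hMp.le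
    linarith [sq ~M]
  have e4 : S ≤ (D + 2 * π * |pc γ k| + 2) * ~X ^ (τ + ε) := by
    refine le_of_mul_le_mul_left ?_ hMp
    linarith
  refine e4.trans (le_mul_of_one_le_right PP ?_)
  have : 0 ≤ (j / ~X ^ σ) ^ (~1 / 6) := by positivity
  have : 0 ≤ T ^ (-~1 / 3) := by positivity
  linarith

lemma hpar (h q c : ℝ) (hq : h * (2 - q) = q) (q0 : 0 < q) (q1 : q < 1 / 2) (hc1 : 1 < c) (hc2 : c < 1 + 2 * h / (1 - h)) :
    0 < 1 / c ∧ 1 / c < 1 ∧ 1 - q < 1 / c ∧ 1 - 1 / c * ((1 + c) / 2 * (1 - h)) < q ∧ 0 ≤ 1 - 1 / c * ((1 + c) / 2 * (1 - h)) ∧ 1 / c * ((1 + c) / 2 * (1 - h)) ≤ 1 / c := by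
  have hh : h = q / (2 - q) := by rw [eq_div_iff LL]; exact hq
  have c0 : 0 < c := by linarith
  have e1 : 1 - h = 2 * (1 - q) / (2 - q) := by rw [hh]; field_simp [show 2 - q ≠ 0 by linarith]; ring
  have e2 : 1 + 2 * h / (1 - h) = 1 / (1 - q) := by
    rw [e1, hh]; have : 2 - q ≠ 0 := by linarith
    have : 1 - q ≠ 0 := by linarith
    field_simp; ring
  rw [e2] at hc2
  have hg : 1 - q < 1 / c := by
    rw [lt_div_iff₀ c0, mul_comm]; rwa [lt_div_iff₀ LL] at hc2
  have hg1 : 1 / c < 1 := by rw [div_lt_one c0]; exact hc1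
  have e3 : 1 / c * ((1 + c) / 2 * (1 - h)) = (1 / c + 1) * (1 - q) / (2 - q) := by
    rw [e1]; field_simp
  rw [e3]
  have h2q : 0 < 2 - q := by linarith
  have t1 : 1 - q < (1 / c + 1) * (1 - q) / (2 - q) := by
    rw [lt_div_iff₀ h2q]; nlinarith
  have t2 : (1 / c + 1) * (1 - q) / (2 - q) ≤ 1 / c := by
    rw [div_le_iff₀ h2q]; nlinarith
  exact ⟨by positivity, hg1, hg, by linarith, by linarith, t2⟩

lemma params (d : ℕ) (hd : 2 ≤ d) (c : ℝ) (hc1 : 1 < c) (hc2 : c < 1 + c3ps d) :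
    EH d (1 / c) (1 / c * θdc d c) ∧ 1 / c * θdc d c ≤ 1 / c ∧ 1 / 2 ≤ 1 / c * θdc d c := by
  have c0 : 0 < c := by linarith
  have g0 : 0 < 1 / c := by positivity
  have g1 : 1 / c < 1 := by rw [div_lt_one c0]; exact hc1
  by_cases h2 : d = 2
  · subst h2
    simp only [c3ps, if_true] at hc2
    have hg : 2 / 3 < 1 / c := by rw [lt_div_iff₀ c0]; linarith
    have e : 1 / c * θdc 2 c = (4 + 7 * (1 / c)) / 13 := by simp only [θdc, if_true]; field_simp
    rw [e]
    refine ⟨P2EH 2 le_rfl _ _ g0 g1 ?_ ?_, ?_, ?_⟩ <;> norm_num <;> norm_num at hg <;> linarith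
  by_cases h3 : d = 3
  · subst h3
    simp only [c3ps, h2, if_false, if_true] at hc2
    have hg : 15 / 16 < 1 / c := by rw [lt_div_iff₀ c0]; linarith
    have e : 1 / c * θdc 3 c = (15 + 14 * (1 / c)) / 30 := by simp only [θdc, h2, if_false, if_true]; field_simp
    rw [e]
    refine ⟨P2EH 3 (by norm_num) _ _ g0 g1 ?_ ?_, ?_, ?_⟩ <;> norm_num <;> norm_num at hg <;> linarith
  by_cases h11 : d ≤ 11
  · have e : θdc d c = (1 + c) / 2 * (1 - hD d) := by simp only [θdc, h2, h3, h11, if_false, if_true]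
    simp only [c3ps, h2, h3, h11, if_false, if_true] at hc2
    rw [e]
    have hd4 : ~4 ≤ d := by exact_mod_cast (by omega : 4 ≤ d)
    have hdd : ~100 ≤ ~d * (~d + 1) ^ 2 := by nlinarith [sq_nonneg (~d - 4)]
    obtain ⟨-, -, a1, a2, a3, a4⟩ := hpar (hD d) (2 / (~d * (~d + 1) ^ 2)) c (by
      rw [hD]
      have : ~d * (~d + 1) ^ 2 - 1 ≠ 0 := by linarith
      have : (d : ℝ) ≠ 0 := by linarith
      have : ~d + 1 ≠ 0 := by linarith
      field_simp) PP (by rw [div_lt_iff₀ LL]; linarith) hc1 hc2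
    have a5 : 2 / (~d * (~d + 1) ^ 2) ≤ 2 / 100 := by gcongr
    refine ⟨?_, a4, by linarith⟩
    generalize 1 / c * ((1 + c) / 2 * (1 - hD d)) = τ at *
    generalize 1 / c = γ at *
    by_cases h9 : d ≤ 9
    · have h4 : 4 ≤ d := by omega
      apply P2EH d hd γ τ g0 g1 <;> interval_cases d <;> norm_num at * <;> linarith
    · have h10 : 10 ≤ d := by omega
      interval_cases d
      · apply P4EH 10 13 (by norm_num) (by norm_num) γ τ g0 g1 a3 <;> norm_num at * <;> linarith
      · apply P4EH 11 15 (by norm_num) (by norm_num) γ τ g0 g1 a3 <;> norm_num at * <;> linarith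
  by_cases he : 2 ∣ d
  · obtain ⟨e, rfl⟩ := he
    have e1 : θdc (2 * e) c = (1 + c) / 2 * (1 - kD (2 * e)) := by simp only [θdc, h2, h3, h11, if_false, dvd_mul_right, if_true]
    simp only [c3ps, h2, h3, h11, if_false, dvd_mul_right, if_true] at hc2
    rw [e1]
    have he6 : ~6 ≤ e := by exact_mod_cast (by omega : 6 ≤ e)
    have hr : ~100 ≤ 27 * ~e ^ 2 - 3 := by nlinarith
    obtain ⟨-, -, a1, a2, a3, a4⟩ := hpar (kD (2 * e)) (1 / (27 * ~e ^ 2 - 3)) c (by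
      rw [kD]; push_cast
      have : 27 * (2 * ~e) ^ 2 - 14 ≠ 0 := by nlinarith
      have : 27 * ~e ^ 2 - 3 ≠ 0 := by linarith
      rw [div_mul_eq_mul_div, div_eq_div_iff (by assumption) (by assumption)]
      field_simp; ring) (by have : 0 < 27 * ~e ^ 2 - 3 := by linarith
                            positivity) (by rw [div_lt_iff₀ LL]; linarith) hc1 hc2
    have a5 : 1 / (27 * ~e ^ 2 - 3) ≤ 1 / 100 := by gcongr
    refine ⟨?_, a4, by linarith⟩
    generalize 1 / c * ((1 + c) / 2 * (1 - kD (2 * e))) = τ at *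
    generalize 1 / c = γ at *
    set r := 27 * ~e ^ 2 - 3 with hr'
    have a6 : (1 - τ) * r ≤ 1 := by rw [lt_div_iff₀ LL] at a2; exact a2.le
    have a7 : r - 1 ≤ γ * r := by
      have : (1 - 1 / r) * r = r - 1 := by field_simp
      have := mul_le_mul_of_nonneg_right a1.le (by linarith : 0 ≤ r)
      linarith
    apply P4EH (2 * e) (3 * e) OO OO γ τ g0 g1 a3
    · push_cast
      have : (3 * ~e) * (1 - τ) ≤ r * (1 - τ) * (1 / 2) := by nlinarith [mul_nonneg a3 (by nlinarith : 0 ≤ r - 6 * e)]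
      linarith
    · push_cast
      have hr0 : 0 < r := by linarith
      refine le_of_mul_le_mul_right ?_ hr0
      have p0 : 0 ≤ (3 * ~e) ^ 2 * (3 * e - 1) + (2 * e - 1) := by nlinarith
      have p1 := mul_le_mul_of_nonneg_left a6 p0
      have p2 := mul_le_mul_of_nonneg_left a7 (by linarith : ~0 ≤ e + 1)
      have p3 : (3 * ~e) ^ 2 * (3 * e - 1) + (2 * e - 1) ≤ (e + 1) * (r - 1) := by rw [hr']; nlinarith
      linarith
  · obtain ⟨e, rfl⟩ : ∃ e, d = 2 * e + 1 := ⟨d / 2, by omega⟩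
    have e1 : θdc (2 * e + 1) c = (1 + c) / 2 * (1 - lD (2 * e + 1)) := by simp only [θdc, h2, h3, h11, he, if_false]
    simp only [c3ps, h2, h3, h11, he, if_false] at hc2
    rw [e1]
    have he6 : ~6 ≤ e := by exact_mod_cast (by omega : 6 ≤ e)
    have hr : ~100 ≤ 27 * ~e ^ 2 + 27 * e + 6 := by nlinarith
    obtain ⟨-, -, a1, a2, a3, a4⟩ := hpar (lD (2 * e + 1)) (1 / (27 * ~e ^ 2 + 27 * e + 6)) c (by
      rw [lD]; push_cast
      have : 27 * (2 * ~e + 1) ^ 2 - 5 ≠ 0 := by nlinarith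
      have : 27 * ~e ^ 2 + 27 * e + 6 ≠ 0 := by linarith
      rw [div_mul_eq_mul_div, div_eq_div_iff (by assumption) (by assumption)]
      field_simp; ring) PP (by rw [div_lt_iff₀ LL]; linarith) hc1 hc2
    have a5 : 1 / (27 * ~e ^ 2 + 27 * e + 6) ≤ 1 / 100 := by gcongr
    refine ⟨?_, a4, by linarith⟩
    generalize 1 / c * ((1 + c) / 2 * (1 - lD (2 * e + 1))) = τ at *
    generalize 1 / c = γ at *
    set r := 27 * ~e ^ 2 + 27 * e + 6 with hr'
    have a6 : (1 - τ) * r ≤ 1 := by rw [lt_div_iff₀ LL] at a2; exact a2.le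
    have a7 : r - 1 ≤ γ * r := by
      have : (1 - 1 / r) * r = r - 1 := by field_simp
      have := mul_le_mul_of_nonneg_right a1.le (by linarith : 0 ≤ r)
      linarith
    apply P4EH (2 * e + 1) (3 * e + 2) OO OO γ τ g0 g1 a3
    · push_cast
      have : (3 * ~e + 2) * (1 - τ) ≤ r * (1 - τ) * (1 / 2) := by nlinarith [mul_nonneg a3 (by nlinarith : 0 ≤ r - 6 * e - 4)]
      linarith
    · push_cast
      have hr0 : 0 < r := by linarith
      refine le_of_mul_le_mul_right ?_ hr0
      have p0 : 0 ≤ (3 * ~e + 2) ^ 2 * (3 * e + 1) + 2 * e := by positivity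
      have p1 := mul_le_mul_of_nonneg_left a6 p0
      have p2 := mul_le_mul_of_nonneg_left a7 (by linarith : ~0 ≤ e + 2)
      have p3 : (3 * ~e + 2) ^ 2 * (3 * e + 1) + 2 * e ≤ (e + 2) * (r - 1) := by rw [hr']; nlinarith
      linarith

lemma phi_bd (γ : ℝ) (h0 : 0 < γ) (h1 : γ < 1) (m : ℝ) (hm : 0 < m) :
    γ * (m + 1) ^ (γ - 1) ≤ (m + 1) ^ γ - m ^ γ ∧ (m + 1) ^ γ - m ^ γ ≤ γ * m ^ (γ - 1) := by
  have key : ∀ s x y : ℝ, 0 < x → 0 < y → y = x + s → y ^ γ ≤ x ^ γ + γ * s * x ^ (γ - 1) := by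
    intro s x y hx hy e
    have h := rpow_one_add_le_one_add_mul_self (s := s / x) (p := γ)
      (by rw [le_div_iff₀ hx]; linarith) h0.le h1.le
    have e1 : y = x * (1 + s / x) := by field_simp; exact e
    have e2 : 0 ≤ 1 + s / x := by
      have : 1 + s / x = y / x := by rw [e]; field_simp
      rw [this]; positivity
    rw [e1, mul_rpow hx.le e2, rpow_sub_one hx.ne']
    calc _ ≤ x ^ γ * (1 + γ * (s / x)) := by gcongr
      _ = _ := by field_simp
  constructor
  · have := key (-1) (m + 1) m LL hm (by ring)
    linarith
  · have := key 1 m (m + 1) hm LL rfl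
    linarith

lemma abel_bd (b g : ℕ → ℂ) (v : ℕ → ℝ) (N : ℕ) (G : ℝ) (hG : ∀ M ≤ N, ‖∑ n ∈ range M, g n‖ ≤ G)
    (hv : ∀ i, ‖b (i + 1) - b i‖ ≤ v (i + 1) - v i) :
    ‖∑ n ∈ range N, b n * g n‖ ≤ (‖b (N - 1)‖ + (v (N - 1) - v 0)) * G := by
  have h := sum_range_by_parts b g N
  simp only [smul_eq_mul] at h
  rw [h, add_mul]
  refine (norm_sub_le _ _).trans (add_le_add ?_ ?_)
  · rw [norm_mul]; gcongr; exact hG N le_rfl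
  · rw [← sum_range_sub, sum_mul]
    refine norm_sum_le_of_le _ fun i hi => ?_
    rw [norm_mul]
    have := mem_range.1 hi
    exact mul_le_mul (hv i) (hG _ OO) (norm_nonneg _) ((norm_nonneg _).trans (hv i))

def Bf (t : ℝ) : ℝ := Int.fract t ^ 2 - Int.fract t + 1 / 6

lemma hasSum_Bf (t : ℝ) : HasSum (fun n : ℕ => 1 / ~n ^ 2 * cos (2 * π * n * t)) (π ^ 2 * Bf t) := by
  have h := hasSum_one_div_nat_pow_mul_cos (k := 1) one_ne_zero (x := Int.fract t)
    ⟨Int.fract_nonneg _, (Int.fract_lt_one _).le⟩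
  have e : (Polynomial.map (algebraMap ℚ ℝ) (Polynomial.bernoulli 2)).eval (Int.fract t) = Bf t := by
    simp [Bf, Polynomial.bernoulli, sum_range_succ, Polynomial.map_monomial, bernoulli_two, bernoulli_one]; ring
  rw [mul_one, e] at h
  convert h using 1
  · ext n
    congr 1
    rw [← cos_sub_int_mul_two_pi _ (n * ⌊t⌋)]
    congr 1; push_cast
    rw [Int.fract]; ring
  · norm_num [Nat.factorial]; left; ring

lemma hs_comb {K : ℕ} (N : ℕ) (w : ℕ → ℂ) (y : ℕ → ℝ) (a s : Fin K → ℝ) :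
    HasSum (fun j : ℕ => ((1 / ~j ^ 2 : ℝ) : ℂ) *
      ((∑ k, a k * eC (j * s k)) * (∑ n ∈ range N, w n * eC (j * y n)) +
       (starRingEnd ℂ (∑ k, a k * eC (j * s k))) * (∑ n ∈ range N, w n * eC (-(j * y n)))))
      (2 * π ^ 2 * ∑ n ∈ range N, w n * ((∑ k, a k * Bf (y n + s k) : ℝ) : ℂ)) := by
  have h : HasSum (fun j : ℕ => ∑ n ∈ range N, ∑ k, (2 * w n * a k) * ((1 / ~j ^ 2 * cos (2 * π * j * (y n + s k)) : ℝ) : ℂ)) (∑ n ∈ range N, ∑ k, (2 * w n * a k) * ((π ^ 2 * Bf (y n + s k) : ℝ) : ℂ)) :=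
    hasSum_sum fun n _ => hasSum_sum fun k _ => (Complex.hasSum_ofReal.2 (hasSum_Bf (y n + s k))).mul_left _
  convert h using 1
  · ext j
    simp only [map_sum, map_mul, Complex.conj_ofReal, sum_mul_sum, ← eC_neg]
    rw [sum_comm, sum_comm (s := univ), ← sum_add_distrib, mul_sum]
    refine sum_congr rfl fun n _ => ?_
    rw [← sum_add_distrib, mul_sum]
    refine sum_congr rfl fun k _ => ?_
    have : (2 : ℂ) * (cos (2 * π * j * (y n + s k)) : ℂ) = eC (j * s k) * eC (j * y n) + eC (-(j * s k)) * eC (-(j * y n)) := by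
      rw [← eC_add, ← eC_add, eC_cs, eC_cs, show 2 * π * (-(j * s k) + -(j * y n)) = -(2 * π * j * (y n + s k)) by ring, show 2 * π * (j * s k + j * y n) = (2 * π * j * (y n + s k)) by ring, cos_neg, sin_neg]
      push_cast; ring
    push_cast at this ⊢
    linear_combination (-(w n * a k / j ^ 2)) * this
  · rw [mul_sum]
    refine sum_congr rfl fun n _ => ?_
    push_cast
    rw [mul_sum, mul_sum]
    refine sum_congr rfl fun k _ => ?_
    ring

lemma tail_bd (g : ℕ → ℂ) (S : ℂ) (X : ℕ) (hX : 1 ≤ X) (A A' : ℝ)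
    (h : HasSum (fun j : ℕ => ((1 / ~j ^ 2 : ℝ) : ℂ) * g j) S)
    (h1 : ∀ j : ℕ, 1 ≤ j → j ≤ X → ‖g j‖ ≤ A * j) (h2 : ∀ j : ℕ, X < j → ‖g j‖ ≤ A') :
    ‖S‖ ≤ 2 * (A * (1 + log X)) + A' * (2 / X) := by
  have hA : 0 ≤ A := by simpa using (norm_nonneg _).trans (h1 1 le_rfl hX)
  have hA' : 0 ≤ A' := (norm_nonneg _).trans (h2 (X + 1) OO)
  have X0 : ~1 ≤ X := by exact_mod_cast hX
  have hl : 1 + log ~(X + 1 : ℕ) ≤ 2 * (1 + log X) := by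
    have : log ~(X + 1 : ℕ) ≤ log (2 * X) := log_le_log PP (by push_cast; linarith)
    rw [log_mul (by norm_num) PP] at this
    have := log_two_lt_d9
    have := log_nonneg X0
    linarith
  refine le_of_tendsto ((h.tendsto_sum_nat).norm) ?_
  filter_upwards [Filter.eventually_ge_atTop (X + 1)] with n hn
  rw [range_eq_Ico, ← sum_Ico_consecutive _ (Nat.zero_le (X + 1)) hn]
  refine (norm_add_le _ _).trans (add_le_add ?_ ?_)
  · rw [sum_eq_sum_Ico_succ_bot OO]
    simp only [Nat.cast_zero, ne_eq, OfNat.ofNat_ne_zero, not_false_eq_true, zero_pow, div_zero, Complex.ofReal_zero, zero_mul, zero_add]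
    calc _ ≤ ∑ j ∈ Ico 1 (X + 1), A * (~1 / j) := by
          refine norm_sum_le_of_le _ fun j hj => ?_
          rw [mem_Ico] at hj
          have : ~0 < j := by exact_mod_cast hj.1
          rw [norm_mul, Complex.norm_real, norm_of_nonneg PP]
          calc _ ≤ 1 / ~j ^ 2 * (A * j) := by gcongr; exact h1 j hj.1 OO
            _ = _ := by field_simp
      _ ≤ A * (2 * (1 + log X)) := by
          rw [← mul_sum]; gcongr; exact (sum_inv_le _ _ le_rfl).trans hl
      _ = _ := by ring
  · calc _ ≤ ∑ j ∈ Ico (X + 1) n, A' * (~j ^ 2)⁻¹ := by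
          refine norm_sum_le_of_le _ fun j hj => ?_
          rw [mem_Ico] at hj
          rw [norm_mul, Complex.norm_real, norm_of_nonneg PP, mul_comm, one_div]
          gcongr; exact h2 j OO
      _ ≤ A' * (2 / X) := by
          rw [← mul_sum]
          gcongr
          have := sum_Ioo_inv_sq_le (α := ℝ) X n
          rw [show Ico (X + 1) n = Ioo X n by ext; simp]
          refine this.trans ?_
          gcongr; linarith

def Tn (H y : ℝ) : ℝ := 1 / (2 * H) - ∑ k : Fin 3, (![H, -2 * H, H] k) * Bf (y + ![1 / (2 * H), 0, -(1 / (2 * H))] k)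
def Dn (H y : ℝ) : ℝ := ∑ k : Fin 2, (![2 * H, -2 * H] k) * Bf (y + ![0, -(1 / (4 * H))] k)

lemma psi_pt (H y : ℝ) (hH : 1 ≤ H) : |Int.fract y - 1 / 2 - Dn H y| ≤ 1 / (8 * H) + 2 * Tn H y := by
  obtain ⟨δ, hδ⟩ : ∃ δ, δ = 1 / (4 * H) := ⟨_, rfl⟩
  have H0 : 0 < H := by linarith
  have d0 : 0 < δ := by rw [hδ]; positivity
  have d1 : δ ≤ 1 / 4 := by rw [hδ]; gcongr; linarith
  have hd : δ * H = 1 / 4 := by rw [hδ]; field_simp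
  have f0 := Int.fract_nonneg y
  have f1 := Int.fract_lt_one y
  have fr : ∀ (t : ℝ) (z : ℤ), 0 ≤ Int.fract y + t - z → Int.fract y + t - z < 1 → Int.fract (y + t) = Int.fract y + t - z := by
    intro t z h1 h2
    rw [Int.fract_eq_iff]
    refine ⟨h1, h2, ⌊y⌋ + z, ?_⟩
    rw [Int.fract]; push_cast; ring
  have e2 : 1 / (2 * H) = 2 * δ := by rw [hδ]; field_simp; norm_num
  have e3 : 1 / (8 * H) = δ / 2 := by rw [hδ]; field_simp; norm_num
  simp only [Tn, Dn, Fin.sum_univ_two, Fin.sum_univ_three, Matrix.cons_val, e2, e3, ← hδ, add_zero]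
  unfold Bf
  generalize Int.fract y = f at *
  have T : 0 ≤ 2 * δ - (H * (Int.fract (y + 2 * δ) ^ 2 - Int.fract (y + 2 * δ) + 1 / 6) + -2 * H * (f ^ 2 - f + 1 / 6) + H * (Int.fract (y + -(2 * δ)) ^ 2 - Int.fract (y + -(2 * δ)) + 1 / 6)) ∧ (f < δ → 1 ≤ 2 * (2 * δ - (H * (Int.fract (y + 2 * δ) ^ 2 - Int.fract (y + 2 * δ) + 1 / 6) + -2 * H * (f ^ 2 - f + 1 / 6) + H * (Int.fract (y + -(2 * δ)) ^ 2 - Int.fract (y + -(2 * δ)) + 1 / 6)))) := by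
    rcases lt_or_ge f (2 * δ) with h | h
    · rw [fr (2 * δ) 0 (by push_cast; linarith) (by push_cast; linarith), fr (-(2 * δ)) (-1) (by push_cast; linarith) (by push_cast; linarith)]
      have : f * H ≤ 2 * δ * H := by gcongr
      push_cast
      have e : 2 * δ - (H * ((f + 2 * δ - 0) ^ 2 - (f + 2 * δ - 0) + 1 / 6) + -2 * H * (f ^ 2 - f + 1 / 6) + H * ((f + -(2 * δ) - -1) ^ 2 - (f + -(2 * δ) - -1) + 1 / 6)) = 1 - 2 * (f * H) := by
        linear_combination (4 - 8 * δ) * hd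
      rw [e]
      refine ⟨by linarith, fun h => ?_⟩
      have : f * H ≤ δ * H := by gcongr
      linarith
    rcases lt_or_ge f (1 - 2 * δ) with h' | h'
    · rw [fr (2 * δ) 0 (by push_cast; linarith) (by push_cast; linarith), fr (-(2 * δ)) 0 (by push_cast; linarith) (by push_cast; linarith)]
      refine ⟨le_of_eq ?_, fun _ => by linarith⟩
      push_cast
      linear_combination (8 * δ) * hd
    · rw [fr (2 * δ) 1 (by push_cast; linarith) (by push_cast; linarith), fr (-(2 * δ)) 0 (by push_cast; linarith) (by push_cast; linarith)]
      refine ⟨?_, fun _ => by linarith⟩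
      have : (1 - 2 * δ) * H ≤ f * H := by gcongr
      push_cast
      have e : 2 * δ - (H * ((f + 2 * δ - 1) ^ 2 - (f + 2 * δ - 1) + 1 / 6) + -2 * H * (f ^ 2 - f + 1 / 6) + H * ((f + -(2 * δ) - 0) ^ 2 - (f + -(2 * δ) - 0) + 1 / 6)) = 1 - 2 * H + 2 * (f * H) := by
        linear_combination (4 - 8 * δ) * hd
      rw [e]; linarith
  revert T
  generalize 2 * δ - (H * (Int.fract (y + 2 * δ) ^ 2 - Int.fract (y + 2 * δ) + 1 / 6) + -2 * H * (f ^ 2 - f + 1 / 6) + H * (Int.fract (y + -(2 * δ)) ^ 2 - Int.fract (y + -(2 * δ)) + 1 / 6)) = W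
  rintro ⟨T1, T2⟩
  rcases lt_or_ge f δ with h | h
  · have := T2 h
    rw [fr (-δ) (-1) (by push_cast; linarith) (by push_cast; linarith)]
    have h3 : f * H ≤ δ * H := by gcongr
    have h4 : 0 ≤ f * H := by positivity
    push_cast
    have e : f - 1 / 2 - (2 * H * (f ^ 2 - f + 1 / 6) + -2 * H * ((f + -δ - -1) ^ 2 - (f + -δ - -1) + 1 / 6)) = 4 * (f * H) - 1 + δ / 2 := by
      linear_combination (-2 - 4 * f + 2 * δ) * hd
    rw [e, abs_le]; constructor <;> linarith
  · rw [fr (-δ) 0 (by push_cast; linarith) (by push_cast; linarith)]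
    push_cast
    have e : f - 1 / 2 - (2 * H * (f ^ 2 - f + 1 / 6) + -2 * H * ((f + -δ - 0) ^ 2 - (f + -δ - 0) + 1 / 6)) = δ / 2 := by
      linear_combination (2 - 4 * f + 2 * δ) * hd
    rw [e, abs_of_pos PP]; linarith

lemma nrm_sum (N : ℕ) (w : ℕ → ℂ) (hw : ∀ n, ‖w n‖ ≤ 1) (y : ℕ → ℝ) : ‖∑ n ∈ range N, w n * eC (y n)‖ ≤ N := by
  have h : ‖∑ n ∈ range N, w n * eC (y n)‖ ≤ ∑ n ∈ range N, (1 : ℝ) := norm_sum_le_of_le _ fun n _ => ?_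
  · simpa using h
  rw [norm_mul, norm_eC, mul_one]; exact hw n

lemma pi_bd : 18 ≤ 2 * π ^ 2 ∧ π ^ 2 ≤ 10 := by
  have := pi_gt_three
  have := pi_lt_d2
  constructor <;> nlinarith

lemma from2pi (S : ℂ) (R : ℝ) (h : ‖2 * (π : ℂ) ^ 2 * S‖ ≤ R) : ‖S‖ ≤ R / 18 := by
  have e : ‖2 * (π : ℂ) ^ 2 * S‖ = 2 * π ^ 2 * ‖S‖ := by
    rw [norm_mul, norm_mul, norm_pow, Complex.norm_real, norm_of_nonneg pi_pos.le]; simp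
  rw [e] at h
  rw [le_div_iff₀ (by norm_num)]
  refine le_trans ?_ h
  rw [mul_comm]
  exact mul_le_mul_of_nonneg_right pi_bd.1 (norm_nonneg _)

lemma mu3 (H j : ℝ) (hH : 1 ≤ H) (hj : 0 < j) : ‖∑ k : Fin 3, ((![H, -2 * H, H] k : ℝ) : ℂ) * eC (j * ![1 / (2 * H), 0, -(1 / (2 * H))] k)‖ ≤ 10 * H ∧ ‖∑ k : Fin 3, ((![H, -2 * H, H] k : ℝ) : ℂ) * eC (j * ![1 / (2 * H), 0, -(1 / (2 * H))] k)‖ ≤ 10 * (j * (j / H)) := by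
  have H0 : 0 < H := by linarith
  simp only [Fin.sum_univ_three, Matrix.cons_val]
  have e1 := eC_sub (j * (1 / (2 * H))) (j * (1 / (2 * H)))
  rw [sub_self, eC_zero] at e1
  have e : (H : ℂ) * eC (j * (1 / (2 * H))) + ((-2 * H : ℝ) : ℂ) * eC (j * 0) + H * eC (j * -(1 / (2 * H))) = H * ((eC (j * (1 / (2 * H))) - 1) * (1 - eC (-(j * (1 / (2 * H)))))) := by
    rw [mul_zero, eC_zero, mul_neg, eC_neg]; push_cast
    linear_combination (-H : ℂ) * e1
  have n2 : ‖(1 : ℂ) - eC (-(j * (1 / (2 * H))))‖ = ‖eC (j * (1 / (2 * H))) - 1‖ := by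
    rw [eC_neg, ← norm_neg, ← Complex.norm_conj]; simp
  rw [e, norm_mul, norm_mul, n2, Complex.norm_real, norm_of_nonneg H0.le]
  have b1 : ‖eC (j * (1 / (2 * H))) - 1‖ ≤ 2 := (norm_sub_le _ _).trans (by rw [norm_eC]; norm_num)
  have b2 := norm_eC_sub_one (j * (1 / (2 * H)))
  rw [abs_of_pos PP] at b2
  constructor
  · calc _ ≤ H * (2 * 2) := by gcongr
      _ ≤ _ := by linarith
  · calc _ ≤ H * ((2 * π * (j * (1 / (2 * H)))) * (2 * π * (j * (1 / (2 * H))))) := by gcongr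
      _ = π ^ 2 * (j * (j / H)) := by field_simp
      _ ≤ _ := by gcongr; exact pi_bd.2

lemma mu2 (H j : ℝ) (hH : 1 ≤ H) (hj : 0 < j) : ‖∑ k : Fin 2, ((![2 * H, -2 * H] k : ℝ) : ℂ) * eC (j * ![0, -(1 / (4 * H))] k)‖ ≤ 4 * H ∧ ‖∑ k : Fin 2, ((![2 * H, -2 * H] k : ℝ) : ℂ) * eC (j * ![0, -(1 / (4 * H))] k)‖ ≤ 4 * j := by
  have H0 : 0 < H := by linarith
  simp only [Fin.sum_univ_two, Matrix.cons_val]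
  have e : ((2 * H : ℝ) : ℂ) * eC (j * 0) + ((-2 * H : ℝ) : ℂ) * eC (j * -(1 / (4 * H))) = ((2 * H : ℝ) : ℂ) * (1 - eC (j * -(1 / (4 * H)))) := by
    rw [mul_zero, eC_zero]; push_cast; ring
  have b1 : ‖1 - eC (j * -(1 / (4 * H)))‖ ≤ 2 := (norm_sub_le _ _).trans (by rw [norm_eC]; norm_num)
  have b2 := norm_eC_sub_one (j * -(1 / (4 * H)))
  rw [norm_sub_rev, mul_neg, abs_neg, abs_of_pos PP, ← mul_neg] at b2
  rw [e, norm_mul, Complex.norm_real, norm_of_nonneg PP]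
  constructor
  · calc _ ≤ 2 * H * 2 := by gcongr
      _ = _ := by ring
  · calc _ ≤ 2 * H * (2 * π * (j * (1 / (4 * H)))) := by gcongr
      _ = π * j := by field_simp; norm_num
      _ ≤ _ := by gcongr; exact pi_le_four

lemma r_ineq (H j G m : ℝ) (hH : 1 ≤ H) (hj : 0 < j) (hG : 0 ≤ G) (m1 : m ≤ 4 * H) (m2 : m ≤ 4 * j) :
    m * (G * (2 + (j / H) ^ (~1 / 6))) ≤ 12 * (G * j) := by
  have H0 : 0 < H := by linarith
  have e : j = H * (j / H) := by field_simp
  have r0 : 0 < j / H := by positivity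
  rcases le_total (j / H) 1 with h | h
  · have := rpow_le_one r0.le h (by norm_num : ~0 ≤ 1 / 6)
    calc _ ≤ 4 * j * (G * (2 + 1)) := by gcongr
      _ = _ := by ring
  · have := rpow_le_rpow_of_exponent_le h (by norm_num : ~1 / 6 ≤ 1)
    rw [rpow_one] at this
    calc _ ≤ 4 * H * (G * (2 * (j / H) + j / H)) := by gcongr; linarith
      _ = _ := by field_simp; ring

lemma r_ineq3 (H j G m : ℝ) (hH : 1 ≤ H) (hj : 0 < j) (hG : 0 ≤ G) (m1 : m ≤ 10 * H) (m2 : m ≤ 10 * (j * (j / H))) :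
    m * (G * (1 + (j / H) ^ (~1 / 6) + (j / H) ^ (-~1 / 3))) ≤ 30 * (G * j) := by
  have H0 : 0 < H := by linarith
  have r0 : 0 < j / H := by positivity
  rcases le_total (j / H) 1 with h | h
  · have h1 := rpow_le_one r0.le h (by norm_num : ~0 ≤ 1 / 6)
    have h2 := rpow_le_one r0.le h (by norm_num : ~0 ≤ 1 + -1 / 3)
    rw [rpow_add r0, rpow_one] at h2
    have h3 : j / H * (j / H) ^ (~1 / 6) ≤ 1 * 1 := by gcongr
    calc _ ≤ 10 * (j * (j / H)) * (G * (1 + (j / H) ^ (~1 / 6) + (j / H) ^ (-~1 / 3))) := by gcongr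
      _ = 10 * (j * G) * (j / H + j / H * (j / H) ^ (~1 / 6) + j / H * (j / H) ^ (-~1 / 3)) := by ring
      _ ≤ 10 * (j * G) * (1 + 1 * 1 + 1) := by gcongr
      _ = _ := by ring
  · have h1 := rpow_le_rpow_of_exponent_le h (by norm_num : ~1 / 6 ≤ 1)
    have h2 := rpow_le_rpow_of_exponent_le h (by norm_num : -~1 / 3 ≤ 1)
    rw [rpow_one] at h1 h2
    calc _ ≤ 10 * H * (G * (j / H + j / H + j / H)) := by gcongr
      _ = _ := by field_simp; ring

lemma tent_sum (X N : ℕ) (y : ℕ → ℝ) (H G : ℝ) (hX : 1 ≤ X) (hN : N ≤ X) (hH : 1 ≤ H)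
    (hE : ∀ j : ℕ, 1 ≤ j → j ≤ X → ‖∑ n ∈ range N, eC (-(j * y n))‖ ≤ G * (1 + (j / H) ^ (~1 / 6) + (j / H) ^ (-~1 / 3))) :
    ∑ n ∈ range N, Tn H (y n) ≤ X / H + 7 * (G * (1 + log X)) + 3 * H := by
  have H0 : 0 < H := by linarith
  have X0 : ~1 ≤ X := by exact_mod_cast hX
  have N0 : ~N ≤ X := by exact_mod_cast hN
  have l0 := log_nonneg X0
  have hG : 0 ≤ G := by
    have h := (norm_nonneg _).trans (hE 1 le_rfl hX)
    exact nonneg_of_mul_nonneg_left h PP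
  have hc : ∀ j : ℕ, ‖∑ n ∈ range N, eC (j * y n)‖ = ‖∑ n ∈ range N, eC (-(j * y n))‖ := by
    intro j; rw [← Complex.norm_conj, map_sum]; simp only [← eC_neg]
  have hs := tail_bd _ _ X hX (60 * G) (20 * H * X) (hs_comb N (fun _ => 1) y ![H, -2 * H, H] ![1 / (2 * H), 0, -(1 / (2 * H))]) ?_ ?_
  · have h := from2pi _ _ hs
    simp only [one_mul, ← Complex.ofReal_sum, Complex.norm_real] at h
    have h2 := (neg_le_abs _).trans h
    simp only [Tn]
    rw [sum_sub_distrib, sum_const, card_range, nsmul_eq_mul]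
    have e : 20 * H * X * (2 / ~X) = 40 * H := by field_simp; norm_num
    have e2 : N * (1 / (2 * H)) ≤ X / H := by
      rw [div_eq_mul_one_div ~X]; gcongr; linarith
    rw [e] at h2
    have : 0 ≤ G * (1 + log X) := by positivity
    linarith
  · intro j j1 j2
    have j0 : ~0 < j := by exact_mod_cast j1
    obtain ⟨m1, m2⟩ := mu3 H j hH j0
    have := r_ineq3 H j G _ hH j0 hG m1 m2
    simp only [one_mul]
    refine (norm_add_le _ _).trans ?_
    rw [norm_mul, norm_mul, Complex.norm_conj, hc]
    have := (mul_le_mul_of_nonneg_left (hE j j1 j2) (norm_nonneg _)).trans this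
    linarith
  · intro j j1
    have j0 : ~0 < j := by exact_mod_cast (by omega : 0 < j)
    obtain ⟨m1, m2⟩ := mu3 H j hH j0
    refine (norm_add_le _ _).trans ?_
    rw [norm_mul, norm_mul, Complex.norm_conj]
    have a1 := (nrm_sum N (fun _ => 1) (by simp) (fun n => j * y n)).trans N0
    have a2 := (nrm_sum N (fun _ => 1) (by simp) (fun n => -(j * y n))).trans N0
    calc _ ≤ 10 * H * X + 10 * H * X := by gcongr
      _ = _ := by ring

lemma psi_sum (X N : ℕ) (w : ℕ → ℂ) (hw : ∀ n, ‖w n‖ ≤ 1) (y z : ℕ → ℝ) (H G : ℝ) (hX : 1 ≤ X) (hN : N ≤ X) (hH : 1 ≤ H)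
    (hP : ∀ j : ℕ, 1 ≤ j → j ≤ X → ‖∑ n ∈ range N, w n * eC (j * y n) - ∑ n ∈ range N, w n * eC (j * z n)‖ ≤ G * (2 + (j / H) ^ (~1 / 6)))
    (hQ : ∀ j : ℕ, 1 ≤ j → j ≤ X → ‖∑ n ∈ range N, w n * eC (-(j * y n)) - ∑ n ∈ range N, w n * eC (-(j * z n))‖ ≤ G * (2 + (j / H) ^ (~1 / 6))) :
    ‖∑ n ∈ range N, w n * ((Dn H (y n) - Dn H (z n) : ℝ) : ℂ)‖ ≤ 3 * (G * (1 + log X)) + 2 * H := by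
  have H0 : 0 < H := by linarith
  have X0 : ~1 ≤ X := by exact_mod_cast hX
  have N0 : ~N ≤ X := by exact_mod_cast hN
  have l0 := log_nonneg X0
  have hG : 0 ≤ G := by
    have h := (norm_nonneg _).trans (hP 1 le_rfl hX)
    exact nonneg_of_mul_nonneg_left h PP
  have hs := (hs_comb N w y ![2 * H, -2 * H] ![0, -(1 / (4 * H))]).sub (hs_comb N w z ![2 * H, -2 * H] ![0, -(1 / (4 * H))])
  simp only [← mul_sub, ← sum_sub_distrib] at hs
  have hs := tail_bd _ _ X hX (24 * G) (16 * H * X) hs ?_ ?_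
  · have h := from2pi _ _ hs
    have e : 16 * H * X * (2 / ~X) = 32 * H := by field_simp; norm_num
    rw [e] at h
    have : 0 ≤ G * (1 + log X) := by positivity
    simp only [Dn, Complex.ofReal_sub]
    linarith
  · intro j j1 j2
    have j0 : ~0 < j := by exact_mod_cast j1
    obtain ⟨m1, m2⟩ := mu2 H j hH j0
    have := r_ineq H j G _ hH j0 hG m1 m2
    rw [add_sub_add_comm, ← mul_sub, ← mul_sub]
    refine (norm_add_le _ _).trans ?_
    rw [norm_mul, norm_mul, Complex.norm_conj]
    have a1 := (mul_le_mul_of_nonneg_left (hP j j1 j2) (norm_nonneg _)).trans this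
    have a2 := (mul_le_mul_of_nonneg_left (hQ j j1 j2) (norm_nonneg _)).trans this
    linarith
  · intro j j1
    have j0 : ~0 < j := by exact_mod_cast (by omega : 0 < j)
    obtain ⟨m1, m2⟩ := mu2 H j hH j0
    have a := fun y => (nrm_sum N w hw y).trans N0
    rw [add_sub_add_comm, ← mul_sub, ← mul_sub]
    refine (norm_add_le _ _).trans ?_
    rw [norm_mul, norm_mul, Complex.norm_conj]
    have b1 := (norm_sub_le _ _).trans (add_le_add (a fun n => j * y n) (a fun n => j * z n))
    have b2 := (norm_sub_le _ _).trans (add_le_add (a fun n => -(j * y n)) (a fun n => -(j * z n)))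
    calc _ ≤ 4 * H * (X + X) + 4 * H * (X + X) := by gcongr
      _ = _ := by ring

lemma fr_sum (X N : ℕ) (w : ℕ → ℂ) (hw : ∀ n, ‖w n‖ ≤ 1) (y z : ℕ → ℝ) (H G : ℝ) (hX : 1 ≤ X) (hN : N ≤ X) (hH : 1 ≤ H)
    (hy : ∀ j : ℕ, 1 ≤ j → j ≤ X → ‖∑ n ∈ range N, eC (-(j * y n))‖ ≤ G * (1 + (j / H) ^ (~1 / 6) + (j / H) ^ (-~1 / 3)))
    (hz : ∀ j : ℕ, 1 ≤ j → j ≤ X → ‖∑ n ∈ range N, eC (-(j * z n))‖ ≤ G * (1 + (j / H) ^ (~1 / 6) + (j / H) ^ (-~1 / 3)))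
    (hP : ∀ j : ℕ, 1 ≤ j → j ≤ X → ‖∑ n ∈ range N, w n * eC (j * y n) - ∑ n ∈ range N, w n * eC (j * z n)‖ ≤ 13 * G * (2 + (j / H) ^ (~1 / 6)))
    (hQ : ∀ j : ℕ, 1 ≤ j → j ≤ X → ‖∑ n ∈ range N, w n * eC (-(j * y n)) - ∑ n ∈ range N, w n * eC (-(j * z n))‖ ≤ 13 * G * (2 + (j / H) ^ (~1 / 6))) :
    ‖∑ n ∈ range N, w n * ((Int.fract (y n) - Int.fract (z n) : ℝ) : ℂ)‖ ≤ 67 * (G * (1 + log X)) + 14 * H + 5 * (X / H) := by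
  have H0 : 0 < H := by linarith
  have N0 : ~N ≤ X := by exact_mod_cast hN
  have a := psi_sum X N w hw y z H (13 * G) hX hN hH hP hQ
  have b := tent_sum X N y H G hX hN hH hy
  have c := tent_sum X N z H G hX hN hH hz
  have e : ∑ n ∈ range N, w n * ((Int.fract (y n) - Int.fract (z n) : ℝ) : ℂ) = ∑ n ∈ range N, w n * ((Dn H (y n) - Dn H (z n) : ℝ) : ℂ) + ∑ n ∈ range N, w n * (((Int.fract (y n) - 1 / 2 - Dn H (y n)) - (Int.fract (z n) - 1 / 2 - Dn H (z n)) : ℝ) : ℂ) := by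
    rw [← sum_add_distrib]
    refine sum_congr rfl fun n _ => ?_
    push_cast; ring
  have f : ‖∑ n ∈ range N, w n * (((Int.fract (y n) - 1 / 2 - Dn H (y n)) - (Int.fract (z n) - 1 / 2 - Dn H (z n)) : ℝ) : ℂ)‖ ≤ ∑ n ∈ range N, (1 / (4 * H) + 2 * Tn H (y n) + 2 * Tn H (z n)) := by
    refine norm_sum_le_of_le _ fun n _ => ?_
    have p1 := psi_pt H (y n) hH
    have p2 := psi_pt H (z n) hH
    rw [norm_mul, Complex.norm_real, norm_eq_abs]
    have e : 1 / (4 * H) = 1 / (8 * H) + 1 / (8 * H) := by field_simp; norm_num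
    calc _ ≤ 1 * (|Int.fract (y n) - 1 / 2 - Dn H (y n)| + |Int.fract (z n) - 1 / 2 - Dn H (z n)|) := by gcongr; exacts [hw n, abs_sub _ _]
      _ ≤ _ := by rw [e]; linarith
  rw [sum_add_distrib, sum_add_distrib, sum_const, card_range, nsmul_eq_mul, ← mul_sum, ← mul_sum] at f
  have e2 : N * (1 / (4 * H)) ≤ X / H := by
    rw [div_eq_mul_one_div ~X]; gcongr; linarith
  rw [e]
  refine (norm_add_le _ _).trans ?_
  linarith

lemma diff_bd (d X N j : ℕ) (γ θ G R : ℝ) (h0 : 0 < γ) (h1 : γ < 1) (hX : 1 ≤ X) (hN : N ≤ X) (hj : 1 ≤ j) (hG : 0 ≤ G) (hR : 0 ≤ R)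
    (hE : ∀ κ N : ℕ, κ ≤ 1 → N ≤ X → ‖∑ n ∈ range N, eC (j * ~(X + n + κ : ℕ) ^ γ + θ * ~(X + n : ℕ) ^ d)‖ ≤ G * (1 + R + (j * ~X ^ (γ - 1)) ^ (-~1 / 3))) :
    ‖∑ n ∈ range N, eC (j * ~(X + n + 1 : ℕ) ^ γ + θ * ~(X + n : ℕ) ^ d) - ∑ n ∈ range N, eC (j * ~(X + n : ℕ) ^ γ + θ * ~(X + n : ℕ) ^ d)‖ ≤ 13 * G * (2 + R) := by
  have X0 : ~0 < X := by exact_mod_cast hX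
  have j0 : ~0 < j := by exact_mod_cast hj
  obtain ⟨T, hT⟩ : ∃ T, T = j * ~X ^ (γ - 1) := ⟨_, rfl⟩
  have T0 : 0 < T := by rw [hT]; positivity
  rw [← hT] at hE
  rcases le_total 1 T with h | h
  · have t1 : T ^ (-~1 / 3) ≤ 1 := rpow_le_one_of_one_le_of_nonpos h (by norm_num)
    have a := hE 1 N le_rfl hN
    have b := hE 0 N OO hN
    simp only [add_zero] at b
    calc _ ≤ G * (1 + R + 1) + G * (1 + R + 1) := (norm_sub_le _ _).trans (add_le_add (a.trans (by gcongr)) (b.trans (by gcongr)))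
      _ ≤ _ := by
        have : 0 ≤ G * (2 + R) := by positivity
        linarith
  · obtain ⟨φ, hφ⟩ : ∃ φ : ℕ → ℝ, φ = fun n => ((X + n : ℕ) + 1 : ℝ) ^ γ - ~(X + n : ℕ) ^ γ := ⟨_, rfl⟩
    have pb := fun n : ℕ => phi_bd γ h0 h1 ~(X + n : ℕ) (by exact_mod_cast (by omega : 0 < X + n))
    have hb0 : ∀ n, 0 ≤ φ n := fun n => by rw [hφ]; exact le_trans PP (pb n).1
    have hba : ∀ n, φ (n + 1) ≤ φ n := fun n => by
      rw [hφ]; refine (pb (n + 1)).2.trans (le_trans (le_of_eq ?_) (pb n).1)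
      congr 2; push_cast; ring
    have hb1 : ∀ n, φ n ≤ ~X ^ (γ - 1) := fun n => by
      rw [hφ]; refine (pb n).2.trans ?_
      calc _ ≤ 1 * ~X ^ (γ - 1) := by
            refine mul_le_mul h1.le ?_ PP zero_le_one
            exact rpow_le_rpow_of_nonpos X0 (by exact_mod_cast (by omega : X ≤ X + n)) LL
        _ = _ := one_mul _
    have ab := abel_bd (fun n => eC (j * φ n) - 1) (fun n => eC (j * ~(X + n : ℕ) ^ γ + θ * ~(X + n : ℕ) ^ d)) (fun n => -(2 * π * (j * φ n))) N _
      (fun M hM => by simpa only [add_zero] using hE 0 M OO (hM.trans hN)) (fun i => by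
        rw [sub_sub_sub_cancel_right]
        refine (norm_eC_sub _ _).trans (le_of_eq ?_)
        rw [← mul_sub, abs_mul, abs_of_pos j0, abs_of_nonpos (by linarith [hba i])]; ring)
    have e : ∑ n ∈ range N, eC (j * ~(X + n + 1 : ℕ) ^ γ + θ * ~(X + n : ℕ) ^ d) - ∑ n ∈ range N, eC (j * ~(X + n : ℕ) ^ γ + θ * ~(X + n : ℕ) ^ d) = ∑ n ∈ range N, (eC (j * φ n) - 1) * eC (j * ~(X + n : ℕ) ^ γ + θ * ~(X + n : ℕ) ^ d) := by
      rw [← sum_sub_distrib]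
      refine sum_congr rfl fun n _ => ?_
      rw [sub_mul, one_mul, ← eC_add, hφ]
      congr 2; push_cast; ring
    rw [e]
    refine ab.trans ?_
    have n1 := norm_eC_sub_one (j * φ (N - 1))
    rw [abs_of_nonneg (mul_nonneg j0.le (hb0 _))] at n1
    have n2 : 2 * π * (j * φ 0) ≤ 2 * π * T := by rw [hT]; gcongr; exact hb1 0
    have t2 : T * T ^ (-~1 / 3) ≤ 1 := by
      nth_rewrite 1 [← rpow_one T]
      rw [← rpow_add T0]; exact rpow_le_one T0.le h (by norm_num)
    calc _ ≤ (2 * π * T) * (G * (1 + R + T ^ (-~1 / 3))) := by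
          gcongr; linarith
      _ = 2 * π * G * (T * (1 + R) + T * T ^ (-~1 / 3)) := by ring
      _ ≤ 2 * 4 * G * (1 * (1 + R) + 1) := by gcongr; exact pi_le_four
      _ ≤ _ := by
        have : 0 ≤ G * (2 + R) := by positivity
        linarith

lemma win_fr (d : ℕ) (γ τ : ℝ) (h0 : 0 < γ) (h1 : γ < 1) (hE : EH d γ τ) (t1 : τ ≤ γ) (t2 : 1 / 2 ≤ τ) (ε : ℝ) (hε : 0 < ε) :
    ∃ C : ℝ, 1 ≤ C ∧ ∀ (X N : ℕ) (θ : ℝ), 1 ≤ X → N ≤ X →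
      ‖∑ n ∈ range N, eC (θ * ~(X + n : ℕ) ^ d) * ((Int.fract (-~(X + n + 1 : ℕ) ^ γ) - Int.fract (-~(X + n : ℕ) ^ γ) : ℝ) : ℂ)‖ ≤ C * ~X ^ (τ + ε) := by
  obtain ⟨C, hC, h⟩ := hE (ε / 2) PP
  refine ⟨67 * C * (1 + 1 / (ε / 2)) + 19, ?_, fun X N θ hX hN => ?_⟩
  · have : 0 ≤ 67 * C * (1 + 1 / (ε / 2)) := by positivity
    linarith
  have X1 : ~1 ≤ X := by exact_mod_cast hX
  have X0 : ~0 < X := by linarith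
  have hH : 1 ≤ ~X ^ (1 - τ) := one_le_rpow X1 LL
  have hG : 0 ≤ C * ~X ^ (τ + ε / 2) := by positivity
  have hT : ∀ j : ℕ, 1 ≤ j → (j * ~X ^ (γ - 1)) ^ (-~1 / 3) ≤ (j / ~X ^ (1 - τ)) ^ (-~1 / 3) := by
    intro j hj
    have j0 : ~0 < j := by exact_mod_cast hj
    refine rpow_le_rpow_of_nonpos PP ?_ (by norm_num)
    rw [div_eq_mul_inv, ← rpow_neg X0.le]
    gcongr; linarith
  have hz := fun (κ : ℕ) (hκ : κ ≤ 1) (j : ℕ) (j1 : 1 ≤ j) (j2 : j ≤ X) => (h X j κ N 0 hX j1 j2 hκ hN).trans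
    (mul_le_mul_of_nonneg_left (add_le_add_right (hT j j1) _) hG)
  have hd := fun (θ : ℝ) (j : ℕ) (j1 : 1 ≤ j) (j2 : j ≤ X) => diff_bd d X N j γ θ _ ((j / ~X ^ (1 - τ)) ^ (~1 / 6)) h0 h1 hX hN j1 hG PP
    (fun κ M hκ hM => h X j κ M θ hX j1 j2 hκ hM)
  have ec : ∀ (κ j : ℕ), ∑ n ∈ range N, eC (θ * ~(X + n : ℕ) ^ d) * eC (-(j * -~(X + n + κ : ℕ) ^ γ)) = ∑ n ∈ range N, eC (j * ~(X + n + κ : ℕ) ^ γ + θ * ~(X + n : ℕ) ^ d) := by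
    intro κ j; refine sum_congr rfl fun n _ => ?_
    rw [← eC_add]; congr 1; ring
  have ed : ∀ (κ j : ℕ), ∑ n ∈ range N, eC (θ * ~(X + n : ℕ) ^ d) * eC (j * -~(X + n + κ : ℕ) ^ γ) = (starRingEnd ℂ) (∑ n ∈ range N, eC (j * ~(X + n + κ : ℕ) ^ γ + -θ * ~(X + n : ℕ) ^ d)) := by
    intro κ j; rw [map_sum]; refine sum_congr rfl fun n _ => ?_
    rw [← eC_add, ← eC_neg]; congr 1; ring
  have hf := fr_sum X N (fun n => eC (θ * ~(X + n : ℕ) ^ d)) (fun n => (norm_eC _).le) (fun n => -~(X + n + 1 : ℕ) ^ γ) (fun n => -~(X + n : ℕ) ^ γ) _ _ hX hN hH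
    (by simpa only [zero_mul, add_zero, mul_neg, neg_neg] using hz 1 le_rfl)
    (by simpa only [zero_mul, add_zero, mul_neg, neg_neg] using hz 0 OO)
    (fun j j1 j2 => by
      have := ed 0 j
      simp only [add_zero] at this
      rw [ed 1 j, this, ← map_sub, Complex.norm_conj]; exact hd _ j j1 j2)
    (fun j j1 j2 => by
      have := ec 0 j
      simp only [add_zero] at this
      rw [ec 1 j, this]; exact hd _ j j1 j2)
  refine hf.trans ?_
  have l := log_eps (ε / 2) PP X X1
  have e1 : ~X / ~X ^ (1 - τ) ≤ ~X ^ (τ + ε) := by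
    nth_rewrite 1 [← rpow_one ~X]
    rw [← rpow_sub X0]; gcongr; linarith
  have e2 : ~X ^ (1 - τ) ≤ ~X ^ (τ + ε) := by gcongr; linarith
  have e3 : ~X ^ (τ + ε) = ~X ^ (τ + ε / 2) * ~X ^ (ε / 2) := by rw [← rpow_add X0]; congr 1; ring
  calc _ ≤ 67 * (C * ~X ^ (τ + ε / 2) * ((1 + 1 / (ε / 2)) * ~X ^ (ε / 2))) + 14 * ~X ^ (τ + ε) + 5 * ~X ^ (τ + ε) := by gcongr
    _ = _ := by rw [e3]; ring

lemma ps_ind (c : ℝ) (hc : 1 < c) (m : ℕ) (hm : 1 ≤ m) :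
    (if m ∈ PS c then (1 : ℝ) else 0) = ((m + 1 : ℝ) ^ (1 / c) - ~m ^ (1 / c)) + (Int.fract (-~(m + 1 : ℕ) ^ (1 / c)) - Int.fract (-~m ^ (1 / c))) := by
  have c0 : 0 < c := by linarith
  have g0 : 0 < 1 / c := by positivity
  have g1 : 1 / c < 1 := by rw [div_lt_one c0]; exact hc
  have m0 : ~1 ≤ m := by exact_mod_cast hm
  have pb := phi_bd (1 / c) g0 g1 m LL
  have m1 : ~m ^ (1 / c - 1) ≤ 1 := rpow_le_one_of_one_le_of_nonpos m0 LL
  have p2 : (~m + 1) ^ (1 / c) - ~m ^ (1 / c) < 1 := by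
    refine pb.2.trans_lt ?_
    calc _ ≤ 1 / c * 1 := by gcongr
      _ < 1 := by linarith
  have p1 : ~m ^ (1 / c) ≤ (~m + 1) ^ (1 / c) := by gcongr; linarith
  have p0 : 0 < ~m ^ (1 / c) := by positivity
  have key : m ∈ PS c ↔ ∃ n : ℤ, ~m ^ (1 / c) ≤ n ∧ ~n < (~m + 1) ^ (1 / c) := by
    have k1 : ∀ n : ℝ, 0 ≤ n → (~m ^ (1 / c) ≤ n ↔ ~m ≤ n ^ c) := fun n hn => by
      rw [one_div, rpow_inv_le_iff_of_pos PP hn c0]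
    have k2 : ∀ n : ℝ, 0 ≤ n → (n < (~m + 1) ^ (1 / c) ↔ n ^ c < m + 1) := fun n hn => by
      rw [one_div, lt_rpow_inv_iff_of_pos hn PP c0]
    constructor
    · rintro ⟨n, hn, e⟩
      have := (Nat.floor_eq_iff (by positivity : ~0 ≤ ~n ^ c)).1 e.symm
      refine ⟨n, ?_⟩
      rw [Int.cast_natCast, k1 _ PP, k2 _ PP]
      exact this
    · rintro ⟨n, n1, n2⟩
      have n0 : ~0 < n := p0.trans_le n1
      lift n to ℕ using (by exact_mod_cast n0.le)
      rw [Int.cast_natCast] at *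
      refine ⟨n, by exact_mod_cast n0, ?_⟩
      symm
      rw [Nat.floor_eq_iff PP]
      rw [k1 _ n0.le] at n1
      rw [k2 _ n0.le] at n2
      exact ⟨n1, n2⟩
  push_cast
  rw [Int.fract, Int.fract, Int.floor_neg, Int.floor_neg]
  push_cast
  generalize ~m ^ (1 / c) = α at *
  generalize (~m + 1) ^ (1 / c) = β at *
  have a1 := Int.le_ceil α
  have a2 := Int.ceil_lt_add_one α
  have b1 := Int.le_ceil β
  have b2 := Int.ceil_lt_add_one β
  have ab : ⌈α⌉ ≤ ⌈β⌉ := Int.ceil_mono p1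
  split_ifs with h
  · obtain ⟨n, n1, n2⟩ := key.1 h
    have q1 := Int.ceil_le.2 n1
    have q2 := Int.lt_ceil.2 n2
    have q3 : ⌈β⌉ < ⌈α⌉ + 2 := by
      have : (⌈β⌉ : ℝ) < ⌈α⌉ + 2 := by linarith
      exact_mod_cast this
    have : (⌈β⌉ : ℝ) = ⌈α⌉ + 1 := by exact_mod_cast (by omega : ⌈β⌉ = ⌈α⌉ + 1)
    linarith
  · have : ⌈β⌉ = ⌈α⌉ := by
      by_contra hne
      exact h (key.2 ⟨⌈α⌉, a1, Int.lt_ceil.1 OO⟩)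
    rw [this]; ring

def aps (c : ℝ) (m : ℕ) : ℝ := (if m ∈ PS c then (1 : ℝ) else 0) - 1 / c * ~m ^ (1 / c - 1)

lemma win_A (d : ℕ) (c τ : ℝ) (hc : 1 < c) (hE : EH d (1 / c) τ) (t1 : τ ≤ 1 / c) (t2 : 1 / 2 ≤ τ) (ε : ℝ) (hε : 0 < ε) :
    ∃ C : ℝ, 1 ≤ C ∧ ∀ (X N : ℕ) (θ : ℝ), 1 ≤ X → N ≤ X →
      ‖∑ n ∈ range N, eC (θ * ~(X + n : ℕ) ^ d) * (aps c (X + n) : ℂ)‖ ≤ C * ~X ^ (τ + ε) := by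
  have c0 : 0 < c := by linarith
  have g0 : 0 < 1 / c := by positivity
  have g1 : 1 / c < 1 := by rw [div_lt_one c0]; exact hc
  obtain ⟨C, hC, h⟩ := win_fr d (1 / c) τ g0 g1 hE t1 t2 ε hε
  refine ⟨C + 1, by linarith, fun X N θ hX hN => ?_⟩
  have X1 : ~1 ≤ X := by exact_mod_cast hX
  have e : ∀ n : ℕ, aps c (X + n) = (Int.fract (-~(X + n + 1 : ℕ) ^ (1 / c)) - Int.fract (-~(X + n : ℕ) ^ (1 / c))) + ((~(X + n : ℕ) + 1) ^ (1 / c) - ~(X + n : ℕ) ^ (1 / c) - 1 / c * ~(X + n : ℕ) ^ (1 / c - 1)) := by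
    intro n; rw [aps, ps_ind c hc _ OO]; ring
  simp only [e, Complex.ofReal_add _ (_ - _ - _), mul_add, sum_add_distrib]
  refine (norm_add_le _ _).trans ?_
  rw [add_mul, one_mul]
  refine add_le_add (h X N θ hX hN) ?_
  refine le_trans (?_ : _ ≤ ~1) (one_le_rpow X1 LL)
  have pb := fun n : ℕ => phi_bd (1 / c) g0 g1 ~(X + n : ℕ) (by exact_mod_cast (by omega : 0 < X + n))
  calc _ ≤ ∑ n ∈ range N, (1 / c * ~(X + n : ℕ) ^ (1 / c - 1) - 1 / c * ((X + (n + 1) : ℕ) : ℝ) ^ (1 / c - 1)) := by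
        refine norm_sum_le_of_le _ fun n _ => ?_
        rw [norm_mul, norm_eC, one_mul, Complex.norm_real, norm_of_nonpos (by linarith [(pb n).2])]
        have := (pb n).1
        rw [show ((X + (n + 1) : ℕ) : ℝ) = ~(X + n : ℕ) + 1 by push_cast; ring]
        linarith
    _ ≤ 1 / c * ~(X + 0 : ℕ) ^ (1 / c - 1) := by
        rw [sum_range_sub' (fun n => 1 / c * ~(X + n : ℕ) ^ (1 / c - 1))]
        have : 0 ≤ 1 / c * ~(X + N : ℕ) ^ (1 / c - 1) := by positivity
        linarith
    _ ≤ 1 * 1 := by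
        refine mul_le_mul g1.le ?_ PP zero_le_one
        exact rpow_le_one_of_one_le_of_nonpos (by exact_mod_cast hX) LL
    _ = 1 := one_mul _

lemma dyad (f : ℕ → ℂ) (C s : ℝ) (hC : 0 ≤ C) (hs : 1 / 2 ≤ s)
    (h : ∀ X N : ℕ, 1 ≤ X → N ≤ X → ‖∑ n ∈ range N, f (X + n)‖ ≤ C * ~X ^ s) (y : ℕ) :
    ‖∑ n ∈ range y, f (n + 1)‖ ≤ 4 * C * ~y ^ s := by
  induction y using Nat.strong_induction_on with
  | _ y ih =>
  rcases Nat.eq_zero_or_pos y with rfl | hy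
  · rw [range_zero, sum_empty, norm_zero]; positivity
  have a := ih (y / 2) OO
  have b := h (y / 2 + 1) (y - y / 2) OO OO
  have e : ∑ n ∈ range y, f (n + 1) = ∑ n ∈ range (y / 2), f (n + 1) + ∑ n ∈ range (y - y / 2), f (y / 2 + 1 + n) := by
    conv_lhs => rw [show y = y / 2 + (y - y / 2) by omega, sum_range_add]
    congr 1
    refine sum_congr rfl fun n _ => ?_
    congr 1; ring
  have p1 : ~(y / 2 + 1 : ℕ) ^ s ≤ ~y ^ s := by gcongr; omega
  have p2 : ~(y / 2 : ℕ) ^ s ≤ 3 / 4 * ~y ^ s := by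
    have q : (~1 / 2) ^ s ≤ 3 / 4 := by
      calc _ ≤ (~1 / 2) ^ (~1 / 2) := rpow_le_rpow_of_exponent_ge (by norm_num) (by norm_num) hs
        _ ≤ _ := by rw [← sqrt_eq_rpow, sqrt_le_left (by norm_num)]; norm_num
    calc _ ≤ (~1 / 2 * y) ^ s := by
          gcongr; have := Nat.cast_div_le (α := ℝ) (m := y) (n := 2); push_cast at this; linarith
      _ = (~1 / 2) ^ s * ~y ^ s := mul_rpow (by norm_num) PP
      _ ≤ _ := by gcongr
  rw [e]
  calc _ ≤ 4 * C * (3 / 4 * ~y ^ s) + C * ~y ^ s := (norm_add_le _ _).trans (add_le_add (a.trans (by gcongr)) (b.trans (by gcongr)))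
    _ = _ := by ring

theorem stmt10 (d : ℕ) (hd : 2 ≤ d) (c : ℝ) (hc1 : 1 < c) (hc2 : c < 1 + c3ps d)
    (ε : ℝ) (hε : 0 < ε) :
    ∃ C : ℝ, 0 < C ∧ ∀ x : ℕ, 2 ≤ x → ∀ θ : ℝ, 0 ≤ θ → θ < 1 →
      ‖(∑ m ∈ (Finset.Icc 1 x).filter (· ∈ PS c),
            ((c * (m : ℝ) ^ ((d : ℝ) - 1 / c) : ℝ) : ℂ) * eC ((m : ℝ) ^ d * θ)) -
          ∑ m ∈ Finset.Icc 1 x, (((m : ℝ) ^ (d - 1) : ℝ) : ℂ) * eC ((m : ℝ) ^ d * θ)‖ ≤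
        C * (x : ℝ) ^ ((d : ℝ) - (1 - θdc d c) / c + ε) := by
  obtain ⟨hE, t1, t2⟩ := params d hd c hc1 hc2
  obtain ⟨C, hC, h⟩ := win_A d c _ hc1 hE t1 t2 ε hε
  have c0 : 0 < c := by linarith
  have g1 : 1 / c < 1 := by rw [div_lt_one c0]; exact hc1
  have d2 : ~2 ≤ d := by exact_mod_cast hd
  refine ⟨8 * c * C, by positivity, fun x hx θ _ _ => ?_⟩
  have x0 : ~0 < x := by exact_mod_cast (by omega : 0 < x)
  have hd := dyad (fun m => eC (θ * ~m ^ d) * (aps c m : ℂ)) C (1 / c * θdc d c + ε) LL LL (fun X N hX hN => h X N θ hX hN)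
  have ab := abel_bd (fun n => ((c * ~(n + 1 : ℕ) ^ (~d - 1 / c) : ℝ) : ℂ)) (fun n => eC (θ * ~(n + 1 : ℕ) ^ d) * (aps c (n + 1) : ℂ)) (fun n => c * ~(n + 1 : ℕ) ^ (~d - 1 / c)) x _
    (fun M hM => (hd M).trans (by gcongr : _ ≤ 4 * C * ~x ^ (1 / c * θdc d c + ε))) (fun i => by
      rw [← Complex.ofReal_sub, Complex.norm_real, norm_of_nonneg]
      have : ~(i + 1 : ℕ) ^ (~d - 1 / c) ≤ ~(i + 1 + 1 : ℕ) ^ (~d - 1 / c) := by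
        gcongr
        · linarith
        · omega
      have := mul_le_mul_of_nonneg_left this c0.le
      linarith)
  have e : (∑ m ∈ (Icc 1 x).filter (· ∈ PS c), ((c * ~m ^ (~d - 1 / c) : ℝ) : ℂ) * eC (~m ^ d * θ)) - ∑ m ∈ Icc 1 x, ((~m ^ (d - 1) : ℝ) : ℂ) * eC (~m ^ d * θ) = ∑ n ∈ range x, ((c * ~(n + 1 : ℕ) ^ (~d - 1 / c) : ℝ) : ℂ) * (eC (θ * ~(n + 1 : ℕ) ^ d) * (aps c (n + 1) : ℂ)) := by
    have r : ∀ g : ℕ → ℂ, ∑ n ∈ range x, g (n + 1) = ∑ m ∈ Icc 1 x, g m := fun g => by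
      rw [range_eq_Ico, sum_Ico_add' g 0 x 1]
      congr 1
    rw [sum_filter, ← sum_sub_distrib, r (fun m : ℕ => ((c * ~m ^ (~d - 1 / c) : ℝ) : ℂ) * (eC (θ * ~m ^ d) * (aps c m : ℂ)))]
    refine sum_congr rfl fun m hm => ?_
    have m0 : ~0 < m := by exact_mod_cast (mem_Icc.1 hm).1
    have p : c * ~m ^ (~d - 1 / c) * (1 / c * ~m ^ (1 / c - 1)) = ~m ^ (d - 1) := by
      rw [← rpow_natCast, Nat.cast_sub OO]
      rw [show c * ~m ^ (~d - 1 / c) * (1 / c * ~m ^ (1 / c - 1)) = ~m ^ (~d - 1 / c) * ~m ^ (1 / c - 1) by field_simp, ← rpow_add m0]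
      congr 1; push_cast; ring
    rw [← p, aps, mul_comm θ]
    split_ifs <;> push_cast <;> ring
  rw [e]
  refine ab.trans ?_
  rw [show x - 1 + 1 = x by omega, Complex.norm_real, norm_of_nonneg PP]
  have z : 0 ≤ c * ~(0 + 1 : ℕ) ^ (~d - 1 / c) := by positivity
  have ee : ~x ^ (~d - (1 - θdc d c) / c + ε) = ~x ^ (~d - 1 / c) * ~x ^ (1 / c * θdc d c + ε) := by
    rw [← rpow_add x0]; congr 1; ring
  calc _ ≤ (2 * (c * ~x ^ (~d - 1 / c))) * (4 * C * ~x ^ (1 / c * θdc d c + ε)) := by gcongr; linarith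
    _ = _ := by rw [ee]; ring
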